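/- Let Ω be as in the context with n ≥ 2, and let S be a Szegő kernel for Ω. Then S is not rational: there do not exist polynomials P, Q ∈ ℂ[X,Y] with Q ≠ 0 such that S(z,w)·Q(z, conj(w)) = P(z, conj(w)) for all z, w ∈ Ω. -/

import Mathlib

open MeasureTheory Complex Set Metric ComplexConjugate Filter

noncomputable section

/-- `Ω` is a bounded domain whose complement has exactly `n` connected components and whose
boundary is the disjoint union of the images of `n` curves `γ j` that are `C^∞`, `1`-periodic,
injective on `[0,1)`, and have nowhere-vanishing derivative. -/
structure IsSmoothMultiplyConnectedDomain (n : ℕ) (Ω : Set ℂ) (γ : Fin n → ℝ → ℂ) : Prop where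
  nonempty : Ω.Nonempty
  isOpen : IsOpen Ω
  isConnected : IsConnected Ω
  isBounded : Bornology.IsBounded Ω
  ncomponents : {C : Set ℂ | ∃ z ∈ Ωᶜ, C = connectedComponentIn Ωᶜ z}.ncard = n
  smooth : ∀ j, ContDiff ℝ (⊤ : ℕ∞) (γ j)
  periodic : ∀ j, Function.Periodic (γ j) 1
  injOn : ∀ j, Set.InjOn (γ j) (Set.Ico (0:ℝ) 1)
  deriv_ne : ∀ j t, deriv (γ j) t ≠ 0
  boundary_eq : frontier Ω = ⋃ j, Set.range (γ j)
  disjointImages : ∀ j k, j ≠ k → Disjoint (Set.range (γ j)) (Set.range (γ k))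

/-- `S` is a Szegő kernel for `Ω`: holomorphic in its first variable, hermitian, and
reproducing holomorphic functions from boundary integrals against arc length measure
(one-dimensional Hausdorff measure restricted to the boundary). -/
structure IsSzegoKernel (Ω : Set ℂ) (S : ℂ → ℂ → ℂ) : Prop where
  continuousOn : ∀ a ∈ Ω, ContinuousOn (fun z => S z a) (closure Ω)
  holo : ∀ a ∈ Ω, DifferentiableOn ℂ (fun z => S z a) Ω
  hermitian : ∀ z ∈ Ω, ∀ w ∈ Ω, S z w = conj (S w z)
  reproducing : ∀ h : ℂ → ℂ, ContinuousOn h (closure Ω) → DifferentiableOn ℂ h Ω →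
    ∀ a ∈ Ω, h a = ∫ ζ in frontier Ω, h ζ * conj (S ζ a) ∂μH[1]

open MeasureTheory Complex Set Metric ComplexConjugate Filter
open scoped ENNReal NNReal

theorem SK.antilip_hausdorff {f : ℝ → ℂ} {s : Set ℝ} {k : ℝ} (hk : 0 < k)
    (h : ∀ x ∈ s, ∀ y ∈ s, k * dist x y ≤ dist (f x) (f y)) :
    ENNReal.ofReal k * volume s ≤ μH[1] (f '' s) := by
  have h1 : AntilipschitzWith (Real.toNNReal k)⁻¹ (s.domRestrict f) := by
    refine AntilipschitzWith.of_le_mul_dist ?_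
    rintro ⟨x, hx⟩ ⟨y, hy⟩
    have := h x hx y hy
    simp only [NNReal.coe_inv, Real.coe_toNNReal k hk.le, Set.domRestrict_apply]
    rw [Subtype.dist_eq, inv_mul_eq_div, le_div_iff₀ hk]
    linarith
  have h2 := h1.le_hausdorffMeasure_image (d := 1) zero_le_one univ
  have h3 : μH[1] (univ : Set s) = volume s := by
    rw [← hausdorffMeasure_real, ← (isometry_subtype_coe (s := s)).hausdorffMeasure_image (Or.inl zero_le_one)]
    simp
  rw [h3] at h2
  have h4 : s.domRestrict f '' univ = f '' s := by
    rw [image_univ, Set.range_domRestrict]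
  rw [h4] at h2
  have h5 : ((Real.toNNReal k)⁻¹ : ℝ≥0) = ((ENNReal.ofReal k)⁻¹ : ℝ≥0∞) := by
    rw [ENNReal.coe_inv]; rfl
    simpa using hk
  rw [ENNReal.rpow_one, h5] at h2
  calc _ ≤ ENNReal.ofReal k * ((ENNReal.ofReal k)⁻¹ * μH[1] (f '' s)) := by gcongr
    _ = _ := by
      rw [← mul_assoc, ENNReal.mul_inv_cancel, one_mul]
      · simpa using hk
      · simp

theorem SK.lip_hausdorff {f : ℝ → ℂ} {s : Set ℝ} {k : ℝ} (hk : 0 ≤ k)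
    (h : ∀ x ∈ s, ∀ y ∈ s, dist (f x) (f y) ≤ k * dist x y) :
    μH[1] (f '' s) ≤ ENNReal.ofReal k * volume s := by
  have h1 : LipschitzOnWith (Real.toNNReal k) f s := by
    refine LipschitzOnWith.of_dist_le_mul ?_
    intro x hx y hy
    simpa [Real.coe_toNNReal k hk] using h x hx y hy
  have h2 := h1.hausdorffMeasure_image_le (d := 1) zero_le_one
  rw [ENNReal.rpow_one, hausdorffMeasure_real] at h2
  exact h2

theorem SK.short_est {γ : ℝ → ℂ} (hγ : ContDiff ℝ 1 γ) {I s : Set ℝ} (hI : Convex ℝ I)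
    (hs : MeasurableSet s) (hsI : s ⊆ I) {t0 : ℝ} {ε : ℝ} (hε : 0 < ε)
    (hd : ∀ t ∈ I, ‖deriv γ t - deriv γ t0‖ ≤ ε) :
    μH[1] (γ '' s) ≤ (∫⁻ t in s, ‖deriv γ t‖ₑ) + ENNReal.ofReal (2 * ε) * volume s ∧
    (∫⁻ t in s, ‖deriv γ t‖ₑ) ≤ μH[1] (γ '' s) + ENNReal.ofReal (2 * ε) * volume s := by
  have hdiff : Differentiable ℝ γ := hγ.differentiable (by norm_num)
  have key : ∀ x ∈ I, ∀ y ∈ I, ‖γ y - γ x - (y - x) • deriv γ t0‖ ≤ ε * ‖y - x‖ := by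
    intro x hx y hy
    have := hI.norm_image_sub_le_of_norm_hasDerivWithin_le (f := fun t => γ t - t • deriv γ t0)
      (f' := fun t => deriv γ t - deriv γ t0) (C := ε) (fun t ht => ?_) hd hx hy
    · have e : γ y - γ x - (y - x) • deriv γ t0 =
          γ y - y • deriv γ t0 - (γ x - x • deriv γ t0) := by
        rw [sub_smul]; ring
      rw [e]; exact this
    · have h1 := (hdiff t).hasDerivAt
      have h2 : HasDerivAt (fun t : ℝ => t • deriv γ t0) ((1:ℝ) • deriv γ t0) t :=
        (hasDerivAt_id t).smul_const _
      rw [one_smul] at h2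
      exact (h1.sub h2).hasDerivWithinAt
  set c := ‖deriv γ t0‖ with hc
  have up : ∀ x ∈ s, ∀ y ∈ s, dist (γ x) (γ y) ≤ (c + ε) * dist x y := by
    intro x hx y hy
    have h1 := key y (hsI hy) x (hsI hx)
    rw [dist_eq_norm, dist_eq_norm]
    have h2 := norm_le_norm_add_norm_sub' (γ x - γ y) ((x - y) • deriv γ t0)
    rw [norm_smul] at h2
    nlinarith
  have lo : ∀ x ∈ s, ∀ y ∈ s, (c - ε) * dist x y ≤ dist (γ x) (γ y) := by
    intro x hx y hy
    have h1 := key y (hsI hy) x (hsI hx)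
    rw [dist_eq_norm, dist_eq_norm]
    have h2 := norm_le_norm_add_norm_sub' ((x - y) • deriv γ t0) (γ x - γ y)
    rw [norm_smul, norm_sub_rev ((x - y) • deriv γ t0)] at h2
    nlinarith
  have hb1 : ∀ t ∈ s, ENNReal.ofReal c ≤ ‖deriv γ t‖ₑ + ENNReal.ofReal ε := by
    intro t ht
    rw [← ofReal_norm, ← ENNReal.ofReal_add (norm_nonneg _) hε.le]
    apply ENNReal.ofReal_le_ofReal
    have := hd t (hsI ht)
    have h2 := norm_le_norm_add_norm_sub (deriv γ t) (deriv γ t0)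
    linarith
  have hb2 : ∀ t ∈ s, ‖deriv γ t‖ₑ ≤ ENNReal.ofReal (c + ε) := by
    intro t ht
    rw [← ofReal_norm]
    apply ENNReal.ofReal_le_ofReal
    have := hd t (hsI ht)
    have h2 := norm_le_norm_add_norm_sub' (deriv γ t) (deriv γ t0)
    linarith
  have hmeas : Measurable (fun t => ‖deriv γ t‖ₑ) := (measurable_deriv γ).enorm
  constructor
  · refine (SK.lip_hausdorff (by positivity) up).trans ?_
    have : ENNReal.ofReal c * volume s ≤ (∫⁻ t in s, ‖deriv γ t‖ₑ) + ENNReal.ofReal ε * volume s := by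
      rw [← setLIntegral_const, ← setLIntegral_const, ← lintegral_add_right _ measurable_const]
      exact setLIntegral_mono (hmeas.add measurable_const) hb1
    rw [ENNReal.ofReal_add (norm_nonneg _) hε.le, add_mul, two_mul, ENNReal.ofReal_add hε.le hε.le,
      add_mul, ← add_assoc]
    gcongr
  · have h1 : (∫⁻ t in s, ‖deriv γ t‖ₑ) ≤ ENNReal.ofReal (c + ε) * volume s := by
      rw [← setLIntegral_const]
      exact setLIntegral_mono measurable_const hb2
    refine h1.trans ?_
    rcases le_or_gt c ε with h | h
    · refine le_trans ?_ le_add_self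
      gcongr
      linarith
    · have h2 := SK.antilip_hausdorff (sub_pos.2 h) lo
      have h3 : c + ε = (c - ε) + 2 * ε := by ring
      rw [h3, ENNReal.ofReal_add (sub_pos.2 h).le (by positivity), add_mul]
      gcongr

theorem SK.arc_set {γ : ℝ → ℂ} (hγ : ContDiff ℝ 1 γ) (hinj : InjOn γ (Ico (0:ℝ) 1))
    {s : Set ℝ} (hs : MeasurableSet s) (hsI : s ⊆ Ico (0:ℝ) 1) :
    μH[1] (γ '' s) = ∫⁻ t in s, ‖deriv γ t‖ₑ := by
  have main : ∀ ε : ℝ, 0 < ε →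
    μH[1] (γ '' s) ≤ (∫⁻ t in s, ‖deriv γ t‖ₑ) + ENNReal.ofReal (2 * ε) * volume s ∧
    (∫⁻ t in s, ‖deriv γ t‖ₑ) ≤ μH[1] (γ '' s) + ENNReal.ofReal (2 * ε) * volume s := by
    intro ε hε
    have hcont : Continuous (deriv γ) := hγ.continuous_deriv (by norm_num)
    have huc := isCompact_Icc.uniformContinuousOn_of_continuous (s := Icc (0:ℝ) 1) hcont.continuousOn
    rw [Metric.uniformContinuousOn_iff] at huc
    obtain ⟨δ, hδ, huc⟩ := huc ε hε
    obtain ⟨N, hN⟩ := exists_nat_one_div_lt hδ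
    have hNpos : (0:ℝ) < (N:ℝ) + 1 := by positivity
    let J : ℕ → Set ℝ := fun k => Ico ((k:ℝ) / (N + 1)) (((k:ℝ) + 1) / (N + 1))
    have hJd : (↑(Finset.range (N+1)) : Set ℕ).PairwiseDisjoint (fun k => s ∩ J k) := by
      intro i _ j _ hij
      rw [Function.onFun, Set.disjoint_left]
      rintro x ⟨_, hx1, hx2⟩ ⟨_, hy1, hy2⟩
      rw [div_le_iff₀ hNpos] at hx1 hy1
      rw [lt_div_iff₀ hNpos] at hx2 hy2
      apply hij
      have h1 : (i:ℝ) < j + 1 := by linarith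
      have h2 : (j:ℝ) < i + 1 := by linarith
      norm_cast at h1 h2
      omega
    have hcov : s = ⋃ k ∈ Finset.range (N+1), s ∩ J k := by
      ext x
      simp only [mem_iUnion, mem_inter_iff, Finset.mem_range, exists_prop]
      constructor
      · intro hx
        have hx' := hsI hx
        have hx0 : 0 ≤ x * (N+1) := mul_nonneg hx'.1 hNpos.le
        refine ⟨⌊x * (N+1)⌋₊, ?_, hx, ?_⟩
        · rw [Nat.floor_lt hx0]
          push_cast
          nlinarith [hx'.2]
        · constructor
          · rw [div_le_iff₀ hNpos]; exact Nat.floor_le hx0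
          · rw [lt_div_iff₀ hNpos]; exact Nat.lt_floor_add_one _
      · rintro ⟨k, _, hx, _⟩; exact hx
    have hms : ∀ k ∈ Finset.range (N+1), MeasurableSet (s ∩ J k) := fun k _ => hs.inter measurableSet_Ico
    have hJI : ∀ k ∈ Finset.range (N+1), J k ⊆ Icc 0 1 := by
      intro k hk x hx
      have hk' : ((k:ℝ)+1) ≤ N + 1 := by
        have := Finset.mem_range.1 hk
        exact_mod_cast this
      refine ⟨le_trans (by positivity) hx.1, hx.2.le.trans ?_⟩
      rw [div_le_one hNpos]; exact hk'
    have e1 : μH[1] (γ '' s) = ∑ k ∈ Finset.range (N+1), μH[1] (γ '' (s ∩ J k)) := by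
      conv_lhs => rw [hcov]
      rw [image_iUnion₂, measure_biUnion_finset]
      · intro i hi j hj hij
        have := hJd hi hj hij
        rw [Function.onFun] at this ⊢
        rw [Set.disjoint_left]
        rintro _ ⟨x, hx, rfl⟩ ⟨y, hy, hxy⟩
        have := hinj (hsI hy.1) (hsI hx.1) hxy
        subst this
        exact Set.disjoint_left.1 ‹_› hx hy
      · intro k hk
        exact (hms k hk).image_of_continuousOn_injOn hγ.continuous.continuousOn
          (hinj.mono (inter_subset_left.trans hsI))
    have e2 : ∫⁻ t in s, ‖deriv γ t‖ₑ = ∑ k ∈ Finset.range (N+1), ∫⁻ t in s ∩ J k, ‖deriv γ t‖ₑ := by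
      conv_lhs => rw [hcov]
      rw [lintegral_biUnion_finset hJd hms]
    have e3 : volume s = ∑ k ∈ Finset.range (N+1), volume (s ∩ J k) := by
      conv_lhs => rw [hcov]
      rw [measure_biUnion_finset hJd hms]
    have hest := fun k (hk : k ∈ Finset.range (N+1)) =>
      SK.short_est hγ (I := J k) (convex_Ico _ _) (hms k hk) inter_subset_right (t0 := (k:ℝ)/(N+1)) hε
      (fun t ht => by
        have h0 : (k:ℝ)/(N+1) ∈ J k := ⟨le_rfl, by gcongr; linarith⟩
        have := huc t (hJI k hk ht) _ (hJI k hk h0) (by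
          rw [Real.dist_eq, abs_of_nonneg (sub_nonneg.2 ht.1)]
          have := ht.2
          rw [add_div] at this
          linarith)
        rw [dist_eq_norm] at this
        exact this.le)
    rw [e1, e2, e3, Finset.mul_sum, ← Finset.sum_add_distrib, ← Finset.sum_add_distrib]
    exact ⟨Finset.sum_le_sum fun k hk => (hest k hk).1, Finset.sum_le_sum fun k hk => (hest k hk).2⟩
  have hvol : volume s ≤ 1 := by
    calc volume s ≤ volume (Ico (0:ℝ) 1) := measure_mono hsI
      _ = 1 := by simp
  apply le_antisymm
  · refine ENNReal.le_of_forall_pos_le_add fun ε hε _ => ?_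
    refine (main (ε/2) (by positivity)).1.trans ?_
    gcongr
    calc _ ≤ ENNReal.ofReal (2 * (ε/2)) * 1 := by gcongr
      _ = ε := by rw [mul_one, mul_div_cancel₀ _ (by norm_num)]; simp
  · refine ENNReal.le_of_forall_pos_le_add fun ε hε _ => ?_
    refine (main (ε/2) (by positivity)).2.trans ?_
    gcongr
    calc _ ≤ ENNReal.ofReal (2 * (ε/2)) * 1 := by gcongr
      _ = ε := by rw [mul_one, mul_div_cancel₀ _ (by norm_num)]; simp

theorem SK.range_eq {γ : ℝ → ℂ} (hp : Function.Periodic γ 1) : range γ = γ '' Ico (0:ℝ) 1 := by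
  ext x
  constructor
  · rintro ⟨t, rfl⟩
    obtain ⟨y, hy, hxy⟩ := hp.exists_mem_Ico₀ one_pos t
    exact ⟨y, hy, hxy.symm⟩
  · rintro ⟨t, _, rfl⟩
    exact ⟨t, rfl⟩

theorem SK.map_eq {γ : ℝ → ℂ} (hγ : ContDiff ℝ 1 γ) (hinj : InjOn γ (Ico (0:ℝ) 1))
    (hp : Function.Periodic γ 1) :
    (μH[1] : Measure ℂ).restrict (range γ) =
      Measure.map γ ((volume.restrict (Ico (0:ℝ) 1)).withDensity (fun t => ‖deriv γ t‖ₑ)) := by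
  ext B hB
  rw [Measure.map_apply hγ.continuous.measurable hB, Measure.restrict_apply hB,
    withDensity_apply _ (hγ.continuous.measurable hB), Measure.restrict_restrict (hγ.continuous.measurable hB),
    ← SK.arc_set hγ hinj ((hγ.continuous.measurable hB).inter measurableSet_Ico) inter_subset_right,
    SK.range_eq hp, image_preimage_inter]

open MeasureTheory Complex Set Metric ComplexConjugate Filter Topology
open scoped ENNReal NNReal Interval

structure SK.Curve (γ : ℝ → ℂ) : Prop where
  smooth : ContDiff ℝ 2 γ
  periodic : Function.Periodic γ 1
  inj : ∀ s t, γ s = γ t → ∃ k : ℤ, s = t + k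
  deriv_ne : ∀ t, deriv γ t ≠ 0

namespace SK

theorem Curve.of_injOn {γ : ℝ → ℂ} (h1 : ContDiff ℝ 2 γ) (h2 : Function.Periodic γ 1)
    (h3 : InjOn γ (Ico (0:ℝ) 1)) (h4 : ∀ t, deriv γ t ≠ 0) : Curve γ := by
  refine ⟨h1, h2, ?_, h4⟩
  intro s t hst
  have e : ∀ x : ℝ, γ x = γ (Int.fract x) := by
    intro x
    have := h2.sub_int_mul_eq (x := x) ⌊x⌋
    rw [mul_one] at this
    rw [← this]; rfl
  have := h3 ⟨Int.fract_nonneg s, Int.fract_lt_one s⟩ ⟨Int.fract_nonneg t, Int.fract_lt_one t⟩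
    (by rw [← e, ← e, hst])
  refine ⟨⌊s⌋ - ⌊t⌋, ?_⟩
  have a := Int.fract_add_floor s
  have b := Int.fract_add_floor t
  push_cast
  linarith

theorem Curve.injOn {γ : ℝ → ℂ} (h : Curve γ) : InjOn γ (Ico (0:ℝ) 1) := by
  intro s hs t ht hst
  obtain ⟨k, hk⟩ := h.inj s t hst
  have : k = 0 := by
    have h1 : (k:ℝ) < 1 := by linarith [hs.1, hs.2, ht.1, ht.2]
    have h2 : (-1:ℝ) < k := by linarith [hs.1, hs.2, ht.1, ht.2]
    have h1' : k < 1 := by exact_mod_cast h1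
    have h2' : -1 < k := by exact_mod_cast h2
    omega
  simpa [this] using hk

theorem Curve.differentiable {γ : ℝ → ℂ} (h : Curve γ) : Differentiable ℝ γ :=
  h.smooth.differentiable (by norm_num)
theorem Curve.continuous {γ : ℝ → ℂ} (h : Curve γ) : Continuous γ := h.smooth.continuous
theorem Curve.contDiff_deriv {γ : ℝ → ℂ} (h : Curve γ) : ContDiff ℝ 1 (deriv γ) := by
  have := h.smooth
  rw [show (2 : WithTop ℕ∞) = 1 + 1 by norm_num, contDiff_succ_iff_deriv] at this
  exact this.2.2
theorem Curve.continuous_deriv {γ : ℝ → ℂ} (h : Curve γ) : Continuous (deriv γ) :=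
  h.contDiff_deriv.continuous
theorem Curve.hasDerivAt {γ : ℝ → ℂ} (h : Curve γ) (t : ℝ) : HasDerivAt γ (deriv γ t) t :=
  (h.differentiable t).hasDerivAt
theorem Curve.deriv_periodic {γ : ℝ → ℂ} (h : Curve γ) : Function.Periodic (deriv γ) 1 := by
  intro t
  have := deriv_comp_add_const γ (1:ℝ) t
  rw [← this]
  congr 1
  funext x
  exact h.periodic x
theorem Curve.range_eq {γ : ℝ → ℂ} (h : Curve γ) (a : ℝ) : range γ = γ '' Icc a (a+1) := by
  ext x
  constructor
  · rintro ⟨t, rfl⟩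
    obtain ⟨y, hy, hxy⟩ := h.periodic.exists_mem_Ico one_pos t a
    exact ⟨y, Ico_subset_Icc_self hy, hxy.symm⟩
  · rintro ⟨t, _, rfl⟩
    exact ⟨t, rfl⟩
theorem Curve.isCompact_range {γ : ℝ → ℂ} (h : Curve γ) : IsCompact (range γ) := by
  rw [h.range_eq 0]
  exact isCompact_Icc.image h.continuous

/-- the integral formula -/
theorem Curve.integral {γ : ℝ → ℂ} (h : Curve γ) (f : ℂ → ℂ) (hf : ContinuousOn f (range γ)) :
    ∫ ζ in range γ, f ζ ∂μH[1] = ∫ t in (0:ℝ)..1, (‖deriv γ t‖ : ℂ) * f (γ t) := by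
  have hm := SK.map_eq (h.smooth.of_le (by norm_num)) h.injOn h.periodic
  have hf' : AEStronglyMeasurable f ((μH[1] : Measure ℂ).restrict (range γ)) :=
    hf.aestronglyMeasurable h.isCompact_range.measurableSet
  rw [hm] at hf' ⊢
  rw [integral_map h.continuous.aemeasurable hf']
  have : (fun t => ‖deriv γ t‖ₑ) = (fun t => ((‖deriv γ t‖₊ : ℝ≥0) : ℝ≥0∞)) := rfl
  rw [this, integral_withDensity_eq_integral_smul (measurable_deriv γ).nnnorm,
    intervalIntegral.integral_of_le zero_le_one, integral_Ico_eq_integral_Ioc]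
  congr 1

theorem Curve.measure_lt_top {γ : ℝ → ℂ} (h : Curve γ) : μH[1] (range γ) < ⊤ := by
  have := SK.arc_set (h.smooth.of_le (by norm_num)) h.injOn measurableSet_Ico subset_rfl
  rw [← SK.range_eq h.periodic] at this
  rw [this]
  obtain ⟨C, hC⟩ := isCompact_Icc.exists_bound_of_continuousOn (s := Icc (0:ℝ) 1) h.continuous_deriv.continuousOn
  calc ∫⁻ t in Ico (0:ℝ) 1, ‖deriv γ t‖ₑ ≤ ∫⁻ t in Ico (0:ℝ) 1, ENNReal.ofReal C := by
        apply setLIntegral_mono measurable_const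
        intro t ht
        rw [← ofReal_norm]
        exact ENNReal.ofReal_le_ofReal (hC t (Ico_subset_Icc_self ht))
    _ < ⊤ := by simp

/-- reversed curve -/
theorem Curve.rev {γ : ℝ → ℂ} (h : Curve γ) : Curve (fun t => γ (-t)) ∧
    (∀ t, deriv (fun t => γ (-t)) t = - deriv γ (-t)) ∧ range (fun t => γ (-t)) = range γ := by
  have hd : ∀ t, deriv (fun t => γ (-t)) t = - deriv γ (-t) := fun t => deriv_comp_neg γ t
  refine ⟨⟨h.smooth.comp contDiff_neg, ?_, ?_, ?_⟩, hd, ?_⟩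
  · intro t
    have := h.periodic (-t-1)
    simp only [neg_add, ← sub_eq_add_neg]
    rw [← this]; congr 1; ring
  · intro s t hst
    obtain ⟨k, hk⟩ := h.inj _ _ hst
    exact ⟨-k, by push_cast; linarith⟩
  · intro t; rw [hd]; exact neg_ne_zero.2 (h.deriv_ne _)
  · ext x; constructor
    · rintro ⟨t, rfl⟩; exact ⟨-t, rfl⟩
    · rintro ⟨t, rfl⟩; exact ⟨-t, by simp⟩

/-- winding integral -/
noncomputable def Wn (γ : ℝ → ℂ) (w : ℂ) : ℂ := ∫ t in (0:ℝ)..1, deriv γ t / (γ t - w)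

theorem Curve.intervalIntegrable {γ : ℝ → ℂ} (h : Curve γ) {w : ℂ} (hw : w ∉ range γ) (a b : ℝ) :
    IntervalIntegrable (fun t => deriv γ t / (γ t - w)) volume a b := by
  apply Continuous.intervalIntegrable
  refine h.continuous_deriv.div (h.continuous.sub continuous_const) ?_
  intro t ht
  exact hw ⟨t, sub_eq_zero.1 ht⟩

theorem Curve.Wn_eq {γ : ℝ → ℂ} (h : Curve γ) (w : ℂ) (a : ℝ) :
    Wn γ w = ∫ t in a..a+1, deriv γ t / (γ t - w) := by
  have : Function.Periodic (fun t => deriv γ t / (γ t - w)) 1 := by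
    intro t; simp only [h.deriv_periodic t, h.periodic t]
  have := this.intervalIntegral_add_eq 0 a
  rw [zero_add] at this
  exact this

theorem Curve.Wn_loc {γ : ℝ → ℂ} (h : Curve γ) {w0 : ℂ} (hw : w0 ∉ range γ) :
    ∀ᶠ w in 𝓝 w0, Wn γ w = Wn γ w0 := by
  have hopen : IsOpen (range γ)ᶜ := h.isCompact_range.isClosed.isOpen_compl
  obtain ⟨r, hr, hball⟩ := Metric.isOpen_iff.1 hopen w0 hw
  filter_upwards [Metric.ball_mem_nhds w0 hr] with w hwr
  have hfar : ∀ t, r ≤ ‖γ t - w0‖ := by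
    intro t
    by_contra hlt
    push Not at hlt
    exact hball (by rw [mem_ball, dist_eq_norm]; exact hlt) ⟨t, rfl⟩
  have hw' : w ∉ range γ := hball hwr
  have hne0 : ∀ t, γ t - w0 ≠ 0 := fun t ht => hw ⟨t, sub_eq_zero.1 ht⟩
  have hne : ∀ t, γ t - w ≠ 0 := fun t ht => hw' ⟨t, sub_eq_zero.1 ht⟩
  have hslit : ∀ t, (γ t - w) / (γ t - w0) ∈ slitPlane := by
    intro t
    apply Complex.ball_one_subset_slitPlane
    rw [mem_ball, dist_eq_norm]
    have : (γ t - w) / (γ t - w0) - 1 = (w0 - w) / (γ t - w0) := by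
      field_simp [hne0 t]; ring
    rw [this, norm_div, div_lt_one (norm_pos_iff.2 (hne0 t))]
    refine lt_of_lt_of_le ?_ (hfar t)
    rw [mem_ball, dist_eq_norm] at hwr
    rwa [norm_sub_rev]
  have hder : ∀ t, HasDerivAt (fun t => Complex.log ((γ t - w) / (γ t - w0)))
      (deriv γ t / (γ t - w) - deriv γ t / (γ t - w0)) t := by
    intro t
    have := (((h.hasDerivAt t).sub_const w).div ((h.hasDerivAt t).sub_const w0) (hne0 t)).clog_real (hslit t)
    refine this.congr_deriv ?_
    simp only [Pi.div_apply]
    have := hne0 t; have := hne t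
    field_simp
  have hintg := intervalIntegral.integral_eq_sub_of_hasDerivAt (a := 0) (b := 1) (fun t _ => hder t)
    ((h.intervalIntegrable hw' 0 1).sub (h.intervalIntegrable hw 0 1))
  rw [intervalIntegral.integral_sub (h.intervalIntegrable hw' 0 1) (h.intervalIntegrable hw 0 1)] at hintg
  have h01 : γ 1 = γ 0 := by simpa using h.periodic 0
  simp only [h01, sub_self] at hintg
  exact sub_eq_zero.1 hintg

theorem const_of_loc {f : ℂ → ℂ} {s : Set ℂ} (hs : IsPreconnected s)
    (hf : ∀ z ∈ s, ∀ᶠ w in 𝓝 z, f w = f z) : ∀ x ∈ s, ∀ y ∈ s, f x = f y := by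
  have := Subtype.preconnectedSpace hs
  have : IsLocallyConstant (fun z : s => f z) := by
    rw [IsLocallyConstant.iff_eventually_eq]
    rintro ⟨z, hz⟩
    exact (continuous_subtype_val.tendsto (⟨z, hz⟩ : s)).eventually (hf z hz)
  intro x hx y hy
  exact this.apply_eq_of_preconnectedSpace ⟨x, hx⟩ ⟨y, hy⟩

theorem Curve.near {γ : ℝ → ℂ} (h : Curve γ) (t0 : ℝ) : ∃ m > 0,
    (∀ t ∈ Icc t0 (t0 + 1/2), ‖(γ t - γ t0) / deriv γ t0‖ < m → t ≠ t0 → 0 < ((γ t - γ t0) / deriv γ t0).re) ∧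
    (∀ t ∈ Icc (t0 - 1/2) t0, ‖(γ t - γ t0) / deriv γ t0‖ < m → t ≠ t0 → ((γ t - γ t0) / deriv γ t0).re < 0) ∧
    m ≤ ‖(γ (t0 + 1/2) - γ t0) / deriv γ t0‖ := by
  set y : ℝ → ℂ := fun t => (γ t - γ t0) / deriv γ t0 with hy
  have hyd : HasDerivAt y 1 t0 := by
    have := ((h.hasDerivAt t0).sub_const (γ t0)).div_const (deriv γ t0)
    rwa [div_self (h.deriv_ne t0)] at this
  have hycont : Continuous y := (h.continuous.sub continuous_const).div_const _
  have hlit := hyd.isLittleO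
  have hbd := hlit.bound (c := 1/2) (by norm_num)
  obtain ⟨δ, hδ, hball⟩ := Metric.eventually_nhds_iff_ball.1 hbd
  set δ' := min δ (1/2) with hδ'
  have hδ'0 : 0 < δ' := lt_min hδ (by norm_num)
  set K : Set ℝ := Icc (t0 - 1/2) (t0 + 1/2) \ Ioo (t0 - δ') (t0 + δ') with hK
  have hKc : IsCompact K := isCompact_Icc.diff isOpen_Ioo
  have hKne : K.Nonempty := ⟨t0 + 1/2, ⟨by constructor <;> linarith, by
    rintro ⟨_, h2⟩; linarith [min_le_right δ (1/2)]⟩⟩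
  obtain ⟨t1, ht1, hmin⟩ := hKc.exists_isMinOn hKne hycont.norm.continuousOn
  have hpos : 0 < ‖y t1‖ := by
    rw [norm_pos_iff]
    intro h0
    simp only [hy, div_eq_zero_iff, h.deriv_ne t0, or_false] at h0
    obtain ⟨k, hk⟩ := h.inj _ _ (sub_eq_zero.1 h0)
    have hk1 : (k:ℝ) < 1 := by linarith [ht1.1.2]
    have hk2 : (-1:ℝ) < k := by linarith [ht1.1.1]
    have hk1' : k < 1 := by exact_mod_cast hk1
    have hk2' : -1 < k := by exact_mod_cast hk2
    have : k = 0 := by omega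
    subst this
    apply ht1.2
    rw [hk]; simp; exact hδ'0
  have hest : ∀ t, t ∈ Ioo (t0 - δ') (t0 + δ') → |(y t).re - (t - t0)| ≤ 1/2 * |t - t0| := by
    intro t ht
    have := hball t (by
      rw [mem_ball, Real.dist_eq, abs_lt]
      constructor <;> linarith [ht.1, ht.2, min_le_left δ (1/2)])
    have e : y t0 = 0 := by simp [hy]
    rw [e, sub_zero, Real.norm_eq_abs] at this
    refine le_trans ?_ this
    have := Complex.abs_re_le_norm (y t - (t - t0) • (1:ℂ))
    simpa using this
  refine ⟨‖y t1‖, hpos, ?_, ?_, ?_⟩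
  · intro t ht hlt hne
    have htI : t ∈ Ioo (t0 - δ') (t0 + δ') := by
      by_contra hnot
      have := hmin ⟨⟨by linarith [ht.1], ht.2⟩, hnot⟩
      simp only [mem_ofPred_eq] at this
      exact absurd hlt (not_lt.2 this)
    have hgt : 0 < t - t0 := by
      rcases lt_or_eq_of_le ht.1 with h' | h'
      · linarith
      · exact absurd h'.symm hne
    have := hest t htI
    rw [abs_of_pos hgt, abs_le] at this
    linarith [this.1]
  · intro t ht hlt hne
    have htI : t ∈ Ioo (t0 - δ') (t0 + δ') := by
      by_contra hnot
      have := hmin ⟨⟨ht.1, by linarith [ht.2]⟩, hnot⟩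
      simp only [mem_ofPred_eq] at this
      exact absurd hlt (not_lt.2 this)
    have hgt : t - t0 < 0 := by
      rcases lt_or_eq_of_le ht.2 with h' | h'
      · linarith
      · exact absurd h' hne
    have := hest t htI
    rw [abs_of_neg hgt, abs_le] at this
    linarith [this.2]
  · refine hmin ⟨by constructor <;> linarith, ?_⟩
    rintro ⟨_, h2⟩; linarith [min_le_right δ (1/2)]

theorem slit_aux {y : ℂ} {s : ℝ} (hs : 0 < s) (h1 : ‖y‖ = s → 0 < y.re) :
    y + I * s ≠ 0 ∧ y - I * s ≠ 0 ∧ I * ((y - I * s) / (y + I * s)) ∈ slitPlane := by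
  have ha : y + I * s ≠ 0 := by
    intro h
    have : y = - (I * s) := by linear_combination h
    have h2 := h1 (by rw [this]; simp [abs_of_pos hs])
    rw [this] at h2; simp at h2
  have hb : y - I * s ≠ 0 := by
    intro h
    have : y = (I * s) := by linear_combination h
    have h2 := h1 (by rw [this]; simp [abs_of_pos hs])
    rw [this] at h2; simp at h2
  refine ⟨ha, hb, ?_⟩
  by_contra hns
  rw [Complex.mem_slitPlane_iff] at hns
  push Not at hns
  obtain ⟨hre, him⟩ := hns
  set r := -(I * ((y - I * s) / (y + I * s))).re with hr
  have hr0 : 0 ≤ r := by linarith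
  have e : I * ((y - I * s) / (y + I * s)) = -(r:ℂ) := by
    apply Complex.ext
    · simp [hr]
    · rw [him]; simp
  have e2 : I * (y - I * s) = -(r:ℂ) * (y + I * s) := by
    rw [← e]; field_simp
  have er := congrArg Complex.re e2
  have ei := congrArg Complex.im e2
  simp at er ei
  have hb1 : y.im = s + r * y.re ∨ True := Or.inr trivial
  -- er : -y.im + s = -r * y.re ; ei : y.re = -(r * (y.im + s))
  have hre' : y.re * (1 + r^2) = -2 * r * s := by nlinarith
  have him' : y.im * (1 + r^2) = s * (1 - r^2) := by nlinarith
  have hp : 0 < 1 + r^2 := by positivity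
  have hn : ‖y‖ = s := by
    have : ‖y‖^2 = s^2 := by
      rw [Complex.sq_norm, Complex.normSq_apply]
      have : (y.re * y.re + y.im * y.im) * (1 + r^2)^2 = s^2 * (1 + r^2)^2 := by
        calc _ = (y.re * (1 + r^2))^2 + (y.im * (1+r^2))^2 := by ring
          _ = _ := by rw [hre', him']; ring
      exact mul_right_cancel₀ (pow_ne_zero 2 hp.ne') this
    exact (pow_left_inj₀ (norm_nonneg _) hs.le two_ne_zero).1 this
  have := h1 hn
  nlinarith [mul_pos this hp, mul_nonneg hr0 hs.le]

theorem slit_aux' {y : ℂ} {s : ℝ} (hs : 0 < s) (h1 : ‖y‖ = s → y.re < 0) :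
    y + I * s ≠ 0 ∧ y - I * s ≠ 0 ∧ -I * ((y - I * s) / (y + I * s)) ∈ slitPlane := by
  obtain ⟨a, b, c⟩ := slit_aux (y := -(conj y)) hs (by intro h; simpa using h1 (by simpa using h))
  have ha : y + I * s ≠ 0 := by
    intro h
    apply a
    have := congrArg conj h
    simp at this
    linear_combination -this
  have hb : y - I * s ≠ 0 := by
    intro h
    apply b
    have := congrArg conj h
    simp at this
    linear_combination -this
  refine ⟨ha, hb, ?_⟩
  have e : -I * ((y - I * s) / (y + I * s)) = conj (I * ((-(conj y) - I * s) / (-(conj y) + I * s))) := by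
    simp only [map_mul, map_div₀, map_sub, map_add, map_neg, conj_I, conj_conj, conj_ofReal]
    congr 1
    rw [← neg_div_neg_eq]
    congr 1 <;> ring
  rw [e]
  rw [Complex.mem_slitPlane_iff] at c ⊢
  rw [conj_re, conj_im, neg_ne_zero]
  exact c

end SK

open MeasureTheory Complex Set Metric ComplexConjugate Filter Topology
open scoped ENNReal NNReal Interval
namespace SK

theorem log_jump {q : ℂ} (hq : 0 < q.re) :
    Complex.log (I * q) - Complex.log (-I * q) = Real.pi * I := by
  have hq0 : q ≠ 0 := by rintro rfl; simp at hq
  have harg : |q.arg| < Real.pi / 2 := Complex.abs_arg_lt_pi_div_two_iff.2 (Or.inl hq)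
  rw [abs_lt] at harg
  rw [Complex.log_mul I_ne_zero hq0 (by rw [arg_I]; constructor <;> linarith [Real.pi_pos]),
    Complex.log_mul (neg_ne_zero.2 I_ne_zero) hq0 (by rw [arg_neg_I]; constructor <;> linarith [Real.pi_pos]),
    Complex.log_I, Complex.log_neg_I]
  ring

theorem Curve.jump {γ : ℝ → ℂ} (h : Curve γ) (t0 : ℝ) : ∃ s0 > (0:ℝ), ∀ s : ℝ, 0 < s → s < s0 →
    γ t0 + I * s * deriv γ t0 ∉ range γ ∧ γ t0 - I * s * deriv γ t0 ∉ range γ ∧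
    Wn γ (γ t0 + I * s * deriv γ t0) - Wn γ (γ t0 - I * s * deriv γ t0) = 2 * Real.pi * I := by
  obtain ⟨m, hm, hR, hL, hend⟩ := h.near t0
  refine ⟨m, hm, fun s hs hsm => ?_⟩
  set y : ℝ → ℂ := fun t => (γ t - γ t0) / deriv γ t0 with hy
  have hd := h.deriv_ne t0
  have y0 : y t0 = 0 := by simp [hy]
  have hR' : ∀ t ∈ Icc t0 (t0 + 1/2), ‖y t‖ = s → 0 < (y t).re := by
    intro t ht hn
    refine hR t ht (lt_of_eq_of_lt hn hsm) ?_
    rintro rfl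
    rw [y0, norm_zero] at hn; linarith
  have hL' : ∀ t ∈ Icc (t0-1/2) t0, ‖y t‖ = s → (y t).re < 0 := by
    intro t ht hn
    refine hL t ht (lt_of_eq_of_lt hn hsm) ?_
    rintro rfl
    rw [y0, norm_zero] at hn; linarith
  have key : ∀ t, γ t - (γ t0 + I * s * deriv γ t0) = (y t - I * s) * deriv γ t0 ∧
      γ t - (γ t0 - I * s * deriv γ t0) = (y t + I * s) * deriv γ t0 := by
    intro t
    simp only [hy]
    constructor <;> field_simp <;> ring
  have hne : ∀ t ∈ Icc (t0-1/2) (t0+1/2), y t + I * s ≠ 0 ∧ y t - I * s ≠ 0 := by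
    intro t ht
    rcases le_total t t0 with h' | h'
    · have := slit_aux' hs (hL' t ⟨ht.1, h'⟩); exact ⟨this.1, this.2.1⟩
    · have := slit_aux hs (hR' t ⟨h', ht.2⟩); exact ⟨this.1, this.2.1⟩
  have hrange : range γ = γ '' Icc (t0-1/2) (t0+1/2) := by
    rw [h.range_eq (t0-1/2)]; congr 2; ring
  have hp : γ t0 + I * s * deriv γ t0 ∉ range γ := by
    rw [hrange]; rintro ⟨t, ht, hte⟩
    have := (key t).1; rw [hte, sub_self] at this
    exact (mul_ne_zero (hne t ht).2 hd) this.symm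
  have hq : γ t0 - I * s * deriv γ t0 ∉ range γ := by
    rw [hrange]; rintro ⟨t, ht, hte⟩
    have := (key t).2; rw [hte, sub_self] at this
    exact (mul_ne_zero (hne t ht).1 hd) this.symm
  refine ⟨hp, hq, ?_⟩
  set wp := γ t0 + I * s * deriv γ t0 with hwp
  set wq := γ t0 - I * s * deriv γ t0 with hwq
  rw [h.Wn_eq wp (t0-1/2), h.Wn_eq wq (t0-1/2), ← intervalIntegral.integral_sub
    (h.intervalIntegrable hp _ _) (h.intervalIntegrable hq _ _)]
  have hii : ∀ a b, IntervalIntegrable (fun t => deriv γ t / (γ t - wp) - deriv γ t / (γ t - wq)) volume a b :=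
    fun a b => (h.intervalIntegrable hp a b).sub (h.intervalIntegrable hq a b)
  rw [show t0 - 1/2 + 1 = t0 + 1/2 by ring, ← intervalIntegral.integral_add_adjacent_intervals (hii _ t0) (hii _ _)]
  set q : ℝ → ℂ := fun t => (y t - I * s) / (y t + I * s) with hq'
  have hyd : ∀ t, HasDerivAt y (deriv γ t / deriv γ t0) t := fun t =>
    ((h.hasDerivAt t).sub_const (γ t0)).div_const (deriv γ t0)
  have hder : ∀ (c : ℂ), c ≠ 0 → ∀ t ∈ Icc (t0-1/2) (t0+1/2), c * q t ∈ slitPlane → HasDerivAt (fun t => Complex.log (c * q t))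
      (deriv γ t / (γ t - wp) - deriv γ t / (γ t - wq)) t := by
    intro c hc t ht hsl
    have h1 := hne t ht
    have := ((((hyd t).sub_const (I*s)).div ((hyd t).add_const (I*s)) h1.1).const_mul c).clog_real hsl
    refine this.congr_deriv ?_
    rw [(key t).1, (key t).2]
    simp only [Pi.div_apply]
    have h2 := h1.1; have h3 := h1.2
    field_simp
  have i1 := intervalIntegral.integral_eq_sub_of_hasDerivAt (a := t0-1/2) (b := t0) (f := fun t => Complex.log (-I * q t))
    (f' := fun t => deriv γ t / (γ t - wp) - deriv γ t / (γ t - wq)) (by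
      intro t ht
      rw [uIcc_of_le (by linarith)] at ht
      exact hder _ (by simp) t ⟨ht.1, by linarith [ht.2]⟩ (slit_aux' hs (hL' t ht)).2.2) (hii _ _)
  have i2 := intervalIntegral.integral_eq_sub_of_hasDerivAt (a := t0) (b := t0+1/2) (f := fun t => Complex.log (I * q t))
    (f' := fun t => deriv γ t / (γ t - wp) - deriv γ t / (γ t - wq)) (by
      intro t ht
      rw [uIcc_of_le (by linarith)] at ht
      exact hder _ (by simp) t ⟨by linarith [ht.1], ht.2⟩ (slit_aux hs (hR' t ht)).2.2) (hii _ _)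
  rw [i1, i2]
  have yend : y (t0 - 1/2) = y (t0 + 1/2) := by
    simp only [hy]
    rw [← h.periodic (t0-1/2), show t0 - 1/2 + 1 = t0 + 1/2 by ring]
  have qend : q (t0 - 1/2) = q (t0 + 1/2) := by simp only [hq', yend]
  have q0 : q t0 = -1 := by
    simp only [hq', y0]
    rw [zero_sub, zero_add, neg_div, div_self]
    exact mul_ne_zero I_ne_zero (by exact_mod_cast hs.ne')
  have hqre : 0 < (q (t0+1/2)).re := by
    simp only [hq']
    have hgt : s < ‖y (t0+1/2)‖ := lt_of_lt_of_le hsm hend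
    have hn := (hne (t0+1/2) ⟨by linarith, le_rfl⟩).1
    rw [Complex.div_re, ← add_div]
    apply div_pos
    · have : s^2 < ‖y (t0+1/2)‖^2 := by gcongr
      rw [Complex.sq_norm, Complex.normSq_apply] at this
      simp
      nlinarith
    · exact Complex.normSq_pos.2 hn
  rw [qend, q0]
  have l1 := log_jump hqre
  have l2 : Complex.log (I * -1) = -(Real.pi/2) * I := by rw [mul_neg_one, Complex.log_neg_I]
  have l3 : Complex.log (-I * -1) = (Real.pi/2) * I := by rw [neg_mul_neg, mul_one, Complex.log_I]
  rw [l2, l3]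
  linear_combination l1

end SK

open MeasureTheory Complex Set Metric ComplexConjugate Filter Topology
open scoped ENNReal NNReal Interval
namespace SK

theorem Curve.local_arc {γ : ℝ → ℂ} (h : Curve γ) (t0 : ℝ) {C : Set ℂ} (hC : IsClosed C)
    (hw : γ t0 ∉ C) {r : ℝ} (hr : 0 < r) :
    ∀ᶠ w in 𝓝 (γ t0), w ∈ C ∪ range γ → ∃ t, |t - t0| < r ∧ γ t = w := by
  have hK : IsCompact (γ '' (Icc (t0 - 1/2) (t0 + 1/2) \ Ioo (t0 - r) (t0 + r))) :=
    (isCompact_Icc.diff isOpen_Ioo).image h.continuous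
  have hnot : γ t0 ∉ γ '' (Icc (t0 - 1/2) (t0 + 1/2) \ Ioo (t0 - r) (t0 + r)) := by
    rintro ⟨t, ht, hte⟩
    obtain ⟨k, hk⟩ := h.inj _ _ hte
    have hk1 : (k:ℝ) < 1 := by linarith [ht.1.2]
    have hk2 : (-1:ℝ) < k := by linarith [ht.1.1]
    have hk1' : k < 1 := by exact_mod_cast hk1
    have hk2' : -1 < k := by exact_mod_cast hk2
    have : k = 0 := by omega
    subst this
    apply ht.2
    rw [hk]; simp; exact hr
  filter_upwards [hC.isOpen_compl.mem_nhds hw, hK.isClosed.isOpen_compl.mem_nhds hnot] with w h1 h2 h3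
  rcases h3 with h3 | h3
  · exact absurd h3 h1
  · rw [h.range_eq (t0 - 1/2)] at h3
    obtain ⟨t, ht, rfl⟩ := h3
    refine ⟨t, ?_, rfl⟩
    by_contra hlt
    apply h2
    refine ⟨t, ⟨⟨ht.1, by linarith [ht.2]⟩, ?_⟩, rfl⟩
    rintro ⟨ha, hb⟩
    exact hlt (abs_lt.2 ⟨by linarith, by linarith⟩)

theorem Curve.antilip {γ : ℝ → ℂ} (h : Curve γ) (t0 : ℝ) : ∃ c > 0, ∃ r > 0, ∀ s t, |s - t0| < r → |t - t0| < r →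
    c * |s - t| ≤ ‖γ s - γ t‖ := by
  have hs : HasStrictDerivAt γ (deriv γ t0) t0 :=
    (h.smooth.contDiffAt).hasStrictDerivAt (by norm_num)
  have hd : 0 < ‖deriv γ t0‖ := norm_pos_iff.2 (h.deriv_ne t0)
  have hb := hs.isLittleO.bound (c := ‖deriv γ t0‖/2) (by positivity)
  rw [nhds_prod_eq, Metric.nhds_basis_ball.prod_self.eventually_iff] at hb
  obtain ⟨r, hr, hb⟩ := hb
  refine ⟨‖deriv γ t0‖/2, by positivity, r, hr, fun s t h1 h2 => ?_⟩
  have := hb (x := (s,t)) ⟨by simpa [Real.dist_eq] using h1, by simpa [Real.dist_eq] using h2⟩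
  simp only [Real.norm_eq_abs, ContinuousLinearMap.toSpanSingleton_apply] at this
  have e : ‖(s - t) • deriv γ t0‖ = |s - t| * ‖deriv γ t0‖ := by rw [norm_smul, Real.norm_eq_abs]
  have := norm_sub_norm_le ((s - t) • deriv γ t0) (γ s - γ t)
  rw [e, norm_sub_rev ((s - t) • deriv γ t0)] at this
  linarith

/-- collar map -/
noncomputable def Psi (γ : ℝ → ℂ) (z : ℂ) : ℂ := γ z.re + I * z.im * deriv γ z.re

theorem Curve.psi_contDiff {γ : ℝ → ℂ} (h : Curve γ) : ContDiff ℝ 1 (Psi γ) := by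
  have hre : ContDiff ℝ 1 (fun z : ℂ => z.re) := reCLM.contDiff
  have him : ContDiff ℝ 1 (fun z : ℂ => z.im) := imCLM.contDiff
  have hof : ContDiff ℝ 1 (fun z : ℝ => (z:ℂ)) := ofRealCLM.contDiff
  exact ((h.smooth.of_le (by norm_num)).comp hre).add
    ((contDiff_const.mul (hof.comp him)).mul (h.contDiff_deriv.comp hre))

theorem Curve.psi_fderiv {γ : ℝ → ℂ} (h : Curve γ) (t0 : ℝ) : HasFDerivAt (Psi γ)
    (((ContinuousLinearEquiv.unitsEquivAut ℂ (Units.mk0 (deriv γ t0) (h.deriv_ne t0))).restrictScalars ℝ : ℂ ≃L[ℝ] ℂ) : ℂ →L[ℝ] ℂ) (t0 : ℂ) := by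
  have hre : HasFDerivAt (fun z : ℂ => z.re) reCLM (t0:ℂ) := reCLM.hasFDerivAt
  have him : HasFDerivAt (fun z : ℂ => (z.im : ℂ)) (ofRealCLM.comp imCLM) (t0:ℂ) := (ofRealCLM.comp imCLM).hasFDerivAt
  have h1 : HasFDerivAt (fun z : ℂ => γ z.re) _ (t0:ℂ) :=
    HasFDerivAt.comp (t0:ℂ) (g := γ) (h.hasDerivAt (t0:ℂ).re).hasFDerivAt hre
  have h2 : HasFDerivAt (fun z : ℂ => deriv γ z.re) _ (t0:ℂ) :=
    HasFDerivAt.comp (t0:ℂ) (g := deriv γ) ((h.contDiff_deriv.differentiable (by norm_num)) (t0:ℂ).re).hasDerivAt.hasFDerivAt hre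
  have := h1.add ((him.const_mul I).mul h2)
  refine this.congr_fderiv ?_
  ext z
  simp
  conv_rhs => rw [← Complex.re_add_im z]
  ring

theorem Curve.local_struct {γ : ℝ → ℂ} (h : Curve γ) (t0 : ℝ) {C : Set ℂ} (hC : IsClosed C)
    (hw : γ t0 ∉ C) : ∃ Lf Rt N : Set ℂ, IsPreconnected Lf ∧ IsPreconnected Rt ∧
      Disjoint Lf (C ∪ range γ) ∧ Disjoint Rt (C ∪ range γ) ∧ N ∈ 𝓝 (γ t0) ∧ N ⊆ Lf ∪ Rt ∪ range γ ∧
      ∃ δ > 0, ∀ t, |t - t0| < δ → ∀ s : ℝ, 0 < s → s < δ →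
        γ t + I * s * deriv γ t ∈ Lf ∧ γ t - I * s * deriv γ t ∈ Rt := by
  have hcd := h.psi_contDiff
  have hfd := h.psi_fderiv t0
  have hw0 : Psi γ t0 = γ t0 := by simp [Psi]
  set e := ContDiffAt.toOpenPartialHomeomorph (Psi γ) (hcd.contDiffAt) hfd (by norm_num) with he
  have hmem : (t0:ℂ) ∈ e.source := ContDiffAt.mem_toOpenPartialHomeomorph_source _ _ _
  have hcoe : (e : ℂ → ℂ) = Psi γ := rfl
  obtain ⟨r, hr, hrs⟩ := Metric.isOpen_iff.1 e.open_source _ hmem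
  have harc := h.local_arc t0 hC hw hr
  rw [← hw0] at harc
  have hpre := hcd.continuous.continuousAt.eventually harc
  obtain ⟨r', hr', hrs'⟩ := Metric.eventually_nhds_iff_ball.1 hpre
  set ρ := min r r' / 2 with hρ
  have hρ0 : 0 < ρ := by have := lt_min hr hr'; positivity
  set R : Set ℂ := {z | |z.re - t0| < ρ ∧ |z.im| < ρ} with hR
  have hRball : ∀ z ∈ R, z ∈ ball (t0:ℂ) r ∧ z ∈ ball (t0:ℂ) r' := by
    intro z hz
    have h1 : ‖z - t0‖ < min r r' := by
      refine lt_of_le_of_lt (Complex.norm_le_abs_re_add_abs_im _) ?_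
      have := hz.1; have := hz.2
      simp
      constructor <;> linarith [min_le_left r r', min_le_right r r']
    rw [mem_ball, mem_ball, dist_eq_norm]
    exact ⟨h1.trans_le (min_le_left _ _), h1.trans_le (min_le_right _ _)⟩
  have hnb : ∀ z ∈ R, z.im ≠ 0 → Psi γ z ∉ C ∪ range γ := by
    intro z hz him hmem'
    obtain ⟨t, ht, hte⟩ := hrs' z (hRball z hz).2 hmem'
    have h1 : (t:ℂ) ∈ e.source := hrs (by
      rw [mem_ball, dist_eq_norm, ← ofReal_sub, norm_real]; exact ht)
    have h2 : z ∈ e.source := hrs (hRball z hz).1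
    have h3 : e t = e z := by rw [hcoe, ← hte]; simp [Psi]
    have := e.injOn h1 h2 h3
    rw [← this] at him; simp at him
  have hRopen : IsOpen R := by
    have c1 : Continuous fun z : ℂ => |z.re - t0| := (continuous_re.sub continuous_const).abs
    have c2 : Continuous fun z : ℂ => |z.im| := continuous_im.abs
    exact (isOpen_lt c1 continuous_const).inter (isOpen_lt c2 continuous_const)
  have conv1 : Convex ℝ {z : ℂ | |z.re - t0| < ρ} := by
    have : {z : ℂ | |z.re - t0| < ρ} = reCLM ⁻¹' (ball t0 ρ) := by
      ext z; simp [Real.dist_eq]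
    rw [this]; exact (convex_ball t0 ρ).linear_preimage reCLM.toLinearMap
  have conv2 : Convex ℝ {z : ℂ | 0 < z.im ∧ z.im < ρ} := by
    have : {z : ℂ | 0 < z.im ∧ z.im < ρ} = imCLM ⁻¹' (Ioo 0 ρ) := by
      ext z; simp
    rw [this]; exact (convex_Ioo 0 ρ).linear_preimage imCLM.toLinearMap
  have conv3 : Convex ℝ {z : ℂ | -ρ < z.im ∧ z.im < 0} := by
    have : {z : ℂ | -ρ < z.im ∧ z.im < 0} = imCLM ⁻¹' (Ioo (-ρ) 0) := by
      ext z; simp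
    rw [this]; exact (convex_Ioo (-ρ) 0).linear_preimage imCLM.toLinearMap
  refine ⟨Psi γ '' ({z : ℂ | |z.re - t0| < ρ} ∩ {z : ℂ | 0 < z.im ∧ z.im < ρ}),
    Psi γ '' ({z : ℂ | |z.re - t0| < ρ} ∩ {z : ℂ | -ρ < z.im ∧ z.im < 0}), Psi γ '' R,
    (conv1.inter conv2).isPreconnected.image _ hcd.continuous.continuousOn,
    (conv1.inter conv3).isPreconnected.image _ hcd.continuous.continuousOn, ?_, ?_, ?_, ?_, ρ, hρ0, ?_⟩
  · rw [disjoint_left]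
    rintro _ ⟨z, hz, rfl⟩
    exact hnb z ⟨hz.1, abs_lt.2 ⟨by linarith [hz.2.1], hz.2.2⟩⟩ hz.2.1.ne'
  · rw [disjoint_left]
    rintro _ ⟨z, hz, rfl⟩
    exact hnb z ⟨hz.1, abs_lt.2 ⟨hz.2.1, by linarith [hz.2.2]⟩⟩ hz.2.2.ne
  · rw [← hw0]
    have hsub : R ⊆ e.source := fun z hz => hrs (hRball z hz).1
    have := e.isOpen_image_of_subset_source hRopen hsub
    exact this.mem_nhds ⟨t0, by simp [hR, hρ0], rfl⟩
  · rintro _ ⟨z, hz, rfl⟩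
    have := abs_lt.1 hz.2
    rcases lt_trichotomy z.im 0 with h0 | h0 | h0
    · exact Or.inl (Or.inr ⟨z, ⟨hz.1, this.1, h0⟩, rfl⟩)
    · right; exact ⟨z.re, by simp [Psi, h0]⟩
    · exact Or.inl (Or.inl ⟨z, ⟨hz.1, h0, this.2⟩, rfl⟩)
  · intro t ht s hs1 hs2
    refine ⟨⟨t + I * s, ⟨by simpa using ht, by simpa using ⟨hs1, hs2⟩⟩, by simp [Psi]⟩,
      ⟨t - I * s, ⟨by simpa using ht, by simpa using ⟨hs2, hs1⟩⟩, by simp [Psi]; ring⟩⟩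

end SK

open MeasureTheory Complex Set Metric ComplexConjugate Filter Topology
open scoped ENNReal NNReal Interval

structure SK.Dom (n : ℕ) (Ω : Set ℂ) (γ : Fin n → ℝ → ℂ) : Prop where
  nonempty : Ω.Nonempty
  isOpen : IsOpen Ω
  conn : IsPreconnected Ω
  bdd : Bornology.IsBounded Ω
  curve : ∀ j, SK.Curve (γ j)
  bd : frontier Ω = ⋃ j, Set.range (γ j)
  disj : ∀ j k, j ≠ k → Disjoint (Set.range (γ j)) (Set.range (γ k))

namespace SK
variable {n : ℕ} {Ω : Set ℂ} {γ : Fin n → ℝ → ℂ}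

theorem Dom.isClosed_C (h : Dom n Ω γ) (j : Fin n) : IsClosed (⋃ k : {k // k ≠ j}, range (γ k)) :=
  isClosed_iUnion_of_finite fun k => (h.curve k).isCompact_range.isClosed

theorem Dom.not_mem_C (h : Dom n Ω γ) (j : Fin n) (t : ℝ) : γ j t ∉ (⋃ k : {k // k ≠ j}, range (γ k)) := by
  rw [mem_iUnion]
  rintro ⟨⟨k, hk⟩, hm⟩
  exact disjoint_left.1 (h.disj k j hk) hm ⟨t, rfl⟩

theorem Dom.C_union (h : Dom n Ω γ) (j : Fin n) : (⋃ k : {k // k ≠ j}, range (γ k)) ∪ range (γ j) = frontier Ω := by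
  rw [h.bd]
  ext x
  simp only [mem_union, mem_iUnion]
  constructor
  · rintro (⟨k, hk⟩ | hk)
    · exact ⟨k, hk⟩
    · exact ⟨j, hk⟩
  · rintro ⟨k, hk⟩
    by_cases hkj : k = j
    · right; exact hkj ▸ hk
    · left; exact ⟨⟨k, hkj⟩, hk⟩

theorem Dom.mem_frontier (h : Dom n Ω γ) (j : Fin n) (t : ℝ) : γ j t ∈ frontier Ω := by
  rw [h.bd]; exact mem_iUnion.2 ⟨j, t, rfl⟩

theorem Dom.not_frontier (h : Dom n Ω γ) {z : ℂ} (hz : z ∈ Ω) : z ∉ frontier Ω := by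
  rw [h.isOpen.frontier_eq]; exact fun h' => h'.2 hz

theorem trichot {Ω : Set ℂ} (hO : IsOpen Ω) (z : ℂ) : z ∈ Ω ∨ z ∈ (closure Ω)ᶜ ∨ z ∈ frontier Ω := by
  rw [hO.frontier_eq]
  by_cases h1 : z ∈ Ω
  · exact Or.inl h1
  · by_cases h2 : z ∈ closure Ω
    · exact Or.inr (Or.inr ⟨h2, h1⟩)
    · exact Or.inr (Or.inl h2)

theorem Dom.dichot (h : Dom n Ω γ) {X : Set ℂ} (hX : IsPreconnected X) (hd : Disjoint X (frontier Ω)) :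
    X ⊆ Ω ∨ X ⊆ (closure Ω)ᶜ := by
  apply hX.subset_or_subset h.isOpen isClosed_closure.isOpen_compl
  · exact disjoint_left.2 fun z hz hz' => hz' (subset_closure hz)
  · intro z hz
    rcases trichot h.isOpen z with h1 | h1 | h1
    · exact Or.inl h1
    · exact Or.inr h1
    · exact absurd h1 (disjoint_left.1 hd hz)

theorem Dom.Wn_const (h : Dom n Ω γ) (j : Fin n) : ∀ x ∈ Ω, ∀ y ∈ Ω, Wn (γ j) x = Wn (γ j) y := by
  apply const_of_loc h.conn
  intro z hz
  apply (h.curve j).Wn_loc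
  rintro ⟨t, rfl⟩
  exact h.not_frontier hz (h.mem_frontier j t)

def Pos (Ω : Set ℂ) (γ : ℝ → ℂ) (t0 : ℝ) : Prop := ∃ δ > 0, ∀ t, |t - t0| < δ → ∀ s : ℝ, 0 < s → s < δ →
        γ t + I * s * deriv γ t ∈ Ω ∧ γ t - I * s * deriv γ t ∈ (closure Ω)ᶜ
def Neg (Ω : Set ℂ) (γ : ℝ → ℂ) (t0 : ℝ) : Prop := ∃ δ > 0, ∀ t, |t - t0| < δ → ∀ s : ℝ, 0 < s → s < δ →
        γ t - I * s * deriv γ t ∈ Ω ∧ γ t + I * s * deriv γ t ∈ (closure Ω)ᶜ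

theorem Dom.local (h : Dom n Ω γ) (j : Fin n) (t0 : ℝ) : ∃ Lf Rt N : Set ℂ, IsPreconnected Lf ∧ IsPreconnected Rt ∧
      Disjoint Lf (frontier Ω) ∧ Disjoint Rt (frontier Ω) ∧ N ∈ 𝓝 (γ j t0) ∧ N ⊆ Lf ∪ Rt ∪ frontier Ω ∧
      ((Lf ⊆ Ω ∧ Rt ⊆ (closure Ω)ᶜ) ∨ (Lf ⊆ (closure Ω)ᶜ ∧ Rt ⊆ Ω)) ∧
      ∃ δ > 0, ∀ t, |t - t0| < δ → ∀ s : ℝ, 0 < s → s < δ →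
        γ j t + I * s * deriv (γ j) t ∈ Lf ∧ γ j t - I * s * deriv (γ j) t ∈ Rt := by
  obtain ⟨Lf, Rt, N, h1, h2, h3, h4, h5, h6, δ, hδ, h7⟩ := (h.curve j).local_struct t0 (h.isClosed_C j) (h.not_mem_C j t0)
  rw [h.C_union] at h3 h4
  have h6' : N ⊆ Lf ∪ Rt ∪ frontier Ω := h6.trans (union_subset_union_right _ (by rw [← h.C_union j]; exact subset_union_right))
  refine ⟨Lf, Rt, N, h1, h2, h3, h4, h5, h6', ?_, δ, hδ, h7⟩
  rcases h.dichot h1 h3 with a | a <;> rcases h.dichot h2 h4 with b | b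
  · exfalso
    obtain ⟨s0, hs0, hj⟩ := (h.curve j).jump t0
    set s := min s0 δ / 2
    have hm := lt_min hs0 hδ
    have hs : 0 < s := by positivity
    have hs1 : s < s0 := by have := min_le_left s0 δ; simp only [s]; linarith
    have hs2 : s < δ := by have := min_le_right s0 δ; simp only [s]; linarith
    have h8 := h7 t0 (by simpa using hδ) s hs hs2
    have h9 := (hj s hs hs1).2.2
    rw [h.Wn_const j _ (a h8.1) _ (b h8.2), sub_self] at h9
    exact Complex.two_pi_I_ne_zero h9.symm
  · exact Or.inl ⟨a, b⟩
  · exact Or.inr ⟨a, b⟩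
  · exfalso
    have hcl : γ j t0 ∈ closure Ω := frontier_subset_closure (h.mem_frontier j t0)
    obtain ⟨z, hzN, hzΩ⟩ := mem_closure_iff_nhds.1 hcl N h5
    rcases h6' hzN with (hz | hz) | hz
    · exact a hz (subset_closure hzΩ)
    · exact b hz (subset_closure hzΩ)
    · exact h.not_frontier hzΩ hz

theorem Dom.pos_or_neg (h : Dom n Ω γ) (j : Fin n) (t0 : ℝ) : Pos Ω (γ j) t0 ∨ Neg Ω (γ j) t0 := by
  obtain ⟨Lf, Rt, N, h1, h2, h3, h4, h5, h6, hc | hc, δ, hδ, h7⟩ := h.local j t0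
  · left; exact ⟨δ, hδ, fun t ht s hs hs' => ⟨hc.1 (h7 t ht s hs hs').1, hc.2 (h7 t ht s hs hs').2⟩⟩
  · right; exact ⟨δ, hδ, fun t ht s hs hs' => ⟨hc.2 (h7 t ht s hs hs').2, hc.1 (h7 t ht s hs hs').1⟩⟩

theorem Pos.open (γ : ℝ → ℂ) : IsOpen {t | Pos Ω γ t} := by
  rw [Metric.isOpen_iff]
  rintro t ⟨δ, hδ, h⟩
  refine ⟨δ/2, by positivity, fun t' ht' => ⟨δ/2, by positivity, fun u hu s hs hs' => h u ?_ s hs (by linarith)⟩⟩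
  rw [mem_ball, Real.dist_eq] at ht'
  have := abs_sub_le u t' t
  linarith

theorem Neg.open (γ : ℝ → ℂ) : IsOpen {t | Neg Ω γ t} := by
  rw [Metric.isOpen_iff]
  rintro t ⟨δ, hδ, h⟩
  refine ⟨δ/2, by positivity, fun t' ht' => ⟨δ/2, by positivity, fun u hu s hs hs' => h u ?_ s hs (by linarith)⟩⟩
  rw [mem_ball, Real.dist_eq] at ht'
  have := abs_sub_le u t' t
  linarith

theorem Pos.not_neg {γ : ℝ → ℂ} {t : ℝ} (h : Pos Ω γ t) (h' : Neg Ω γ t) : False := by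
  obtain ⟨δ, hδ, h⟩ := h
  obtain ⟨δ', hδ', h'⟩ := h'
  have hm := lt_min hδ hδ'
  set s := min δ δ' / 2
  have hs : 0 < s := by positivity
  have hs1 : s < δ := by have := min_le_left δ δ'; simp only [s]; linarith
  have hs2 : s < δ' := by have := min_le_right δ δ'; simp only [s]; linarith
  exact (h' t (by simpa using hδ') s hs hs2).2 (subset_closure (h t (by simpa using hδ) s hs hs1).1)

theorem Dom.all_pos_or_neg (h : Dom n Ω γ) (j : Fin n) : (∀ t, Pos Ω (γ j) t) ∨ (∀ t, Neg Ω (γ j) t) := by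
  have := isPreconnected_univ.subset_or_subset (Pos.open (Ω := Ω) (γ j)) (Neg.open (Ω := Ω) (γ j))
    (disjoint_left.2 fun t h1 h2 => Pos.not_neg h1 h2) (fun t _ => h.pos_or_neg j t)
  rcases this with h' | h'
  · left; exact fun t => h' (mem_univ t)
  · right; exact fun t => h' (mem_univ t)

theorem Dom.orient (h : Dom n Ω γ) : ∃ γ' : Fin n → ℝ → ℂ, Dom n Ω γ' ∧ (∀ j, range (γ' j) = range (γ j)) ∧ ∀ j t, Pos Ω (γ' j) t := by
  have : ∀ j, ∃ g : ℝ → ℂ, Curve g ∧ range g = range (γ j) ∧ ∀ t, Pos Ω g t := by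
    intro j
    rcases h.all_pos_or_neg j with h' | h'
    · exact ⟨γ j, h.curve j, rfl, h'⟩
    · obtain ⟨h1, h2, h3⟩ := (h.curve j).rev
      refine ⟨_, h1, h3, fun t => ?_⟩
      obtain ⟨δ, hδ, h4⟩ := h' (-t)
      refine ⟨δ, hδ, fun u hu s hs hs' => ?_⟩
      have := h4 (-u) (by rw [abs_sub_comm]; convert hu using 2; ring) s hs hs'
      rw [h2]
      simpa [sub_eq_add_neg] using this
  choose g hg1 hg2 hg3 using this
  refine ⟨g, ⟨h.nonempty, h.isOpen, h.conn, h.bdd, hg1, ?_, ?_⟩, hg2, hg3⟩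
  · rw [h.bd]; simp [hg2]
  · intro j k hjk; rw [hg2, hg2]; exact h.disj j k hjk

noncomputable def Wtot (γ : Fin n → ℝ → ℂ) (w : ℂ) : ℂ := ∑ j, Wn (γ j) w

theorem Dom.Wtot_loc (h : Dom n Ω γ) {w : ℂ} (hw : w ∉ frontier Ω) : ∀ᶠ z in 𝓝 w, Wtot γ z = Wtot γ w := by
  have : ∀ᶠ z in 𝓝 w, ∀ j, Wn (γ j) z = Wn (γ j) w := by
    rw [eventually_all]
    intro j
    apply (h.curve j).Wn_loc
    rintro ⟨t, rfl⟩
    exact hw (h.mem_frontier j t)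
  filter_upwards [this] with z hz
  exact Finset.sum_congr rfl fun j _ => hz j

theorem Dom.Wtot_jump (h : Dom n Ω γ) (j : Fin n) (t0 : ℝ) : ∃ s0 > (0:ℝ), ∀ s : ℝ, 0 < s → s < s0 →
    Wtot γ (γ j t0 + I * s * deriv (γ j) t0) - Wtot γ (γ j t0 - I * s * deriv (γ j) t0) = 2 * Real.pi * I := by
  obtain ⟨s0, hs0, hj⟩ := (h.curve j).jump t0
  have hoth : ∀ᶠ z in 𝓝 (γ j t0), ∀ k, k ≠ j → Wn (γ k) z = Wn (γ k) (γ j t0) := by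
    rw [eventually_all]
    intro k
    by_cases hk : k = j
    · simp [hk]
    · have := (h.curve k).Wn_loc (w0 := γ j t0) (fun h' => disjoint_left.1 (h.disj k j hk) h' ⟨t0, rfl⟩)
      filter_upwards [this] with z hz _ using hz
  have c1 : ContinuousAt (fun s : ℝ => γ j t0 + I * s * deriv (γ j) t0) 0 := by fun_prop
  have c2 : ContinuousAt (fun s : ℝ => γ j t0 - I * s * deriv (γ j) t0) 0 := by fun_prop
  have e1 := c1.eventually (p := fun z => ∀ k, k ≠ j → Wn (γ k) z = Wn (γ k) (γ j t0)) (by simpa using hoth)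
  have e2 := c2.eventually (p := fun z => ∀ k, k ≠ j → Wn (γ k) z = Wn (γ k) (γ j t0)) (by simpa using hoth)
  obtain ⟨r, hr, hb⟩ := Metric.eventually_nhds_iff_ball.1 (e1.and e2)
  refine ⟨min s0 r, lt_min hs0 hr, fun s hs hs' => ?_⟩
  have hb' := hb s (by rw [mem_ball, Real.dist_eq, sub_zero, abs_of_pos hs]; exact hs'.trans_le (min_le_right _ _))
  rw [Wtot, Wtot, ← Finset.sum_sub_distrib, Finset.sum_eq_single j]
  · exact (hj s hs (hs'.trans_le (min_le_left _ _))).2.2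
  · intro k _ hk
    rw [hb'.1 k hk, hb'.2 k hk, sub_self]
  · simp

theorem Curve.Wn_tendsto {g : ℝ → ℂ} (h : Curve g) : Tendsto (fun x : ℝ => Wn g x) atTop (𝓝 0) := by
  obtain ⟨C, hC⟩ := isCompact_Icc.exists_bound_of_continuousOn (s := Icc (0:ℝ) 1) h.continuous_deriv.continuousOn
  obtain ⟨R, hR⟩ := isCompact_Icc.exists_bound_of_continuousOn (s := Icc (0:ℝ) 1) h.continuous.continuousOn
  have hC0 : 0 ≤ C := (norm_nonneg _).trans (hC 0 (by simp))
  have hR0 : 0 ≤ R := (norm_nonneg _).trans (hR 0 (by simp))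
  have hlim : Tendsto (fun x : ℝ => C / (x - R)) atTop (𝓝 0) := by
    apply Tendsto.const_div_atTop
    exact tendsto_atTop_add_const_right _ _ tendsto_id
  apply squeeze_zero_norm' _ hlim
  filter_upwards [eventually_gt_atTop R] with x hx
  have := intervalIntegral.norm_integral_le_of_norm_le_const (a := 0) (b := 1) (C := C / (x - R)) (f := fun t => deriv g t / (g t - x)) (by
    intro t ht
    rw [uIoc_of_le zero_le_one] at ht
    have ht' : t ∈ Icc (0:ℝ) 1 := ⟨ht.1.le, ht.2⟩
    rw [norm_div]
    have h1 : x - R ≤ ‖g t - x‖ := by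
      have := norm_sub_norm_le (x:ℂ) (g t)
      rw [norm_sub_rev, norm_real, Real.norm_eq_abs, abs_of_pos (by linarith)] at this
      linarith [hR t ht']
    have : 0 < x - R := by linarith
    gcongr
    exact hC t ht')
  simpa [Wn] using this

theorem Dom.Wtot_val (h : Dom n Ω γ) (hpos : ∀ j t, Pos Ω (γ j) t) :
    (∀ w ∈ Ω, Wtot γ w = 2 * Real.pi * I) ∧ (∀ w ∈ (closure Ω)ᶜ, Wtot γ w = 0) := by
  obtain ⟨p0, hp0⟩ := h.nonempty
  set c := Wtot γ p0 with hc
  have hcΩ : ∀ w ∈ Ω, Wtot γ w = c := fun w hw =>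
    const_of_loc h.conn (fun z hz => h.Wtot_loc (h.not_frontier hz)) w hw p0 hp0
  have hnf : ∀ w ∈ (closure Ω)ᶜ, w ∉ frontier Ω := fun w hw h' => hw (frontier_subset_closure h')
  set E : Set ℂ := {p | p ∈ (closure Ω)ᶜ ∧ Wtot γ p ≠ c - 2 * Real.pi * I} with hE
  have hEo : IsOpen E := by
    rw [isOpen_iff_mem_nhds]
    rintro p ⟨hp1, hp2⟩
    filter_upwards [isClosed_closure.isOpen_compl.mem_nhds hp1, h.Wtot_loc (hnf p hp1)] with z hz1 hz2
    exact ⟨hz1, by rwa [hz2]⟩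
  have hEc : IsClosed E := by
    rw [← isOpen_compl_iff, isOpen_iff_mem_nhds]
    intro p hp
    rcases trichot h.isOpen p with h1 | h1 | h1
    · filter_upwards [h.isOpen.mem_nhds h1] with z hz
      exact fun h' => h'.1 (subset_closure hz)
    · have hv : Wtot γ p = c - 2 * Real.pi * I := by
        by_contra h'; exact hp ⟨h1, h'⟩
      filter_upwards [h.Wtot_loc (hnf p h1)] with z hz
      exact fun h' => h'.2 (by rw [hz, hv])
    · rw [h.bd, mem_iUnion] at h1
      obtain ⟨j, t0, rfl⟩ := h1
      obtain ⟨Lf, Rt, N, a1, a2, a3, a4, a5, a6, hc', δ, hδ, a7⟩ := h.local j t0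
      obtain ⟨δ', hδ', hP⟩ := hpos j t0
      obtain ⟨s0, hs0, hj⟩ := h.Wtot_jump j t0
      have hm := lt_min (lt_min hδ hδ') hs0
      set s := min (min δ δ') s0 / 2 with hsdef
      have hs : 0 < s := by positivity
      have hs3 : s < s0 := by have := min_le_right (min δ δ') s0; linarith
      have hs4 : s < min δ δ' := by have := min_le_left (min δ δ') s0; linarith
      have hs1 : s < δ := hs4.trans_le (min_le_left _ _)
      have hs2 : s < δ' := hs4.trans_le (min_le_right _ _)
      have b1 := a7 t0 (by simpa using hδ) s hs hs1
      have b2 := hP t0 (by simpa using hδ') s hs hs2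
      have b3 := hj s hs hs3
      have hLR : Lf ⊆ Ω ∧ Rt ⊆ (closure Ω)ᶜ := by
        rcases hc' with h' | h'
        · exact h'
        · exact absurd (subset_closure b2.1) (h'.1 b1.1)
      have hRt : ∀ z ∈ Rt, Wtot γ z = c - 2 * Real.pi * I := by
        intro z hz
        rw [const_of_loc a2 (fun z hz => h.Wtot_loc (disjoint_left.1 a4 hz)) z hz _ b1.2]
        rw [hcΩ _ b2.1] at b3
        linear_combination -b3
      filter_upwards [a5] with z hz
      rintro ⟨hz1, hz2⟩
      rcases a6 hz with (h' | h') | h'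
      · exact hz1 (subset_closure (hLR.1 h'))
      · exact hz2 (hRt z h')
      · exact hz1 (frontier_subset_closure h')
  have hEe : E = ∅ := by
    rcases isClopen_iff.1 ⟨hEc, hEo⟩ with h' | h'
    · exact h'
    · exfalso
      have : p0 ∈ E := by rw [h']; trivial
      exact this.1 (subset_closure hp0)
  have hext : ∀ w ∈ (closure Ω)ᶜ, Wtot γ w = c - 2 * Real.pi * I := by
    intro w hw
    by_contra h'
    have : w ∈ E := ⟨hw, h'⟩
    rw [hEe] at this; exact this
  have hlim : Tendsto (fun x : ℝ => Wtot γ x) atTop (𝓝 0) := by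
    have := tendsto_finsetSum Finset.univ fun j _ => (h.curve j).Wn_tendsto
    simpa [Wtot] using this
  obtain ⟨R, hR⟩ := h.bdd.closure.subset_ball 0
  have hlim2 : Tendsto (fun x : ℝ => Wtot γ x) atTop (𝓝 (c - 2 * Real.pi * I)) := by
    apply tendsto_const_nhds.congr'
    filter_upwards [eventually_gt_atTop R, eventually_gt_atTop 0] with x hx hx0
    refine (hext x fun h' => ?_).symm
    have := hR h'
    rw [mem_ball, dist_zero_right, norm_real, Real.norm_eq_abs, abs_of_pos hx0] at this
    linarith
  have := tendsto_nhds_unique hlim hlim2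
  refine ⟨fun w hw => ?_, fun w hw => ?_⟩
  · rw [hcΩ w hw]; linear_combination -this
  · rw [hext w hw, ← this]

end SK

open MeasureTheory Complex Set Metric ComplexConjugate Filter Topology
open scoped ENNReal NNReal Interval

structure SK.Geo (Ω : Set ℂ) (T : ℂ → ℂ) : Prop where
  nonempty : Ω.Nonempty
  isOpen : IsOpen Ω
  conn : IsPreconnected Ω
  bdd : Bornology.IsBounded Ω
  fin : μH[1] (frontier Ω) < ⊤
  normT : ∀ z ∈ frontier Ω, ‖T z‖ = 1
  lipT : ∀ z ∈ frontier Ω, ∃ U ∈ 𝓝 z, ∃ L : ℝ, 0 ≤ L ∧ ∀ x ∈ frontier Ω ∩ U, ∀ y ∈ frontier Ω ∩ U, ‖T x - T y‖ ≤ L * ‖x - y‖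
  inner : ∀ w ∈ Ω, ∫ ζ in frontier Ω, T ζ / (ζ - w) ∂μH[1] = 2 * Real.pi * I
  outer : ∀ w ∈ (closure Ω)ᶜ, ∫ ζ in frontier Ω, T ζ / (ζ - w) ∂μH[1] = 0
  exact : ∀ F F' : ℂ → ℂ, (∀ z ∈ frontier Ω, HasDerivAt F (F' z) z) → ContinuousOn F' (frontier Ω) →
    ∫ ζ in frontier Ω, F' ζ * T ζ ∂μH[1] = 0
  ext_dense : frontier Ω ⊆ closure (closure Ω)ᶜ
  perfect : ∀ F : Set ℂ, F.Finite → frontier Ω ⊆ closure (frontier Ω \ F)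

namespace SK
variable {n : ℕ} {Ω : Set ℂ} {γ : Fin n → ℝ → ℂ}

open Classical in
noncomputable def tang (γ : Fin n → ℝ → ℂ) (z : ℂ) : ℂ :=
  if h : ∃ p : Fin n × ℝ, γ p.1 p.2 = z then deriv (γ h.choose.1) h.choose.2 / ‖deriv (γ h.choose.1) h.choose.2‖ else 0

theorem Dom.tang_eq (h : Dom n Ω γ) (j : Fin n) (t : ℝ) :
    tang γ (γ j t) = deriv (γ j) t / ‖deriv (γ j) t‖ := by
  have hex : ∃ p : Fin n × ℝ, γ p.1 p.2 = γ j t := ⟨(j, t), rfl⟩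
  rw [tang, dif_pos hex]
  have hs := hex.choose_spec
  generalize hex.choose = p at hs
  obtain ⟨k, u⟩ := p
  simp only at hs ⊢
  have hk : k = j := by
    by_contra hne
    exact disjoint_left.1 (h.disj k j hne) ⟨u, rfl⟩ (hs ▸ ⟨t, rfl⟩)
  subst hk
  obtain ⟨m, hm⟩ := (h.curve k).inj _ _ hs
  have : deriv (γ k) u = deriv (γ k) t := by
    rw [hm]
    have := (h.curve k).deriv_periodic.int_mul m t
    simpa using this
  rw [this]

theorem Dom.exists_param (h : Dom n Ω γ) {z : ℂ} (hz : z ∈ frontier Ω) : ∃ j t, γ j t = z := by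
  rw [h.bd, mem_iUnion] at hz; exact hz

theorem Dom.lip (h : Dom n Ω γ) : ∀ z ∈ frontier Ω, ∃ U ∈ 𝓝 z, ∃ L : ℝ, 0 ≤ L ∧ ∀ x ∈ frontier Ω ∩ U, ∀ y ∈ frontier Ω ∩ U,
    ‖tang γ x - tang γ y‖ ≤ L * ‖x - y‖ := by
  intro z hz
  obtain ⟨j, t0, rfl⟩ := h.exists_param hz
  have hc := h.curve j
  obtain ⟨c, hc0, r, hr, hanti⟩ := hc.antilip t0
  set τ : ℝ → ℂ := fun t => deriv (γ j) t / ‖deriv (γ j) t‖ with hτ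
  have hcd : ContDiffAt ℝ 1 τ t0 := by
    have h1 : ContDiffAt ℝ 1 (fun t => ‖deriv (γ j) t‖) t0 := hc.contDiff_deriv.contDiffAt.norm ℝ (hc.deriv_ne t0)
    have h2 : ContDiffAt ℝ 1 (fun t => (‖deriv (γ j) t‖:ℂ)) t0 := ofRealCLM.contDiff.contDiffAt.comp t0 h1
    simp only [hτ, div_eq_mul_inv]
    exact hc.contDiff_deriv.contDiffAt.mul (h2.inv (by simpa using hc.deriv_ne t0))
  obtain ⟨K, s, hs, hK⟩ := hcd.exists_lipschitzOnWith
  obtain ⟨r', hr', hball⟩ := Metric.mem_nhds_iff.1 hs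
  have harc := hc.local_arc t0 (h.isClosed_C j) (h.not_mem_C j t0) (lt_min hr hr')
  rw [h.C_union] at harc
  refine ⟨_, harc, K / c, by positivity, ?_⟩
  rintro x ⟨hx1, hx2⟩ y ⟨hy1, hy2⟩
  obtain ⟨t, ht, rfl⟩ := hx2 hx1
  obtain ⟨u, hu, rfl⟩ := hy2 hy1
  rw [h.tang_eq, h.tang_eq]
  have h1 := hK.dist_le_mul t (hball (by rw [mem_ball, Real.dist_eq]; exact ht.trans_le (min_le_right _ _)))
    u (hball (by rw [mem_ball, Real.dist_eq]; exact hu.trans_le (min_le_right _ _)))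
  have h2 := hanti t u (ht.trans_le (min_le_left _ _)) (hu.trans_le (min_le_left _ _))
  rw [dist_eq_norm, Real.dist_eq] at h1
  refine h1.trans ?_
  rw [div_mul_eq_mul_div, le_div_iff₀ hc0, mul_assoc]
  gcongr
  linarith

theorem contOn_of_lip {T : ℂ → ℂ} {X : Set ℂ} (h : ∀ z ∈ X, ∃ U ∈ 𝓝 z, ∃ L : ℝ, 0 ≤ L ∧ ∀ x ∈ X ∩ U, ∀ y ∈ X ∩ U,
    ‖T x - T y‖ ≤ L * ‖x - y‖) : ContinuousOn T X := by
  intro z hz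
  obtain ⟨U, hU, L, hL, hl⟩ := h z hz
  rw [ContinuousWithinAt, tendsto_iff_norm_sub_tendsto_zero]
  have hlim : Tendsto (fun x => L * ‖x - z‖) (𝓝[X] z) (𝓝 0) := by
    have : ContinuousWithinAt (fun x => L * ‖x - z‖) X z := by fun_prop
    simpa [ContinuousWithinAt] using this
  refine squeeze_zero' (Eventually.of_forall fun _ => norm_nonneg _) ?_ hlim
  filter_upwards [self_mem_nhdsWithin, mem_nhdsWithin_of_mem_nhds hU] with x hx hxU
  exact hl x ⟨hx, hxU⟩ z ⟨hz, mem_of_mem_nhds hU⟩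

theorem Dom.finite (h : Dom n Ω γ) : μH[1] (frontier Ω) < ⊤ := by
  rw [h.bd]
  refine (measure_iUnion_fintype_le _ _).trans_lt ?_
  exact ENNReal.sum_lt_top.2 fun j _ => (h.curve j).measure_lt_top

theorem Dom.integral (h : Dom n Ω γ) (f : ℂ → ℂ) (hf : ContinuousOn f (frontier Ω)) :
    ∫ ζ in frontier Ω, f ζ * tang γ ζ ∂μH[1] = ∑ j, ∫ t in (0:ℝ)..1, deriv (γ j) t * f (γ j t) := by
  have hc : ContinuousOn (fun ζ => f ζ * tang γ ζ) (frontier Ω) := hf.mul (contOn_of_lip h.lip)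
  have hsub : ∀ j, range (γ j) ⊆ frontier Ω := fun j => by rw [h.bd]; exact subset_iUnion (fun j => range (γ j)) j
  have hintg : ∀ j, IntegrableOn (fun ζ => f ζ * tang γ ζ) (range (γ j)) μH[1] := by
    intro j
    exact (hc.mono (hsub j)).integrableOn_of_subset_isCompact (h.curve j).isCompact_range
      (h.curve j).isCompact_range.measurableSet subset_rfl (h.curve j).measure_lt_top.ne
  have : ∫ ζ in frontier Ω, f ζ * tang γ ζ ∂μH[1] = ∑ j, ∫ ζ in range (γ j), f ζ * tang γ ζ ∂μH[1] := by
    rw [h.bd]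
    exact integral_iUnion_fintype (fun j => (h.curve j).isCompact_range.measurableSet)
      (fun j k hjk => h.disj j k hjk) hintg
  rw [this]
  refine Finset.sum_congr rfl fun j _ => ?_
  rw [(h.curve j).integral _ (hc.mono (hsub j))]
  apply intervalIntegral.integral_congr
  intro t _
  simp only [h.tang_eq]
  have : (‖deriv (γ j) t‖ : ℂ) ≠ 0 := by simpa using (h.curve j).deriv_ne t
  field_simp

theorem Dom.geo (h : Dom n Ω γ) (hpos : ∀ j t, Pos Ω (γ j) t) : Geo Ω (tang γ) := by
  have hW : ∀ w, w ∉ frontier Ω → ∫ ζ in frontier Ω, tang γ ζ / (ζ - w) ∂μH[1] = Wtot γ w := by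
    intro w hw
    have := h.integral (fun ζ => (ζ - w)⁻¹) (by
      apply ContinuousOn.inv₀ (by fun_prop)
      intro z hz h0
      exact hw (sub_eq_zero.1 h0 ▸ hz))
    simp only [← div_eq_mul_inv] at this
    rw [Wtot]
    simp only [Wn]
    rw [← this]
    congr 1; funext ζ; rw [div_eq_inv_mul]
  obtain ⟨w1, w2⟩ := h.Wtot_val hpos
  refine ⟨h.nonempty, h.isOpen, h.conn, h.bdd, h.finite, ?_, h.lip, ?_, ?_, ?_, ?_, ?_⟩
  · intro z hz
    obtain ⟨j, t, rfl⟩ := h.exists_param hz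
    rw [h.tang_eq, norm_div, norm_real, norm_norm, div_self]
    simpa using (h.curve j).deriv_ne t
  · intro w hw; rw [hW w (h.not_frontier hw), w1 w hw]
  · intro w hw; rw [hW w (fun h' => hw (frontier_subset_closure h')), w2 w hw]
  · intro F F' hF hF'
    rw [h.integral F' hF']
    apply Finset.sum_eq_zero
    intro j _
    have hd : ∀ t, HasDerivAt (fun t => F (γ j t)) (deriv (γ j) t * F' (γ j t)) t := by
      intro t
      rw [mul_comm]
      exact (hF _ (h.mem_frontier j t)).comp_of_eq t ((h.curve j).hasDerivAt t) rfl
    have hcont : Continuous fun t => deriv (γ j) t * F' (γ j t) :=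
      (h.curve j).continuous_deriv.mul (hF'.comp_continuous (h.curve j).continuous (h.mem_frontier j))
    rw [intervalIntegral.integral_eq_sub_of_hasDerivAt (fun t _ => hd t) (hcont.intervalIntegrable _ _)]
    have h01 : γ j 1 = γ j 0 := by simpa using (h.curve j).periodic 0
    rw [h01, sub_self]
  · intro z hz
    obtain ⟨j, t, rfl⟩ := h.exists_param hz
    obtain ⟨δ, hδ, hP⟩ := hpos j t
    have c2 : ContinuousWithinAt (fun s : ℝ => γ j t - I * s * deriv (γ j) t) (Ioi 0) 0 := by fun_prop
    have hlim : Tendsto (fun s : ℝ => γ j t - I * s * deriv (γ j) t) (𝓝[>] 0) (𝓝 (γ j t)) := by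
      simpa [ContinuousWithinAt] using c2
    refine mem_closure_of_tendsto hlim ?_
    filter_upwards [self_mem_nhdsWithin, mem_nhdsWithin_of_mem_nhds (Iio_mem_nhds hδ)] with s hs hs'
    exact (hP t (by simpa using hδ) s hs hs').2
  · intro F hF z hz
    obtain ⟨j, t, rfl⟩ := h.exists_param hz
    set A := (γ j) ⁻¹' F ∩ Ioo (t - 1/2) (t + 1/2)
    have hA : A.Finite := by
      apply Set.Finite.of_finite_image (f := γ j) (hF.subset (by rintro _ ⟨u, hu, rfl⟩; exact hu.1))
      intro a ha b hb hab
      obtain ⟨k, hk⟩ := (h.curve j).inj _ _ hab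
      have hk1 : (k:ℝ) < 1 := by linarith [ha.2.2, hb.2.1]
      have hk2 : (-1:ℝ) < k := by linarith [ha.2.1, hb.2.2]
      have hk1' : k < 1 := by exact_mod_cast hk1
      have hk2' : -1 < k := by exact_mod_cast hk2
      have : k = 0 := by omega
      simpa [this] using hk
    have hd : Dense Aᶜ := by
      have := (dense_univ (X := ℝ)).sdiff_finite hA
      rwa [← compl_eq_univ_sdiff] at this
    have ht : t ∈ closure (Ioo (t - 1/2) (t + 1/2) ∩ Aᶜ) :=
      hd.open_subset_closure_inter isOpen_Ioo ⟨by linarith, by linarith⟩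
    have := image_closure_subset_closure_image (h.curve j).continuous (mem_image_of_mem (γ j) ht)
    refine closure_mono ?_ this
    rintro _ ⟨u, hu, rfl⟩
    exact ⟨h.mem_frontier j u, fun hF => hu.2 ⟨hF, hu.1⟩⟩

end SK

open MeasureTheory Complex Set Metric ComplexConjugate Filter Topology
open scoped ENNReal NNReal Interval

namespace SK

/-- locally Lipschitz on a set -/
def LL (X : Set ℂ) (φ : ℂ → ℂ) : Prop := ∀ z ∈ X, ∃ U ∈ 𝓝 z, ∃ L : ℝ, 0 ≤ L ∧ ∀ x ∈ X ∩ U, ∀ y ∈ X ∩ U,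
    ‖φ x - φ y‖ ≤ L * ‖x - y‖

theorem LL.continuousOn {X : Set ℂ} {φ : ℂ → ℂ} (h : LL X φ) : ContinuousOn φ X := contOn_of_lip h

theorem LL.mul {X : Set ℂ} {φ ψ : ℂ → ℂ} (h : LL X φ) (h' : LL X ψ) : LL X (fun z => φ z * ψ z) := by
  intro z hz
  have b1 : ∀ᶠ x in 𝓝[X] z, ‖φ x‖ < ‖φ z‖ + 1 := (h.continuousOn z hz).norm.eventually_lt_const (by linarith)
  have b2 : ∀ᶠ x in 𝓝[X] z, ‖ψ x‖ < ‖ψ z‖ + 1 := (h'.continuousOn z hz).norm.eventually_lt_const (by linarith)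
  rw [eventually_nhdsWithin_iff] at b1 b2
  obtain ⟨U, hU, L, hL, h1⟩ := h z hz
  obtain ⟨V, hV, M, hM, h2⟩ := h' z hz
  refine ⟨_, inter_mem (inter_mem hU hV) (b1.and b2), (‖φ z‖ + 1) * M + (‖ψ z‖ + 1) * L, by positivity, ?_⟩
  rintro x ⟨hx, ⟨hxU, hxV⟩, hx1, hx2⟩ y ⟨hy, ⟨hyU, hyV⟩, hy1, hy2⟩
  have e : φ x * ψ x - φ y * ψ y = φ x * (ψ x - ψ y) + ψ y * (φ x - φ y) := by ring
  rw [e]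
  refine (norm_add_le _ _).trans ?_
  rw [norm_mul, norm_mul, add_mul, mul_assoc, mul_assoc]
  have a1 := (hx1 hx).le
  have a2 := (hy2 hy).le
  have a3 := h1 x ⟨hx, hxU⟩ y ⟨hy, hyU⟩
  have a4 := h2 x ⟨hx, hxV⟩ y ⟨hy, hyV⟩
  gcongr

theorem LL.conj {X : Set ℂ} {φ : ℂ → ℂ} (h : LL X φ) : LL X (fun z => conj (φ z)) := by
  intro z hz
  obtain ⟨U, hU, L, hL, h1⟩ := h z hz
  refine ⟨U, hU, L, hL, fun x hx y hy => ?_⟩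
  rw [← map_sub, RCLike.norm_conj]
  exact h1 x hx y hy

theorem LL.of_contDiffAt {X : Set ℂ} {φ : ℂ → ℂ} (h : ∀ z ∈ X, ContDiffAt ℂ 1 φ z) : LL X φ := by
  intro z hz
  obtain ⟨K, s, hs, hK⟩ := (h z hz).exists_lipschitzOnWith
  refine ⟨s, hs, K, K.2, fun x hx y hy => ?_⟩
  have := hK.dist_le_mul x hx.2 y hy.2
  rwa [dist_eq_norm, dist_eq_norm] at this

theorem LL.congr {X : Set ℂ} {φ ψ : ℂ → ℂ} (h : LL X φ) (e : ∀ z ∈ X, ψ z = φ z) : LL X ψ := by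
  intro z hz
  obtain ⟨U, hU, L, hL, h1⟩ := h z hz
  refine ⟨U, hU, L, hL, fun x hx y hy => ?_⟩
  rw [e x hx.1, e y hy.1]
  exact h1 x hx y hy

variable {Ω : Set ℂ} {T : ℂ → ℂ}

theorem Geo.compact (g : Geo Ω T) : IsCompact (frontier Ω) :=
  Metric.isCompact_of_isClosed_isBounded isClosed_frontier (g.bdd.closure.subset frontier_subset_closure)

theorem Geo.compact_closure (g : Geo Ω T) : IsCompact (closure Ω) :=
  Metric.isCompact_of_isClosed_isBounded isClosed_closure g.bdd.closure

theorem Geo.isFinite (g : Geo Ω T) : IsFiniteMeasure ((μH[1] : Measure ℂ).restrict (frontier Ω)) :=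
  ⟨by rw [Measure.restrict_apply_univ]; exact g.fin⟩

theorem Geo.contT (g : Geo Ω T) : ContinuousOn T (frontier Ω) := contOn_of_lip g.lipT

theorem Geo.integrable (g : Geo Ω T) {f : ℂ → ℂ} (hf : ContinuousOn f (frontier Ω)) :
    Integrable f ((μH[1] : Measure ℂ).restrict (frontier Ω)) :=
  hf.integrableOn_of_subset_isCompact g.compact isClosed_frontier.measurableSet subset_rfl g.fin.ne

theorem Geo.meas {f : ℂ → ℂ} (hf : ContinuousOn f (frontier Ω)) :
    AEStronglyMeasurable f ((μH[1] : Measure ℂ).restrict (frontier Ω)) :=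
  hf.aestronglyMeasurable isClosed_frontier.measurableSet

theorem Geo.not_frontier (g : Geo Ω T) {z : ℂ} (hz : z ∈ Ω) : z ∉ frontier Ω := by
  rw [g.isOpen.frontier_eq]; exact fun h' => h'.2 hz

theorem not_frontier_ext {z : ℂ} (hz : z ∈ (closure Ω)ᶜ) : z ∉ frontier Ω :=
  fun h => hz (frontier_subset_closure h)

theorem contOn_cauchy {f : ℂ → ℂ} (hf : ContinuousOn f (frontier Ω)) {w : ℂ} (hw : w ∉ frontier Ω) :
    ContinuousOn (fun ζ => f ζ / (ζ - w)) (frontier Ω) := by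
  apply hf.div (by fun_prop)
  intro z hz h0
  exact hw (sub_eq_zero.1 h0 ▸ hz)

theorem Geo.frontier_nonempty (g : Geo Ω T) : (frontier Ω).Nonempty := by
  by_contra h
  rw [not_nonempty_iff_eq_empty] at h
  rcases isClopen_iff.1 (isClopen_iff_frontier_eq_empty.2 h) with h' | h'
  · exact g.nonempty.ne_empty h'
  · have := g.bdd
    rw [h'] at this
    exact NormedSpace.unbounded_univ ℝ ℂ this

theorem Geo.cauchy_limit (g : Geo Ω T) {φ : ℂ → ℂ} (hφ : LL (frontier Ω) φ) {w0 : ℂ} (hw0 : w0 ∈ frontier Ω) :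
    ∃ I0 : ℂ, Tendsto (fun w => ∫ ζ in frontier Ω, φ ζ * T ζ / (ζ - w) ∂μH[1]) (𝓝[Ω] w0) (𝓝 (I0 + 2 * Real.pi * I * φ w0)) ∧
      Tendsto (fun w => ∫ ζ in frontier Ω, φ ζ * T ζ / (ζ - w) ∂μH[1]) (𝓝[(closure Ω)ᶜ] w0) (𝓝 I0) := by
  have hex : ∀ w : ℂ, ∃ v ∈ frontier Ω, infDist w (frontier Ω) = dist w v := fun w =>
    g.compact.exists_infDist_eq_dist g.frontier_nonempty w
  choose st hst1 hst2 using hex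
  have hst3 : ∀ w, ∀ ζ ∈ frontier Ω, ‖w - st w‖ ≤ ‖ζ - w‖ := by
    intro w ζ hζ
    rw [← dist_eq_norm, ← hst2 w, ← dist_eq_norm, dist_comm]
    exact infDist_le_dist_of_mem hζ
  have hst4 : Tendsto st (𝓝 w0) (𝓝[frontier Ω] w0) := by
    rw [tendsto_nhdsWithin_iff]
    refine ⟨?_, Eventually.of_forall hst1⟩
    rw [tendsto_iff_norm_sub_tendsto_zero]
    have hlim : Tendsto (fun w : ℂ => 2 * ‖w - w0‖) (𝓝 w0) (𝓝 0) := by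
      have : ContinuousAt (fun w : ℂ => 2 * ‖w - w0‖) w0 := by fun_prop
      simpa [ContinuousAt] using this
    refine squeeze_zero (fun _ => norm_nonneg _) (fun w => ?_) hlim
    have h1 := hst3 w w0 hw0
    have h2 : st w - w0 = (w - w0) - (w - st w) := by ring
    rw [h2]
    refine (norm_sub_le _ _).trans ?_
    rw [norm_sub_rev w0 w] at h1
    linarith
  have hφc := hφ.continuousOn
  have hφst : Tendsto (fun w => φ (st w)) (𝓝 w0) (𝓝 (φ w0)) := (hφc w0 hw0).tendsto.comp hst4
  obtain ⟨M, hM⟩ := g.compact.exists_bound_of_continuousOn hφc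
  have hM0 : 0 ≤ M := (norm_nonneg _).trans (hM w0 hw0)
  obtain ⟨U, hU, L, hL, hlip⟩ := hφ w0 hw0
  obtain ⟨d, hd, hdU⟩ := Metric.mem_nhds_iff.1 hU
  have hnear : ∀ᶠ w in 𝓝 w0, st w ∈ ball w0 (d/2) :=
    (hst4.mono_right nhdsWithin_le_nhds).eventually (ball_mem_nhds w0 (by positivity))
  set L' := L + 4 * M / d with hL'
  have hL'0 : 0 ≤ L' := by positivity
  have hbound : ∀ᶠ w in 𝓝 w0, ∀ ζ ∈ frontier Ω, ‖φ ζ - φ (st w)‖ ≤ L' * ‖ζ - st w‖ := by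
    filter_upwards [hnear] with w hw ζ hζ
    by_cases hζU : ζ ∈ ball w0 d
    · refine (hlip ζ ⟨hζ, hdU hζU⟩ (st w) ⟨hst1 w, hdU (ball_subset_ball (by linarith) hw)⟩).trans ?_
      gcongr
      rw [hL']; have : 0 ≤ 4 * M / d := by positivity
      linarith
    · have h1 : d/2 ≤ ‖ζ - st w‖ := by
        rw [mem_ball, not_lt] at hζU
        rw [mem_ball] at hw
        rw [← dist_eq_norm]
        have := dist_triangle ζ (st w) w0
        linarith
      calc ‖φ ζ - φ (st w)‖ ≤ M + M := (norm_sub_le _ _).trans (add_le_add (hM ζ hζ) (hM _ (hst1 w)))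
        _ = (4 * M / d) * (d / 2) := by field_simp; ring
        _ ≤ L' * ‖ζ - st w‖ := by
          gcongr
          rw [hL']; linarith
  set σ := (μH[1] : Measure ℂ).restrict (frontier Ω) with hσ
  have := g.isFinite
  set G : ℂ → ℂ → ℂ := fun w ζ => (φ ζ - φ (st w)) * T ζ / (ζ - w) with hG
  have hGc : ∀ w, w ∉ frontier Ω → ContinuousOn (G w) (frontier Ω) := fun w hw =>
    contOn_cauchy ((hφc.sub continuousOn_const).mul g.contT) hw
  have hlimG : Tendsto (fun w => ∫ ζ, G w ζ ∂σ) (𝓝[(frontier Ω)ᶜ] w0)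
      (𝓝 (∫ ζ, (φ ζ - φ w0) * T ζ / (ζ - w0) ∂σ)) := by
    apply tendsto_integral_filter_of_dominated_convergence (fun _ => 2 * L')
    · filter_upwards [self_mem_nhdsWithin] with w hw
      exact Geo.meas (hGc w hw)
    · filter_upwards [self_mem_nhdsWithin, mem_nhdsWithin_of_mem_nhds hbound] with w hw hb
      refine (ae_restrict_mem isClosed_frontier.measurableSet).mono fun ζ hζ => ?_
      have hne : 0 < ‖ζ - w‖ := norm_pos_iff.2 fun h0 => hw (sub_eq_zero.1 h0 ▸ hζ)
      simp only [hG]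
      rw [norm_div, norm_mul, g.normT ζ hζ, mul_one, div_le_iff₀ hne]
      refine (hb ζ hζ).trans ?_
      have : ‖ζ - st w‖ ≤ 2 * ‖ζ - w‖ := by
        have e : ζ - st w = (ζ - w) + (w - st w) := by ring
        rw [e]
        refine (norm_add_le _ _).trans ?_
        linarith [hst3 w ζ hζ]
      nlinarith
    · exact integrable_const _
    · have hae : ∀ᵐ ζ ∂σ, ζ ≠ w0 := by
        apply ae_restrict_of_ae
        have := Measure.nullSingletonClass_hausdorff ℂ (d := 1) one_pos
        rw [ae_iff]
        simp
      filter_upwards [hae] with ζ hζ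
      apply Tendsto.mono_left _ nhdsWithin_le_nhds
      refine ((tendsto_const_nhds.sub hφst).mul tendsto_const_nhds).div (tendsto_const_nhds.sub tendsto_id) ?_
      exact sub_ne_zero.2 hζ
  have hEq : ∀ w, w ∉ frontier Ω → ∫ ζ in frontier Ω, φ ζ * T ζ / (ζ - w) ∂μH[1] =
      (∫ ζ, G w ζ ∂σ) + φ (st w) * ∫ ζ in frontier Ω, T ζ / (ζ - w) ∂μH[1] := by
    intro w hw
    rw [← integral_const_mul, ← integral_add (g.integrable (hGc w hw)) ((g.integrable (contOn_cauchy g.contT hw)).const_mul _)]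
    congr 1; funext ζ; simp only [hG]; ring
  refine ⟨∫ ζ, (φ ζ - φ w0) * T ζ / (ζ - w0) ∂σ, ?_, ?_⟩
  · have h1 : Tendsto (fun w => (∫ ζ, G w ζ ∂σ) + φ (st w) * (2 * Real.pi * I)) (𝓝[Ω] w0)
        (𝓝 ((∫ ζ, (φ ζ - φ w0) * T ζ / (ζ - w0) ∂σ) + φ w0 * (2 * Real.pi * I))) :=
      (hlimG.mono_left (nhdsWithin_mono _ fun z hz => g.not_frontier hz)).add
        ((hφst.mono_left nhdsWithin_le_nhds).mul_const _)
    rw [mul_comm (φ w0)] at h1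
    refine h1.congr' ?_
    filter_upwards [self_mem_nhdsWithin] with w hw
    rw [hEq w (g.not_frontier hw), g.inner w hw]
  · have h1 := hlimG.mono_left (nhdsWithin_mono w0 (s := (closure Ω)ᶜ) fun z hz => not_frontier_ext hz)
    refine h1.congr' ?_
    filter_upwards [self_mem_nhdsWithin] with w hw
    rw [hEq w (not_frontier_ext hw), g.outer w hw, mul_zero, add_zero]

theorem Geo.plemelj (g : Geo Ω T) {φ : ℂ → ℂ} (hφ : LL (frontier Ω) φ) {R : ℂ → ℂ}
    (hR : ∀ w ∈ (closure Ω)ᶜ, ∫ ζ in frontier Ω, φ ζ * T ζ / (ζ - w) ∂μH[1] = R w)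
    {w0 : ℂ} (hw0 : w0 ∈ frontier Ω) (hRc : ContinuousAt R w0) :
    Tendsto (fun w => ∫ ζ in frontier Ω, φ ζ * T ζ / (ζ - w) ∂μH[1]) (𝓝[Ω] w0) (𝓝 (R w0 + 2 * Real.pi * I * φ w0)) := by
  obtain ⟨I0, h1, h2⟩ := g.cauchy_limit hφ hw0
  have hne : (𝓝[(closure Ω)ᶜ] w0).NeBot := mem_closure_iff_nhdsWithin_neBot.1 (g.ext_dense hw0)
  have h3 : Tendsto (fun w => ∫ ζ in frontier Ω, φ ζ * T ζ / (ζ - w) ∂μH[1]) (𝓝[(closure Ω)ᶜ] w0) (𝓝 (R w0)) := by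
    refine (hRc.tendsto.mono_left nhdsWithin_le_nhds).congr' ?_
    filter_upwards [self_mem_nhdsWithin] with w hw
    exact (hR w hw).symm
  rw [tendsto_nhds_unique h2 h3] at h1
  exact h1

theorem Geo.cauchy_diff (g : Geo Ω T) {f : ℂ → ℂ} (hf : ContinuousOn f (frontier Ω)) {w0 : ℂ} (hw0 : w0 ∉ frontier Ω) :
    DifferentiableAt ℂ (fun w => ∫ ζ in frontier Ω, f ζ / (ζ - w) ∂μH[1]) w0 := by
  obtain ⟨r, hr, hball⟩ := Metric.isOpen_iff.1 isClosed_frontier.isOpen_compl w0 hw0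
  obtain ⟨M, hM⟩ := g.compact.exists_bound_of_continuousOn hf
  have := g.isFinite
  have hfar : ∀ ζ ∈ frontier Ω, ∀ w ∈ ball w0 (r/2), r/2 ≤ ‖ζ - w‖ := by
    intro ζ hζ w hw
    by_contra hlt
    push Not at hlt
    refine hball ?_ hζ
    rw [mem_ball] at hw ⊢
    rw [← dist_eq_norm] at hlt
    linarith [dist_triangle ζ w w0]
  have key := hasDerivAt_integral_of_dominated_loc_of_deriv_le (𝕜 := ℂ) (μ := (μH[1] : Measure ℂ).restrict (frontier Ω))
    (F := fun w ζ => f ζ / (ζ - w)) (F' := fun w ζ => f ζ / (ζ - w)^2) (x₀ := w0) (s := ball w0 (r/2))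
    (bound := fun _ => M / (r/2)^2) (ball_mem_nhds _ (by positivity)) ?_ ?_ ?_ ?_ ?_ ?_
  · exact key.2.differentiableAt
  · filter_upwards [isClosed_frontier.isOpen_compl.mem_nhds hw0] with w hw
    exact Geo.meas (contOn_cauchy hf hw)
  · exact g.integrable (contOn_cauchy hf hw0)
  · apply Geo.meas
    apply hf.div (by fun_prop)
    intro z hz h0
    exact hw0 (sub_eq_zero.1 (pow_eq_zero_iff two_ne_zero |>.1 h0) ▸ hz)
  · refine (ae_restrict_mem isClosed_frontier.measurableSet).mono fun ζ hζ w hw => ?_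
    rw [norm_div, norm_pow]
    have h1 := hfar ζ hζ w hw
    have h2 := hM ζ hζ
    have : 0 ≤ M := (norm_nonneg _).trans h2
    gcongr
  · exact integrable_const _
  · refine (ae_restrict_mem isClosed_frontier.measurableSet).mono fun ζ hζ w hw => ?_
    have h1 : ζ - w ≠ 0 := by
      intro h0
      have := hfar ζ hζ w hw
      rw [h0, norm_zero] at this; linarith
    have := ((hasDerivAt_const w (f ζ)).div ((hasDerivAt_id w).const_sub ζ) h1)
    refine this.congr_deriv ?_
    simp

end SK

open MeasureTheory Complex Set Metric ComplexConjugate Filter Topology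
open scoped ENNReal NNReal Interval

namespace SK
open Polynomial in
theorem exists_antideriv (N : ℂ[X]) : ∃ F : ℂ[X], derivative F = N := by
  induction N using Polynomial.induction_on' with
  | add p q hp hq =>
    obtain ⟨F, hF⟩ := hp
    obtain ⟨G, hG⟩ := hq
    exact ⟨F + G, by rw [derivative_add, hF, hG]⟩
  | monomial n a =>
    refine ⟨monomial (n+1) (a / (n+1)), ?_⟩
    rw [derivative_monomial]
    congr 1
    push_cast
    have : (n:ℂ) + 1 ≠ 0 := by exact_mod_cast n.succ_ne_zero
    field_simp

noncomputable def den (l : Multiset ℂ) (z : ℂ) : ℂ := (l.map (fun p => z - p)).prod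

theorem den_cons (p : ℂ) (l : Multiset ℂ) (z : ℂ) : den (p ::ₘ l) z = (z - p) * den l z := by simp [den]

theorem den_ne_zero {l : Multiset ℂ} {z : ℂ} (h : z ∉ l) : den l z ≠ 0 := by
  rw [den]
  intro h0
  rw [Multiset.prod_eq_zero_iff, Multiset.mem_map] at h0
  obtain ⟨p, hp, hp'⟩ := h0
  exact h (sub_eq_zero.1 hp' ▸ hp)

theorem den_continuous (l : Multiset ℂ) : Continuous (den l) := by
  unfold den
  induction l using Multiset.induction_on with
  | empty => simp; exact continuous_const
  | cons p l ih => simp only [Multiset.map_cons, Multiset.prod_cons]; exact (continuous_id.sub continuous_const).mul ih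

variable {Ω : Set ℂ} {T : ℂ → ℂ}

open Polynomial in
theorem Geo.rat_zero_aux (g : Geo Ω T) (n : ℕ) : ∀ l : Multiset ℂ, Multiset.card l = n → (∀ p ∈ l, p ∈ (closure Ω)ᶜ) → ∀ N : ℂ[X],
    ∫ ζ in frontier Ω, N.eval ζ / den l ζ * T ζ ∂μH[1] = 0 := by
  induction n with
  | zero =>
    intro l hl _ N
    rw [Multiset.card_eq_zero] at hl
    subst hl
    obtain ⟨F, hF⟩ := exists_antideriv N
    have := g.exact (fun z => F.eval z) (fun z => N.eval z) (fun z _ => hF ▸ F.hasDerivAt z) N.continuous.continuousOn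
    simpa [den] using this
  | succ n ih =>
    intro l hl hp N
    have hnz : ∀ l' ≤ l, ∀ z ∈ frontier Ω, den l' z ≠ 0 := by
      intro l' hle z hz
      exact den_ne_zero fun h => hp z (Multiset.mem_of_le hle h) (frontier_subset_closure hz)
    have hintg : ∀ l' ≤ l, ∀ N : ℂ[X], Integrable (fun ζ => N.eval ζ / den l' ζ * T ζ) ((μH[1] : Measure ℂ).restrict (frontier Ω)) := by
      intro l' hle N
      exact g.integrable ((N.continuous.continuousOn.div (den_continuous l').continuousOn (hnz l' hle)).mul g.contT)
    obtain ⟨p, hpl⟩ : ∃ p, p ∈ l := Multiset.card_pos_iff_exists_mem.1 (by omega)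
    obtain ⟨l', rfl⟩ := Multiset.exists_cons_of_mem hpl
    have hl' : Multiset.card l' = n := by simpa using hl
    have hp' : ∀ q ∈ l', q ∈ (closure Ω)ᶜ := fun q hq => hp q (Multiset.mem_cons_of_mem hq)
    have hpe := hp p (Multiset.mem_cons_self _ _)
    have hzp : ∀ q ∈ p ::ₘ l', ∀ z ∈ frontier Ω, z - q ≠ 0 := by
      intro q hq z hz h0
      exact hp q hq (sub_eq_zero.1 h0 ▸ frontier_subset_closure hz)
    have hconst : ∀ c : ℂ, ∫ ζ in frontier Ω, (C c).eval ζ / den (p ::ₘ l') ζ * T ζ ∂μH[1] = 0 := by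
      intro c
      by_cases hall : ∀ q ∈ l', q = p
      · have hrep : l' = Multiset.replicate n p := Multiset.eq_replicate.2 ⟨hl', hall⟩
        have hden : ∀ z, den (p ::ₘ l') z = (z - p)^(n+1) := by
          intro z; rw [hrep, den_cons]; simp [den]; ring
        rcases Nat.eq_zero_or_pos n with hn | hn
        · subst hn
          have := g.outer p hpe
          have e : (fun ζ => (C c).eval ζ / den (p ::ₘ l') ζ * T ζ) = fun ζ => c * (T ζ / (ζ - p)) := by
            funext ζ; rw [hden]; simp; ring
          rw [e, integral_const_mul, this, mul_zero]
        · refine g.exact (fun z => -c / n * ((z - p)^n)⁻¹) _ ?_ ?_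
          · intro z hz
            have h1 := hzp p (Multiset.mem_cons_self _ _) z hz
            have h2 : HasDerivAt (fun z : ℂ => (z - p)^n) (n * (z-p)^(n-1) * 1) z := ((hasDerivAt_id z).sub_const p).pow n
            have := (h2.inv (pow_ne_zero n h1)).const_mul (-c/n)
            refine this.congr_deriv ?_
            rw [hden]
            obtain ⟨k, rfl⟩ : ∃ k, n = k + 1 := ⟨n-1, by omega⟩
            have : ((k+1 : ℕ):ℂ) ≠ 0 := by exact_mod_cast k.succ_ne_zero
            simp only [eval_C, Nat.add_sub_cancel, mul_one]
            field_simp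
            ring
          · exact (C c).continuous.continuousOn.div (den_continuous _).continuousOn (hnz _ le_rfl)
      · push Not at hall
        obtain ⟨q, hq, hqp⟩ := hall
        obtain ⟨l'', rfl⟩ := Multiset.exists_cons_of_mem hq
        have hpq : p - q ≠ 0 := sub_ne_zero.2 (Ne.symm hqp)
        have e : EqOn (fun ζ => (C c).eval ζ / den (p ::ₘ q ::ₘ l'') ζ * T ζ) (fun ζ => (C (c/(p-q))).eval ζ / den (p ::ₘ l'') ζ * T ζ -
            (C (c/(p-q))).eval ζ / den (q ::ₘ l'') ζ * T ζ) (frontier Ω) := by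
          intro z hz
          have h1 := hzp p (by simp) z hz
          have h2 := hzp q (by simp) z hz
          have h3 : den l'' z ≠ 0 := hnz l'' (by rw [← Multiset.cons_swap]; exact (Multiset.le_cons_self _ _).trans ((Multiset.le_cons_self _ _))) z hz
          simp only [den_cons, eval_C]
          field_simp
          ring
        rw [setIntegral_congr_fun isClosed_frontier.measurableSet e, integral_sub]
        · rw [ih (p ::ₘ l'') (by simpa using hl') (by intro x hx; apply hp; simp at hx ⊢; tauto),
            ih (q ::ₘ l'') (by simpa using hl') (by intro x hx; apply hp; simp at hx ⊢; tauto), sub_zero]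
        · exact hintg _ (by rw [Multiset.cons_swap]; exact Multiset.le_cons_self _ _) _
        · exact hintg _ (Multiset.le_cons_self _ _) _
    have hN : N = (X - C p) * (N /ₘ (X - C p)) + C (N.eval p) := by
      have := modByMonic_add_div N (X - C p)
      rw [modByMonic_X_sub_C_eq_C_eval] at this
      rw [add_comm]; exact this.symm
    have e : EqOn (fun ζ => N.eval ζ / den (p ::ₘ l') ζ * T ζ) (fun ζ => (N /ₘ (X - C p)).eval ζ / den l' ζ * T ζ +
        (C (N.eval p)).eval ζ / den (p ::ₘ l') ζ * T ζ) (frontier Ω) := by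
      intro z hz
      have h1 := hzp p (by simp) z hz
      have h3 : den l' z ≠ 0 := hnz l' (Multiset.le_cons_self _ _) z hz
      have hNz : N.eval z = (z - p) * (N /ₘ (X - C p)).eval z + N.eval p := by
        conv_lhs => rw [hN]
        simp
      simp only [den_cons, eval_C, hNz]
      field_simp
    rw [setIntegral_congr_fun isClosed_frontier.measurableSet e, integral_add (hintg _ (Multiset.le_cons_self _ _) _) (hintg _ le_rfl _),
      hconst, ih l' hl' hp', add_zero]

open Polynomial in
theorem Geo.rat_zero (g : Geo Ω T) (N D : ℂ[X]) (hD : ∀ z ∈ closure Ω, D.eval z ≠ 0) :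
    ∫ ζ in frontier Ω, N.eval ζ / D.eval ζ * T ζ ∂μH[1] = 0 := by
  have hD0 : D ≠ 0 := by
    rintro rfl
    obtain ⟨z, hz⟩ := g.nonempty
    exact hD z (subset_closure hz) (by simp)
  have hs := (IsAlgClosed.splits D).eq_prod_roots
  have hev : ∀ z, D.eval z = D.leadingCoeff * den D.roots z := by
    intro z
    conv_lhs => rw [hs]
    rw [eval_mul, eval_C, eval_multiset_prod, Multiset.map_map, den]
    simp
  have := g.rat_zero_aux _ D.roots rfl (by
    intro p hp hpc
    exact hD p hpc (isRoot_of_mem_roots hp)) (C (D.leadingCoeff⁻¹) * N)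
  rw [← this]
  congr 1; funext ζ
  rw [hev, eval_mul, eval_C]
  have : D.leadingCoeff ≠ 0 := by simpa using hD0
  field_simp

end SK

open MeasureTheory Complex Set Metric ComplexConjugate Filter Topology
open scoped ENNReal NNReal Interval

open Polynomial in
structure SK.Ker (Ω : Set ℂ) (T : ℂ → ℂ) (S : ℂ → ℂ → ℂ) (A : Set ℂ) : Prop where
  geo : SK.Geo Ω T
  sub : A ⊆ Ω
  cofin : (Ω \ A).Finite
  cont : ∀ a ∈ Ω, ContinuousOn (fun z => S z a) (closure Ω)
  holo : ∀ a ∈ Ω, DifferentiableOn ℂ (fun z => S z a) Ω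
  herm : ∀ z ∈ Ω, ∀ w ∈ Ω, S z w = conj (S w z)
  repr : ∀ h : ℂ → ℂ, ContinuousOn h (closure Ω) → DifferentiableOn ℂ h Ω →
    ∀ a ∈ Ω, h a = ∫ ζ in frontier Ω, h ζ * conj (S ζ a) ∂μH[1]
  rat : ∀ a ∈ A, ∃ p q : ℂ[X], ∀ z ∈ closure Ω, q.eval z ≠ 0 ∧ S z a * q.eval z = p.eval z
  deg : ∃ m : ℕ, ∃ F : Set ℂ, F.Finite ∧ ∀ z ∈ Ω \ F, ∃ p q : ℂ[X], q ≠ 0 ∧ p.natDegree ≤ m ∧ q.natDegree ≤ m ∧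
    ∀ a ∈ Ω, S z a * q.eval (conj a) = p.eval (conj a)

namespace SK

noncomputable def E (Ω : Set ℂ) (S : ℂ → ℂ → ℂ) (w a : ℂ) : ℂ := ∫ ζ in frontier Ω, conj (S ζ a) / (ζ - w) ∂μH[1]

open Classical in
noncomputable def Eb (Ω : Set ℂ) (T : ℂ → ℂ) (S : ℂ → ℂ → ℂ) (a w : ℂ) : ℂ :=
  if w ∈ Ω then E Ω S w a else 1 / (a - w) + 2 * Real.pi * I * (conj (S w a) * conj (T w))

variable {Ω : Set ℂ} {T : ℂ → ℂ} {S : ℂ → ℂ → ℂ} {A : Set ℂ}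

theorem Ker.LLS (k : Ker Ω T S A) {a : ℂ} (ha : a ∈ A) : LL (frontier Ω) (fun z => S z a) := by
  obtain ⟨p, q, h⟩ := k.rat a ha
  have : LL (frontier Ω) (fun z => p.eval z / q.eval z) := by
    apply LL.of_contDiffAt
    intro z hz
    have hp : ContDiff ℂ 1 (fun z => p.eval z) := p.differentiable.contDiff
    have hq : ContDiff ℂ 1 (fun z => q.eval z) := q.differentiable.contDiff
    exact (hp.contDiffAt.div hq.contDiffAt (h z (frontier_subset_closure hz)).1)
  refine this.congr fun z hz => ?_
  have := h z (frontier_subset_closure hz)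
  rw [eq_div_iff this.1, this.2]

theorem Ker.LLφ (k : Ker Ω T S A) {a : ℂ} (ha : a ∈ A) : LL (frontier Ω) (fun z => conj (S z a) * conj (T z)) :=
  (k.LLS ha).conj.mul (LL.conj k.geo.lipT)

theorem Geo.TT (g : Geo Ω T) {z : ℂ} (hz : z ∈ frontier Ω) : conj (T z) * T z = 1 := by
  rw [Complex.conj_mul', g.normT z hz]; simp

theorem Ker.contS (k : Ker Ω T S A) {a : ℂ} (ha : a ∈ Ω) : ContinuousOn (fun z => conj (S z a)) (frontier Ω) :=
  continuous_conj.comp_continuousOn ((k.cont a ha).mono frontier_subset_closure)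

theorem Ker.E_eq (k : Ker Ω T S A) (w a : ℂ) :
    E Ω S w a = ∫ ζ in frontier Ω, (conj (S ζ a) * conj (T ζ)) * T ζ / (ζ - w) ∂μH[1] := by
  apply setIntegral_congr_fun isClosed_frontier.measurableSet
  intro z hz
  simp only []
  rw [mul_assoc, k.geo.TT hz, mul_one]

theorem Ker.E_ext (k : Ker Ω T S A) {a : ℂ} (ha : a ∈ Ω) {w : ℂ} (hw : w ∈ (closure Ω)ᶜ) : E Ω S w a = 1 / (a - w) := by
  have hne : ∀ z ∈ closure Ω, z - w ≠ 0 := fun z hz h0 => hw (sub_eq_zero.1 h0 ▸ hz)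
  have := k.repr (fun z => 1 / (z - w)) (continuousOn_const.div (by fun_prop) hne)
    ((differentiableOn_const _).div (by fun_prop) fun z hz => hne z (subset_closure hz)) a ha
  rw [this, E]
  congr 1; funext ζ; ring

theorem Ker.E_lim (k : Ker Ω T S A) {a : ℂ} (ha : a ∈ A) {w0 : ℂ} (hw : w0 ∈ frontier Ω) :
    Tendsto (fun w => E Ω S w a) (𝓝[Ω] w0) (𝓝 (1 / (a - w0) + 2 * Real.pi * I * (conj (S w0 a) * conj (T w0)))) := by
  have hne : a - w0 ≠ 0 := fun h0 => k.geo.not_frontier (k.sub ha) (sub_eq_zero.1 h0 ▸ hw)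
  have := k.geo.plemelj (k.LLφ ha) (R := fun w => 1 / (a - w)) (fun w hw => by rw [← k.E_eq, k.E_ext (k.sub ha) hw]) hw
    (continuousAt_const.div (by fun_prop) hne)
  refine this.congr fun w => ?_
  rw [k.E_eq]

theorem Ker.E_diff (k : Ker Ω T S A) {a : ℂ} (ha : a ∈ Ω) {w : ℂ} (hw : w ∈ Ω) : DifferentiableAt ℂ (fun w => E Ω S w a) w :=
  k.geo.cauchy_diff (k.contS ha) (k.geo.not_frontier hw)

theorem Eb_of_mem {a w : ℂ} (hw : w ∈ Ω) : Eb Ω T S a w = E Ω S w a := if_pos hw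
theorem Eb_of_not_mem {a w : ℂ} (hw : w ∉ Ω) : Eb Ω T S a w = 1 / (a - w) + 2 * Real.pi * I * (conj (S w a) * conj (T w)) := if_neg hw

theorem Geo.closure_eq (g : Geo Ω T) : closure Ω = Ω ∪ frontier Ω := by
  rw [g.isOpen.frontier_eq, union_sdiff_cancel subset_closure]

theorem Ker.Eb_diff (k : Ker Ω T S A) {a : ℂ} (ha : a ∈ Ω) : DifferentiableOn ℂ (Eb Ω T S a) Ω := by
  intro w hw
  refine ((k.E_diff ha hw).congr_of_eventuallyEq ?_).differentiableWithinAt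
  filter_upwards [k.geo.isOpen.mem_nhds hw] with z hz
  exact Eb_of_mem hz

theorem Ker.Eb_cont (k : Ker Ω T S A) {a : ℂ} (ha : a ∈ A) : ContinuousOn (Eb Ω T S a) (closure Ω) := by
  intro w hw
  rw [k.geo.closure_eq] at hw ⊢
  rcases hw with hw | hw
  · exact ((k.Eb_diff (k.sub ha)).differentiableAt (k.geo.isOpen.mem_nhds hw)).continuousAt.continuousWithinAt
  · have hwn : w ∉ Ω := fun h => k.geo.not_frontier h hw
    have hne : a - w ≠ 0 := fun h0 => k.geo.not_frontier (k.sub ha) (sub_eq_zero.1 h0 ▸ hw)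
    rw [continuousWithinAt_union]
    constructor
    · rw [ContinuousWithinAt, Eb_of_not_mem hwn]
      refine (k.E_lim ha hw).congr' ?_
      filter_upwards [self_mem_nhdsWithin] with z hz using (Eb_of_mem hz).symm
    · have : ContinuousWithinAt (fun w => 1 / (a - w) + 2 * Real.pi * I * (conj (S w a) * conj (T w))) (frontier Ω) w :=
        (continuousWithinAt_const.div (by fun_prop) hne).add (continuousWithinAt_const.mul ((k.LLφ ha).continuousOn w hw))
      refine this.congr (fun z hz => Eb_of_not_mem fun h => k.geo.not_frontier h hz) (Eb_of_not_mem hwn)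

theorem Ker.SST (k : Ker Ω T S A) {a b : ℂ} (ha : a ∈ A) (hb : b ∈ A) :
    ∫ ζ in frontier Ω, S ζ a * S ζ b * T ζ ∂μH[1] = 0 := by
  obtain ⟨p, q, h⟩ := k.rat a ha
  obtain ⟨p', q', h'⟩ := k.rat b hb
  have := k.geo.rat_zero (p * p') (q * q') (by
    intro z hz
    rw [Polynomial.eval_mul]
    exact mul_ne_zero (h z hz).1 (h' z hz).1)
  rw [← this]
  apply setIntegral_congr_fun isClosed_frontier.measurableSet
  intro z hz
  have h1 := h z (frontier_subset_closure hz)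
  have h2 := h' z (frontier_subset_closure hz)
  have h3 := h1.1
  have h4 := h2.1
  simp only [Polynomial.eval_mul, ← h1.2, ← h2.2]
  field_simp

theorem Ker.antisymm (k : Ker Ω T S A) {a b : ℂ} (ha : a ∈ A) (hb : b ∈ A) : E Ω S b a = - E Ω S a b := by
  have hr := k.repr _ (k.Eb_cont ha) (k.Eb_diff (k.sub ha)) b (k.sub hb)
  rw [Eb_of_mem (k.sub hb)] at hr
  rw [hr]
  have e : EqOn (fun ζ => Eb Ω T S a ζ * conj (S ζ b)) (fun ζ => - (conj (S ζ b) / (ζ - a)) + 2 * Real.pi * I * conj (S ζ a * S ζ b * T ζ)) (frontier Ω) := by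
    intro z hz
    have hne : a - z ≠ 0 := fun h0 => k.geo.not_frontier (k.sub ha) (sub_eq_zero.1 h0 ▸ hz)
    have hne' : z - a ≠ 0 := by rw [← neg_sub]; exact neg_ne_zero.2 hne
    simp only [Eb_of_not_mem (fun h => k.geo.not_frontier h hz), map_mul]
    have : 1 / (a - z) = - (1 / (z - a)) := by rw [← neg_sub z a, div_neg]
    rw [this]
    ring
  have hc1 := contOn_cauchy (k.contS (k.sub hb)) (k.geo.not_frontier (k.sub ha))
  have hc2 : ContinuousOn (fun ζ => conj (S ζ a * S ζ b * T ζ)) (frontier Ω) :=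
    continuous_conj.comp_continuousOn ((((k.cont a (k.sub ha)).mono frontier_subset_closure).mul
      ((k.cont b (k.sub hb)).mono frontier_subset_closure)).mul k.geo.contT)
  have i1 : Integrable (fun ζ => -(conj (S ζ b) / (ζ - a))) (Measure.restrict μH[1] (frontier Ω)) := (k.geo.integrable hc1).neg
  rw [setIntegral_congr_fun isClosed_frontier.measurableSet e, integral_add i1 ((k.geo.integrable hc2).const_mul _),
    integral_neg, integral_const_mul, integral_conj, k.SST ha hb]
  simp [E]

/-- the function `Λ` -/
noncomputable def Lam (Ω : Set ℂ) (S : ℂ → ℂ → ℂ) (w a : ℂ) : ℂ := E Ω S w a - 1 / (a - w)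

theorem Ker.lam_antisymm (k : Ker Ω T S A) {a b : ℂ} (ha : a ∈ A) (hb : b ∈ A) : Lam Ω S b a = - Lam Ω S a b := by
  rw [Lam, Lam, k.antisymm ha hb, ← neg_sub b a, div_neg]
  ring

end SK

open MeasureTheory Complex Set Metric ComplexConjugate Filter Topology
open scoped ENNReal NNReal Interval

namespace SK
open Polynomial

theorem bridge (Q : MvPolynomial (Fin 2) ℂ) :
    (∃ F : ℂ[X][X], (∀ x y, (F.map (evalRingHom y)).eval x = MvPolynomial.eval ![x, y] Q)) ∧
    (∃ F : ℂ[X][X], (∀ x y, (F.map (evalRingHom y)).eval x = MvPolynomial.eval ![y, x] Q)) := by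
  constructor
  · refine ⟨MvPolynomial.aeval ![X, C X] Q, fun x y => ?_⟩
    induction Q using MvPolynomial.induction_on with
    | C a => simp [Polynomial.algebraMap_apply]
    | add p q hp hq => simp [hp, hq]
    | mul_X p i hp => 
      rw [map_mul, Polynomial.map_mul, eval_mul, hp]
      fin_cases i <;> simp
  · refine ⟨MvPolynomial.aeval ![C X, X] Q, fun x y => ?_⟩
    induction Q using MvPolynomial.induction_on with
    | C a => simp [Polynomial.algebraMap_apply]
    | add p q hp hq => simp [hp, hq]
    | mul_X p i hp => 
      rw [map_mul, Polynomial.map_mul, eval_mul, hp]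
      fin_cases i <;> simp

theorem bridge_ne {F : ℂ[X][X]} (hF : F ≠ 0) : {y : ℂ | F.map (evalRingHom y) = 0}.Finite := by
  have h : F.leadingCoeff ≠ 0 := leadingCoeff_ne_zero.2 hF
  refine (F.leadingCoeff.roots.toFinset.finite_toSet).subset fun y hy => ?_
  simp only [Finset.mem_coe, Multiset.mem_toFinset, mem_roots h]
  have := congrArg (fun p => coeff p F.natDegree) hy
  simpa [coeff_map] using this

theorem closure_sub_fin {Ω F : Set ℂ} (ho : IsOpen Ω) (hF : F.Finite) : closure Ω ⊆ closure (Ω \ F) := by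
  have hd : Dense (Fᶜ) := by
    rw [compl_eq_univ_sdiff]; exact dense_univ.sdiff_finite hF
  have := hd.open_subset_closure_inter ho
  exact closure_minimal this isClosed_closure

theorem reduce {p q : ℂ[X]} (hq : q ≠ 0) : ∃ g p' q' : ℂ[X], g ≠ 0 ∧ p = g * p' ∧ q = g * q' ∧ IsCoprime p' q' := by
  have hg : EuclideanDomain.gcd p q ≠ 0 := fun h => hq (EuclideanDomain.gcd_eq_zero_iff.1 h).2
  obtain ⟨p', hp⟩ := EuclideanDomain.gcd_dvd_left p q
  obtain ⟨q', hq'⟩ := EuclideanDomain.gcd_dvd_right p q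
  refine ⟨EuclideanDomain.gcd p q, p', q', hg, hp, hq', EuclideanDomain.gcdA p q, EuclideanDomain.gcdB p q, ?_⟩
  apply mul_left_cancel₀ hg
  have h := EuclideanDomain.gcd_eq_gcd_ab p q
  generalize EuclideanDomain.gcd p q = g at *
  generalize EuclideanDomain.gcdA p q = a at *
  generalize EuclideanDomain.gcdB p q = b at *
  rw [mul_one]
  conv_rhs => rw [h]
  conv_rhs => rw [hp, hq']
  ring

theorem coprime_eval {p q : ℂ[X]} (h : IsCoprime p q) {z : ℂ} (hq : q.eval z = 0) : p.eval z ≠ 0 := by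
  obtain ⟨u, v, e⟩ := h
  intro hp
  have := congrArg (eval z) e
  simp [hp, hq] at this

theorem Ker.of {Ω : Set ℂ} {T : ℂ → ℂ} {S : ℂ → ℂ → ℂ} (geo : Geo Ω T)
    (cont : ∀ a ∈ Ω, ContinuousOn (fun z => S z a) (closure Ω))
    (holo : ∀ a ∈ Ω, DifferentiableOn ℂ (fun z => S z a) Ω)
    (herm : ∀ z ∈ Ω, ∀ w ∈ Ω, S z w = conj (S w z))
    (repr : ∀ h : ℂ → ℂ, ContinuousOn h (closure Ω) → DifferentiableOn ℂ h Ω →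
      ∀ a ∈ Ω, h a = ∫ ζ in frontier Ω, h ζ * conj (S ζ a) ∂μH[1])
    (P Q : MvPolynomial (Fin 2) ℂ) (hQ : Q ≠ 0)
    (hPQ : ∀ z ∈ Ω, ∀ w ∈ Ω, S z w * MvPolynomial.eval ![z, conj w] Q = MvPolynomial.eval ![z, conj w] P) :
    ∃ A, Ker Ω T S A := by
  obtain ⟨⟨P1, hP1⟩, P2, hP2⟩ := bridge P
  obtain ⟨⟨Q1, hQ1⟩, Q2, hQ2⟩ := bridge Q
  have e2 : ∀ v : Fin 2 → ℂ, v = ![v 0, v 1] := by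
    intro v; funext i; fin_cases i <;> rfl
  have n1 : Q1 ≠ 0 := by
    rintro rfl
    apply hQ
    apply MvPolynomial.funext
    intro v
    rw [e2 v, ← hQ1]; simp
  have n2 : Q2 ≠ 0 := by
    rintro rfl
    apply hQ
    apply MvPolynomial.funext
    intro v
    rw [e2 v, ← hQ2]; simp
  refine ⟨{a | a ∈ Ω ∧ Q1.map (evalRingHom (conj a)) ≠ 0}, geo, fun a ha => ha.1, ?_, cont, holo, herm, repr, ?_, ?_⟩
  · refine ((bridge_ne n1).preimage (f := fun a : ℂ => conj a) (starRingEnd ℂ).injective.injOn).subset ?_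
    rintro a ⟨ha, ha'⟩
    by_contra h
    exact ha' ⟨ha, h⟩
  · rintro a ⟨ha, hq⟩
    obtain ⟨g, p', q', hg, hp, hq', hc⟩ := reduce (p := P1.map (evalRingHom (conj a))) hq
    refine ⟨p', q', ?_⟩
    have key : ∀ z ∈ closure Ω, S z a * q'.eval z = p'.eval z := by
      have hfin : ((g.roots.toFinset : Set ℂ)).Finite := Finset.finite_toSet _
      have h1 : EqOn (fun z => S z a * q'.eval z) (fun z => p'.eval z) (Ω \ (g.roots.toFinset : Set ℂ)) := by
        rintro z ⟨hz, hzg⟩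
        have hg0 : g.eval z ≠ 0 := by
          intro h0; apply hzg
          simp [hg, h0]
        have := hPQ z hz a ha
        rw [← hQ1, ← hP1, hp, hq', eval_mul, eval_mul] at this
        apply mul_left_cancel₀ hg0
        simp only []
        rw [← this]; ring
      have h2 := h1.of_subset_closure (t := closure Ω) ((cont a ha).mul q'.continuous.continuousOn) p'.continuous.continuousOn
        (sdiff_subset.trans subset_closure) (closure_sub_fin geo.isOpen hfin)
      exact h2
    intro z hz
    refine ⟨fun h0 => ?_, key z hz⟩
    have := key z hz
    rw [h0, mul_zero] at this
    exact coprime_eval hc h0 this.symm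
  · refine ⟨max P2.natDegree Q2.natDegree, _, bridge_ne n2, ?_⟩
    rintro z ⟨hz, hzF⟩
    refine ⟨P2.map (evalRingHom z), Q2.map (evalRingHom z), hzF, natDegree_map_le.trans (le_max_left _ _),
      natDegree_map_le.trans (le_max_right _ _), fun a ha => ?_⟩
    rw [hP2, hQ2]
    exact hPQ z hz a ha

end SK

open MeasureTheory Complex Set Metric ComplexConjugate Filter Topology
open scoped ENNReal NNReal Interval

namespace SK
open Polynomial

theorem exists_functional {ι X : Type*} [Fintype ι] [DecidableEq ι] (v : X → ι → ℂ)
    (h : ∀ a : ι → X, Matrix.det (Matrix.of fun i k => v (a i) k) = 0) : ∃ c : ι → ℂ, c ≠ 0 ∧ ∀ x, ∑ k, c k * v x k = 0 := by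
  by_cases ht : Submodule.span ℂ (range v) = ⊤
  · exfalso
    obtain ⟨b, hb, hs, hl⟩ := exists_linearIndependent ℂ (range v)
    rw [ht] at hs
    have B : Module.Basis b ℂ (ι → ℂ) := Module.Basis.mk hl (by rw [Subtype.range_coe, hs])
    have e : b ≃ ι := B.indexEquiv (Pi.basisFun ℂ ι)
    choose a ha using fun i => hb (e.symm i).2
    have hl2 : LinearIndependent ℂ (fun i => v (a i)) := by
      have := hl.comp e.symm e.symm.injective
      have e2 : (fun i => v (a i)) = Subtype.val ∘ ⇑e.symm := funext ha
      rw [e2]; exact this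
    have : IsUnit (Matrix.of fun i k => v (a i) k) := Matrix.linearIndependent_rows_iff_isUnit.1 hl2
    rw [Matrix.isUnit_iff_isUnit_det, h a] at this
    exact not_isUnit_zero this
  · obtain ⟨f, hf, hle⟩ := Submodule.exists_le_ker_of_lt_top _ (lt_top_iff_ne_top.2 ht)
    refine ⟨fun k => f (Pi.single k 1), ?_, fun x => ?_⟩
    · intro h0
      apply hf
      apply LinearMap.pi_ext'
      intro i
      ext
      simpa using congrFun h0 i
    · have : f (v x) = 0 := hle (Submodule.subset_span ⟨x, rfl⟩)
      rw [← this]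
      conv_rhs => rw [LinearMap.pi_apply_eq_sum_univ f (v x)]
      refine Finset.sum_congr rfl fun k _ => ?_
      rw [smul_eq_mul, mul_comm]
      have e2 : (Pi.single k 1 : ι → ℂ) = fun j => if k = j then 1 else 0 := by
        funext j
        simp [Pi.single_apply, eq_comm]
      simp only [e2]

variable {Ω : Set ℂ} {T : ℂ → ℂ} {S : ℂ → ℂ → ℂ} {A : Set ℂ}

theorem Ker.infinite (k : Ker Ω T S A) : A.Infinite := by
  intro h
  have h1 : Ω.Finite := (h.union k.cofin).subset (by intro x hx; by_cases hA : x ∈ A <;> simp [*])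
  obtain ⟨z, hz⟩ := k.geo.nonempty
  exact infinite_of_mem_nhds z (k.geo.isOpen.mem_nhds hz) h1

theorem contOn_det {ι : Type*} [Fintype ι] [DecidableEq ι] {X : Set ℂ} {M : ℂ → Matrix ι ι ℂ} (h : ∀ i j, ContinuousOn (fun z => M z i j) X) :
    ContinuousOn (fun z => (M z).det) X := by
  simp only [Matrix.det_apply]
  exact continuousOn_finsetSum _ fun σ _ => (continuousOn_finsetProd _ fun i _ => h _ _).const_smul _

theorem diffOn_det {ι : Type*} [Fintype ι] [DecidableEq ι] {X : Set ℂ} {M : ℂ → Matrix ι ι ℂ} (h : ∀ i j, DifferentiableOn ℂ (fun z => M z i j) X) :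
    DifferentiableOn ℂ (fun z => (M z).det) X := by
  simp only [Matrix.det_apply]
  refine DifferentiableOn.fun_sum fun σ _ => DifferentiableOn.const_smul (DifferentiableOn.fun_finsetProd fun i _ => h _ _) _

theorem Ker.det0 (k : Ker Ω T S A) : ∃ m : ℕ, ∀ a : (Fin (m+1) ⊕ Fin (m+1)) → ℂ, (∀ i, a i ∈ A) → ∀ w ∈ closure Ω,
    Matrix.det (Matrix.of fun i => Sum.elim (fun j : Fin (m+1) => a i ^ (j:ℕ) * conj (S w (a i))) (fun j : Fin (m+1) => a i ^ (j:ℕ))) = 0 := by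
  obtain ⟨m, F, hF, h⟩ := k.deg
  refine ⟨m, fun a ha => ?_⟩
  have h1 : EqOn (fun w => Matrix.det (Matrix.of fun i => Sum.elim (fun j : Fin (m+1) => a i ^ (j:ℕ) * conj (S w (a i))) (fun j : Fin (m+1) => a i ^ (j:ℕ)))) (fun _ => 0) (Ω \ F) := by
    intro w hw
    obtain ⟨p, q, hq, hpm, hqm, hh⟩ := h w hw
    apply Matrix.exists_mulVec_eq_zero_iff.1
    refine ⟨Sum.elim (fun j => conj (q.coeff j)) (fun j => - conj (p.coeff j)), ?_, ?_⟩
    · intro h0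
      apply hq
      ext j
      by_cases hj : j < m + 1
      · have := congrFun h0 (Sum.inl ⟨j, hj⟩)
        simpa using this
      · rw [coeff_eq_zero_of_natDegree_lt (by omega)]; simp
    · funext i
      have := congrArg conj (hh (a i) (k.sub (ha i)))
      rw [eval_eq_sum_range' (Nat.lt_succ_of_le hpm), eval_eq_sum_range' (Nat.lt_succ_of_le hqm), Finset.sum_range, Finset.sum_range] at this
      simp only [map_mul, map_sum, map_pow, conj_conj] at this
      simp only [Matrix.mulVec, dotProduct, Matrix.of_apply, Fintype.sum_sum_type, Sum.elim_inl, Sum.elim_inr, Pi.zero_apply, mul_neg, Finset.sum_neg_distrib]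
      rw [← sub_eq_add_neg, sub_eq_zero]
      simp only [Finset.mul_sum] at this
      convert this using 1
      · exact Finset.sum_congr rfl fun j _ => by ring
      · exact Finset.sum_congr rfl fun j _ => by ring
  refine h1.of_subset_closure (t := closure Ω) ?_ continuousOn_const
        (sdiff_subset.trans subset_closure) (closure_sub_fin k.geo.isOpen hF)
  apply contOn_det
  rintro i (j | j)
  · exact continuousOn_const.mul (continuous_conj.comp_continuousOn (k.cont _ (k.sub (ha i))))
  · exact continuousOn_const

theorem Ker.det2 (k : Ker Ω T S A) : ∃ m : ℕ, ∀ a : (Fin (m+1) ⊕ Fin (m+1)) → ℂ, (∀ i, a i ∈ A) → ∀ w ∈ Ω, (∀ i, a i ≠ w) →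
    Matrix.det (Matrix.of fun i => Sum.elim (fun j : Fin (m+1) => a i ^ (j:ℕ) * Lam Ω S w (a i)) (fun j : Fin (m+1) => a i ^ (j:ℕ))) = 0 := by
  obtain ⟨m, hm⟩ := k.det0
  refine ⟨m, fun a ha w hw haw => ?_⟩
  set M1 : ℂ → Matrix (Fin (m+1) ⊕ Fin (m+1)) (Fin (m+1) ⊕ Fin (m+1)) ℂ := fun w => Matrix.of fun i => Sum.elim (fun j : Fin (m+1) => a i ^ (j:ℕ) * ((w - a i) * Eb Ω T S (a i) w + 1)) (fun j : Fin (m+1) => (w - a i) * a i ^ (j:ℕ)) with hM1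
  have hdiff : DiffContOnCl ℂ (fun w => (M1 w).det) Ω := by
    constructor
    · apply diffOn_det
      rintro i (j | j)
      · simp only [hM1, Matrix.of_apply, Sum.elim_inl]
        have := k.Eb_diff (k.sub (ha i))
        fun_prop
      · simp only [hM1, Matrix.of_apply, Sum.elim_inr]
        fun_prop
    · apply contOn_det
      rintro i (j | j)
      · simp only [hM1, Matrix.of_apply, Sum.elim_inl]
        have := k.Eb_cont (ha i)
        fun_prop
      · simp only [hM1, Matrix.of_apply, Sum.elim_inr]
        fun_prop
  have hfr : EqOn (fun w => (M1 w).det) (fun _ => 0) (frontier Ω) := by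
    intro z hz
    have e : M1 z = Matrix.diagonal (fun i => z - a i) * (Matrix.of fun i => Sum.elim (fun j : Fin (m+1) => a i ^ (j:ℕ) * conj (S z (a i))) (fun j : Fin (m+1) => a i ^ (j:ℕ))) * Matrix.diagonal (Sum.elim (fun _ => 2 * Real.pi * I * conj (T z)) (fun _ => 1)) := by
      have hzn : z ∉ Ω := fun h => k.geo.not_frontier h hz
      ext i (j | j)
      · have hne : a i - z ≠ 0 := fun h0 => k.geo.not_frontier (k.sub (ha i)) (sub_eq_zero.1 h0 ▸ hz)
        simp only [hM1, Matrix.of_apply, Sum.elim_inl, Matrix.mul_diagonal, Matrix.diagonal_mul, Eb_of_not_mem hzn]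
        field_simp
        ring
      · simp only [hM1, Matrix.of_apply, Sum.elim_inr, Matrix.mul_diagonal, Matrix.diagonal_mul, mul_one]
    simp only []
    rw [e, Matrix.det_mul, Matrix.det_mul, hm a ha z (frontier_subset_closure hz)]
    simp
  have h0 := Complex.eqOn_of_eqOn_frontier k.geo.bdd hdiff (diffContOnCl_const) hfr hw
  have e : M1 w = Matrix.diagonal (fun i => w - a i) * (Matrix.of fun i => Sum.elim (fun j : Fin (m+1) => a i ^ (j:ℕ) * Lam Ω S w (a i)) (fun j : Fin (m+1) => a i ^ (j:ℕ))) := by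
    ext i (j | j)
    · have hne : a i - w ≠ 0 := sub_ne_zero.2 (haw i)
      simp only [hM1, Matrix.of_apply, Sum.elim_inl, Matrix.diagonal_mul, Eb_of_mem hw, Lam]
      field_simp
      ring
    · simp only [hM1, Matrix.of_apply, Sum.elim_inr, Matrix.diagonal_mul]
  simp only [] at h0
  rw [e, Matrix.det_mul, Matrix.det_diagonal] at h0
  refine (mul_eq_zero.1 h0).resolve_left ?_
  exact Finset.prod_ne_zero_iff.2 fun i _ => sub_ne_zero.2 (haw i).symm

theorem Ker.lam_rat (k : Ker Ω T S A) {w : ℂ} (hw : w ∈ Ω) : ∃ p q : ℂ[X], q ≠ 0 ∧ ∀ a ∈ A, a ≠ w →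
    Lam Ω S w a * q.eval a = p.eval a := by
  obtain ⟨m, hm⟩ := k.det2
  obtain ⟨c, hc, h⟩ := exists_functional (X := {a // a ∈ A ∧ a ≠ w}) (ι := Fin (m+1) ⊕ Fin (m+1))
    (fun a => Sum.elim (fun j : Fin (m+1) => (a:ℂ) ^ (j:ℕ) * Lam Ω S w a) (fun j : Fin (m+1) => (a:ℂ) ^ (j:ℕ)))
    (fun a => hm (fun i => a i) (fun i => (a i).2.1) w hw (fun i => (a i).2.2))
  set q : ℂ[X] := ∑ j : Fin (m+1), C (c (Sum.inl j)) * X ^ (j:ℕ) with hq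
  set p : ℂ[X] := - ∑ j : Fin (m+1), C (c (Sum.inr j)) * X ^ (j:ℕ) with hp
  have key : ∀ a ∈ A, a ≠ w → Lam Ω S w a * q.eval a = p.eval a := by
    intro a ha haw
    have := h ⟨a, ha, haw⟩
    simp only [Fintype.sum_sum_type, Sum.elim_inl, Sum.elim_inr] at this
    simp only [hp, hq, eval_neg, eval_finsetSum, eval_mul, eval_C, eval_pow, eval_X, Finset.mul_sum]
    rw [← sub_eq_zero, sub_neg_eq_add, ← this]
    congr 1
    exact Finset.sum_congr rfl fun j _ => by ring
  have cq : ∀ (d : Fin (m+1) → ℂ) (j : Fin (m+1)), (∑ j : Fin (m+1), C (d j) * X ^ (j:ℕ)).coeff j = d j := by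
    intro d j
    simp only [finsetSum_coeff, coeff_C_mul, coeff_X_pow]
    rw [Finset.sum_eq_single j]
    · simp
    · intro i _ hij
      rw [if_neg (fun h => hij (Fin.ext h.symm)), mul_zero]
    · simp
  refine ⟨p, q, fun hq0 => hc ?_, key⟩
  have hp0 : p = 0 := by
    apply Polynomial.eq_zero_of_infinite_isRoot
    refine (k.infinite.sdiff (finite_singleton w)).mono ?_
    rintro a ⟨ha, haw⟩
    have := key a ha haw
    rw [hq0] at this
    simpa using this.symm
  funext i
  rcases i with j | j
  · rw [← cq (fun j => c (Sum.inl j)) j, ← hq, hq0]; simp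
  · rw [hp, neg_eq_zero] at hp0
    rw [← cq (fun j => c (Sum.inr j)) j, hp0]; simp

theorem Ker.lam_rat2 (k : Ker Ω T S A) {a : ℂ} (ha : a ∈ A) : ∃ p q : ℂ[X], q ≠ 0 ∧
    (∀ w ∈ Ω, w ≠ a → Lam Ω S w a * q.eval w = p.eval w) ∧
    ∀ w ∈ frontier Ω, 2 * Real.pi * I * (conj (S w a) * conj (T w)) * q.eval w = p.eval w := by
  obtain ⟨p, q, hq, h⟩ := k.lam_rat (k.sub ha)
  refine ⟨-p, q, hq, ?_⟩
  have h1 : EqOn (fun w => ((a - w) * Eb Ω T S a w - 1) * q.eval w) (fun w => (a - w) * (-p).eval w) (Ω \ ((Ω \ A) ∪ {a})) := by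
    rintro w ⟨hw, hw'⟩
    have hA : w ∈ A := by by_contra hA; exact hw' (Or.inl ⟨hw, hA⟩)
    have haw : w ≠ a := fun h => hw' (Or.inr h)
    simp only [Eb_of_mem hw]
    have := h w hA haw
    rw [k.lam_antisymm hA ha, Lam] at this
    have hne : a - w ≠ 0 := sub_ne_zero.2 (Ne.symm haw)
    rw [eval_neg, ← this]
    field_simp
  have h2 := h1.of_subset_closure (t := closure Ω) (by
      have := k.Eb_cont ha
      fun_prop) (by fun_prop)
        (sdiff_subset.trans subset_closure) (closure_sub_fin k.geo.isOpen (k.cofin.union (finite_singleton a)))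
  constructor
  · intro w hw haw
    have := h2 (subset_closure hw)
    simp only [Eb_of_mem hw] at this
    have hne : a - w ≠ 0 := sub_ne_zero.2 (Ne.symm haw)
    apply mul_left_cancel₀ hne
    rw [← this, Lam]
    field_simp
  · intro w hw
    have := h2 (frontier_subset_closure hw)
    simp only [Eb_of_not_mem (fun h => k.geo.not_frontier h hw)] at this
    have hne : a - w ≠ 0 := fun h0 => k.geo.not_frontier (k.sub ha) (sub_eq_zero.1 h0 ▸ hw)
    apply mul_left_cancel₀ hne
    rw [← this]
    field_simp
    ring

end SK

open MeasureTheory Complex Set Metric ComplexConjugate Filter Topology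
open scoped ENNReal NNReal Interval

namespace SK
open Polynomial

noncomputable def ev (f : RatFunc ℂ) (z : ℂ) : ℂ := f.num.eval z / f.denom.eval z
def reg (f : RatFunc ℂ) (z : ℂ) : Prop := f.denom.eval z ≠ 0

theorem aM_ne {q : ℂ[X]} {z : ℂ} (hq : q.eval z ≠ 0) : algebraMap ℂ[X] (RatFunc ℂ) q ≠ 0 := by
  intro h
  rw [map_eq_zero_iff _ (RatFunc.algebraMap_injective ℂ)] at h
  simp [h] at hq

theorem ev_div {f : RatFunc ℂ} {p q : ℂ[X]} {z : ℂ} (h : f = algebraMap ℂ[X] (RatFunc ℂ) p / algebraMap ℂ[X] (RatFunc ℂ) q) (hq : q.eval z ≠ 0) :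
    reg f z ∧ ev f z = p.eval z / q.eval z := by
  have hq0 : q ≠ 0 := by rintro rfl; simp at hq
  have hd : f.denom ∣ q := (RatFunc.denom_dvd hq0).2 ⟨p, h⟩
  have hr : f.denom.eval z ≠ 0 := by
    obtain ⟨c, hc⟩ := hd
    intro h0; apply hq; rw [hc]; simp [h0]
  refine ⟨hr, ?_⟩
  have h1 : algebraMap ℂ[X] (RatFunc ℂ) (f.num * q) = algebraMap ℂ[X] (RatFunc ℂ) (p * f.denom) := by
    have h2 := RatFunc.num_div_denom f
    rw [h] at h2
    rw [map_mul, map_mul]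
    rw [div_eq_div_iff (RatFunc.algebraMap_ne_zero (RatFunc.denom_ne_zero _)) (aM_ne hq)] at h2
    rw [← h] at h2
    exact h2
  have h3 := congrArg (eval z) (RatFunc.algebraMap_injective ℂ h1)
  rw [eval_mul, eval_mul] at h3
  rw [ev, div_eq_div_iff hr hq, h3]

variable {f g x : RatFunc ℂ} {z : ℂ}

theorem reg_add (hf : reg f z) (hg : reg g z) : reg (f + g) z ∧ ev (f + g) z = ev f z + ev g z := by
  have h : f + g = algebraMap ℂ[X] (RatFunc ℂ) (f.num * g.denom + g.num * f.denom) / algebraMap ℂ[X] (RatFunc ℂ) (f.denom * g.denom) := by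
    conv_lhs => rw [← RatFunc.num_div_denom f, ← RatFunc.num_div_denom g]
    have h1 := aM_ne hf
    have h2 := aM_ne hg
    simp only [map_add, map_mul]
    field_simp
  have := ev_div h (z := z) (by rw [eval_mul]; exact mul_ne_zero hf hg)
  refine ⟨this.1, this.2.trans ?_⟩
  rw [reg] at hf hg
  simp only [ev, eval_add, eval_mul]
  field_simp

theorem reg_mul (hf : reg f z) (hg : reg g z) : reg (f * g) z ∧ ev (f * g) z = ev f z * ev g z := by
  have h : f * g = algebraMap ℂ[X] (RatFunc ℂ) (f.num * g.num) / algebraMap ℂ[X] (RatFunc ℂ) (f.denom * g.denom) := by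
    conv_lhs => rw [← RatFunc.num_div_denom f, ← RatFunc.num_div_denom g]
    have h1 := aM_ne hf
    have h2 := aM_ne hg
    simp only [map_mul]
    field_simp
  have := ev_div h (z := z) (by rw [eval_mul]; exact mul_ne_zero hf hg)
  refine ⟨this.1, this.2.trans ?_⟩
  rw [reg] at hf hg
  simp only [ev, eval_mul]
  field_simp

theorem reg_aM (p : ℂ[X]) (z : ℂ) : reg (algebraMap ℂ[X] (RatFunc ℂ) p) z ∧ ev (algebraMap ℂ[X] (RatFunc ℂ) p) z = p.eval z := by
  have := ev_div (f := algebraMap ℂ[X] (RatFunc ℂ) p) (p := p) (q := 1) (z := z) (by simp) (by simp)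
  simpa using this

theorem reg_C (c z : ℂ) : reg (RatFunc.C c) z ∧ ev (RatFunc.C c) z = c := by
  have := reg_aM (C c) z
  simpa using this

theorem reg_neg (hf : reg f z) : reg (-f) z ∧ ev (-f) z = - ev f z := by
  have := reg_mul (reg_C (-1) z).1 hf
  rw [(reg_C _ _).2] at this
  simpa using this

theorem reg_sub (hf : reg f z) (hg : reg g z) : reg (f - g) z ∧ ev (f - g) z = ev f z - ev g z := by
  have h1 := reg_neg hg
  have := reg_add hf h1.1
  rwa [h1.2, ← sub_eq_add_neg, ← sub_eq_add_neg] at this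

theorem reg_inv (hf : reg f z) (h0 : ev f z ≠ 0) : reg (f⁻¹) z ∧ ev (f⁻¹) z = (ev f z)⁻¹ := by
  have hn : f.num.eval z ≠ 0 := fun h => h0 (by simp [ev, h])
  have h : f⁻¹ = algebraMap ℂ[X] (RatFunc ℂ) f.denom / algebraMap ℂ[X] (RatFunc ℂ) f.num := by
    conv_lhs => rw [← RatFunc.num_div_denom f]
    rw [inv_div]
  have := ev_div h hn
  exact ⟨this.1, this.2.trans (by rw [ev, inv_div])⟩

theorem reg_aeval (hx : reg x z) (P : ℂ[X]) : reg (aeval x P) z ∧ ev (aeval x P) z = P.eval (ev x z) := by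
  induction P using Polynomial.induction_on with
  | C a => 
    have := reg_C a z
    simpa using this
  | add p q hp hq =>
    have := reg_add hp.1 hq.1
    simpa [hp.2, hq.2] using this
  | monomial n a h =>
    have := reg_mul h.1 hx
    rw [h.2] at this
    simp only [map_mul, map_pow, aeval_X, eval_mul, eval_C, eval_pow, eval_X, pow_succ, aeval_C] at this ⊢
    rw [← mul_assoc, ← mul_assoc]
    exact this

theorem ae_reg (f : RatFunc ℂ) : ∀ᶠ z in cofinite, reg f z := by
  rw [eventually_cofinite]
  refine (f.denom.roots.toFinset.finite_toSet).subset fun z hz => ?_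
  have : f.denom.eval z = 0 := by simpa [reg] using hz
  simp [RatFunc.denom_ne_zero, this]

theorem ae_ne (hf : f ≠ 0) : ∀ᶠ z in cofinite, ev f z ≠ 0 := by
  filter_upwards [ae_reg f, ae_reg f⁻¹] with z h1 h2 h0
  have := reg_mul h1 h2
  rw [mul_inv_cancel₀ hf, h0, zero_mul] at this
  have h3 := (reg_C 1 z).2
  simp only [map_one, this.2] at h3
  exact zero_ne_one h3

theorem eq_of_ev {L : Filter ℂ} [NeBot L] (hL : L ≤ cofinite) (h : ∀ᶠ z in L, ev f z = ev g z) : f = g := by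
  by_contra hne
  obtain ⟨z, h1, h2, h3, h4⟩ := (h.and (((ae_reg f).filter_mono hL).and (((ae_reg g).filter_mono hL).and ((ae_ne (sub_ne_zero.2 hne)).filter_mono hL)))).exists
  rw [(reg_sub h2 h3).2, h1, sub_self] at h4
  exact h4 rfl

def R (L : Filter ℂ) (f g : RatFunc ℂ) : Prop := ∀ᶠ z in L, ev g z = conj (ev f z)

section
variable {L : Filter ℂ} {f' g' : RatFunc ℂ}

theorem R.symm (h : R L f g) : R L g f := by
  filter_upwards [h] with z hz
  rw [hz, conj_conj]

theorem R.unique [NeBot L] (hL : L ≤ cofinite) (h : R L f g) (h' : R L f g') : g = g' := by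
  apply eq_of_ev hL
  filter_upwards [h, h'] with z hz hz'
  rw [hz, hz']

theorem R.add (hL : L ≤ cofinite) (h : R L f g) (h' : R L f' g') : R L (f + f') (g + g') := by
  filter_upwards [h, h', hL (ae_reg f), hL (ae_reg f'), hL (ae_reg g), hL (ae_reg g')] with z h1 h2 h3 h4 h5 h6
  rw [(reg_add h3 h4).2, (reg_add h5 h6).2, h1, h2, map_add]

theorem R.mul (hL : L ≤ cofinite) (h : R L f g) (h' : R L f' g') : R L (f * f') (g * g') := by
  filter_upwards [h, h', hL (ae_reg f), hL (ae_reg f'), hL (ae_reg g), hL (ae_reg g')] with z h1 h2 h3 h4 h5 h6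
  rw [(reg_mul h3 h4).2, (reg_mul h5 h6).2, h1, h2, map_mul]

theorem R.C (c : ℂ) : R L (RatFunc.C c) (RatFunc.C (conj c)) := by
  refine Eventually.of_forall fun z => ?_
  rw [(reg_C _ _).2, (reg_C _ _).2]

theorem R.zero : R L 0 0 := by simpa using R.C (L := L) 0

theorem R.sub (hL : L ≤ cofinite) (h : R L f g) (h' : R L f' g') : R L (f - f') (g - g') := by
  filter_upwards [h, h', hL (ae_reg f), hL (ae_reg f'), hL (ae_reg g), hL (ae_reg g')] with z h1 h2 h3 h4 h5 h6
  rw [(reg_sub h3 h4).2, (reg_sub h5 h6).2, h1, h2, map_sub]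

theorem R.inv [NeBot L] (hL : L ≤ cofinite) (h : R L f g) : R L (f⁻¹) (g⁻¹) := by
  by_cases hf : f = 0
  · subst hf
    have := h.unique hL R.zero
    subst this
    simpa using R.zero
  by_cases hg : g = 0
  · subst hg
    exact absurd (h.symm.unique hL R.zero) hf
  filter_upwards [h, hL (ae_reg f), hL (ae_reg g), hL (ae_ne hf), hL (ae_ne hg)] with z h1 h2 h3 h4 h5
  rw [(reg_inv h2 h4).2, (reg_inv h3 h5).2, h1, map_inv₀]

theorem R.aeval (hL : L ≤ cofinite) (h : R L f g) (P : ℂ[X]) : R L (aeval f P) (aeval g (P.map (starRingEnd ℂ))) := by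
  filter_upwards [h, hL (ae_reg f), hL (ae_reg g)] with z h1 h2 h3
  rw [(reg_aeval h2 P).2, (reg_aeval h3 _).2, h1, eval_map, Polynomial.eval₂_at_apply]

/-- the field of rational functions whose conjugate agrees with a rational function along `L` -/
noncomputable def KF (L : Filter ℂ) [NeBot L] (hL : L ≤ cofinite) : IntermediateField ℂ (RatFunc ℂ) where
  carrier := {f | ∃ g, R L f g}
  mul_mem' := by rintro a b ⟨g, h⟩ ⟨g', h'⟩; exact ⟨_, h.mul hL h'⟩
  add_mem' := by rintro a b ⟨g, h⟩ ⟨g', h'⟩; exact ⟨_, h.add hL h'⟩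
  algebraMap_mem' := by intro c; exact ⟨_, R.C c⟩
  inv_mem' := by rintro a ⟨g, h⟩; exact ⟨_, h.inv hL⟩

theorem mem_KF [NeBot L] {hL : L ≤ cofinite} : f ∈ KF L hL ↔ ∃ g, R L f g := Iff.rfl
end

open IntermediateField in
theorem mobius {t s : RatFunc ℂ} (ht : ¬ ∃ c, t = RatFunc.C c) (hs : s ∈ ℂ⟮t⟯) (hts : t ∈ ℂ⟮s⟯) :
    ∃ α β γ δ : ℂ, (RatFunc.C γ * t + RatFunc.C δ) * s = RatFunc.C α * t + RatFunc.C β ∧ (γ ≠ 0 ∨ δ ≠ 0) := by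
  have htr := t.transcendental_of_ne_C ht
  set e := RatFunc.algEquivOfTranscendental t htr with he
  set u := e.symm ⟨s, hs⟩ with hu
  have hX : e RatFunc.X = ⟨t, mem_adjoin_simple_self ℂ t⟩ := by
    apply Subtype.ext; exact RatFunc.algEquivOfTranscendental_X t htr
  have htop : ℂ⟮u⟯ = ⊤ := by
    rw [eq_top_iff, ← RatFunc.adjoin_X, adjoin_simple_le_iff]
    obtain ⟨r, v, hrv⟩ := (mem_adjoin_simple_iff _ _).1 hts
    refine (mem_adjoin_simple_iff _ _).2 ⟨r, v, ?_⟩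
    apply e.injective
    rw [hX, map_div₀, ← aeval_algHom_apply, ← aeval_algHom_apply, hu, AlgEquiv.apply_symm_apply]
    apply Subtype.ext
    simp only [IntermediateField.coe_div]
    refine hrv.trans ?_
    congr 1
    · exact (aeval_algebraMap_apply (RatFunc ℂ) (⟨s, hs⟩ : ℂ⟮t⟯) r)
    · exact (aeval_algebraMap_apply (RatFunc ℂ) (⟨s, hs⟩ : ℂ⟮t⟯) v)
  have hfin := RatFunc.finrank_eq_max_natDegree u
  rw [htop, IntermediateField.finrank_top] at hfin
  have d1 : u.num.natDegree ≤ 1 := by rw [hfin]; exact le_max_left _ _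
  have d2 : u.denom.natDegree ≤ 1 := by rw [hfin]; exact le_max_right _ _
  have hsu : s = aeval t u.num / aeval t u.denom := by
    rw [← RatFunc.algEquivOfTranscendental_apply t htr, ← he, hu, AlgEquiv.apply_symm_apply]
  have hden : aeval t u.denom ≠ 0 := by
    intro h0
    exact RatFunc.denom_ne_zero u ((transcendental_iff.1 htr) _ h0)
  rw [eq_div_iff hden] at hsu
  have lin : ∀ p : ℂ[X], p.natDegree ≤ 1 → aeval t p = RatFunc.C (p.coeff 1) * t + RatFunc.C (p.coeff 0) := by
    intro p hp
    conv_lhs => rw [Polynomial.eq_X_add_C_of_natDegree_le_one hp]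
    simp
  refine ⟨u.num.coeff 1, u.num.coeff 0, u.denom.coeff 1, u.denom.coeff 0, ?_, ?_⟩
  · rw [← lin _ d1, ← lin _ d2, mul_comm, hsu]
  · by_contra h
    push Not at h
    apply hden
    rw [lin _ d2, h.1, h.2]; simp

end SK

open MeasureTheory Complex Set Metric ComplexConjugate Filter Topology
open scoped ENNReal NNReal Interval

namespace SK
open Polynomial IntermediateField

variable {L : Filter ℂ} [NeBot L] {hL : L ≤ cofinite} {t s x : RatFunc ℂ}

theorem C_mem (K : IntermediateField ℂ (RatFunc ℂ)) (c : ℂ) : RatFunc.C c ∈ K := K.algebraMap_mem c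

theorem adj_affine {a b : ℂ} (ha : a ≠ 0) (hx : x = RatFunc.C a * t + RatFunc.C b) : ℂ⟮x⟯ = ℂ⟮t⟯ := by
  have ha' : RatFunc.C a ≠ 0 := by simpa using ha
  apply le_antisymm
  · rw [adjoin_simple_le_iff, hx]
    exact add_mem (mul_mem (C_mem _ _) (mem_adjoin_simple_self ℂ t)) (C_mem _ _)
  · rw [adjoin_simple_le_iff]
    have : t = (RatFunc.C a)⁻¹ * (x - RatFunc.C b) := by rw [hx]; field_simp; ring
    rw [this]
    exact mul_mem (inv_mem (C_mem _ _)) (sub_mem (mem_adjoin_simple_self ℂ x) (C_mem _ _))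

theorem adj_inv (hx : x = t⁻¹) : ℂ⟮x⟯ = ℂ⟮t⟯ := by
  apply le_antisymm
  · rw [adjoin_simple_le_iff, hx]
    exact inv_mem (mem_adjoin_simple_self ℂ t)
  · rw [adjoin_simple_le_iff]
    have : t = x⁻¹ := by rw [hx, inv_inv]
    rw [this]
    exact inv_mem (mem_adjoin_simple_self ℂ x)

theorem nonconst_of_adj (h : ℂ⟮x⟯ = ℂ⟮t⟯) (ht : ¬ ∃ c, t = RatFunc.C c) : ¬ ∃ c, x = RatFunc.C c := by
  rintro ⟨c, rfl⟩
  apply ht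
  have h1 : ℂ⟮(RatFunc.C c : RatFunc ℂ)⟯ = ⊥ := adjoin_simple_eq_bot_iff.2 (C_mem _ _)
  rw [h1] at h
  have h2 : t ∈ (⊥ : IntermediateField ℂ (RatFunc ℂ)) := by rw [h]; exact mem_adjoin_simple_self ℂ t
  obtain ⟨d, hd⟩ := mem_bot.1 h2
  exact ⟨d, hd.symm⟩

theorem R_swap (hK : KF L hL = ℂ⟮t⟯) (h : R L t s) : s ∈ ℂ⟮t⟯ ∧ t ∈ ℂ⟮s⟯ := by
  have h1 : s ∈ ℂ⟮t⟯ := by rw [← hK]; exact ⟨t, h.symm⟩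
  refine ⟨h1, ?_⟩
  obtain ⟨p, q, hpq⟩ := (mem_adjoin_simple_iff _ _).1 h1
  have h2 : R L s (aeval s (p.map (starRingEnd ℂ)) * (aeval s (q.map (starRingEnd ℂ)))⁻¹) := by
    have := (h.aeval hL p).mul hL ((h.aeval hL q).inv hL)
    rwa [← div_eq_mul_inv, ← hpq] at this
  refine (mem_adjoin_simple_iff _ _).2 ⟨p.map (starRingEnd ℂ), q.map (starRingEnd ℂ), ?_⟩
  rw [div_eq_mul_inv]
  exact h.symm.unique hL h2

theorem exists_real_gen (hK : KF L hL ≠ ⊥) : ∃ x, R L x x ∧ (¬ ∃ c, x = RatFunc.C c) ∧ KF L hL = ℂ⟮x⟯ := by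
  set t := RatFunc.Luroth.generator (KF L hL) with ht
  have hKt : KF L hL = ℂ⟮t⟯ := RatFunc.Luroth.eq_adjoin_generator
  have htc : ¬ ∃ c, t = RatFunc.C c := RatFunc.Luroth.generator_ne_C hK
  have htK : t ∈ KF L hL := by rw [hKt]; exact mem_adjoin_simple_self ℂ t
  obtain ⟨s, hs⟩ := htK
  obtain ⟨z1, h1, h2, h3⟩ := (hs.and (((ae_reg t).filter_mono hL).and ((ae_reg s).filter_mono hL))).exists
  set c := ev t z1
  set u := t - RatFunc.C c with hu
  set v := s - RatFunc.C (conj c) with hv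
  have huv : R L u v := hs.sub hL (R.C c)
  have hu0 : u ≠ 0 := fun h => htc ⟨c, sub_eq_zero.1 h⟩
  have hv0 : v ≠ 0 := fun h => hu0 (by rw [h] at huv; exact huv.symm.unique hL R.zero)
  have ru : reg u z1 ∧ ev u z1 = 0 := by
    have := reg_sub h2 (reg_C c z1).1
    rw [(reg_C c z1).2] at this
    exact ⟨this.1, this.2.trans (sub_self _)⟩
  have rv : reg v z1 ∧ ev v z1 = 0 := by
    have := reg_sub h3 (reg_C (conj c) z1).1
    rw [(reg_C _ z1).2, h1] at this
    exact ⟨this.1, this.2.trans (sub_self _)⟩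
  have hst := huv.inv hL
  have hadj : ℂ⟮u⁻¹⟯ = ℂ⟮t⟯ := by
    rw [adj_inv (t := u) rfl, adj_affine (x := u) (t := t) (a := 1) (b := -c) one_ne_zero]
    rw [hu]; simp [sub_eq_add_neg]
  have hKu : KF L hL = ℂ⟮u⁻¹⟯ := by rw [hadj, hKt]
  have hnc := nonconst_of_adj hadj htc
  obtain ⟨α, β, γ, δ, hm, hgd⟩ := mobius hnc (R_swap hKu hst).1 (R_swap hKu hst).2
  have hm2 : RatFunc.C γ + RatFunc.C δ * u = v * (RatFunc.C α + RatFunc.C β * u) := by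
    field_simp at hm
    rw [← sub_eq_zero] at hm ⊢
    rw [← hm]; ring
  have hγ : γ = 0 := by
    have e1 := reg_mul (reg_C δ z1).1 ru.1
    have e2 := reg_add (reg_C γ z1).1 e1.1
    have e3 := reg_mul (reg_C β z1).1 ru.1
    have e4 := reg_add (reg_C α z1).1 e3.1
    have e5 := reg_mul rv.1 e4.1
    rw [← hm2, e2.2, e1.2, ru.2, rv.2, (reg_C _ _).2] at e5
    simpa using e5.2
  have hδ : δ ≠ 0 := hgd.resolve_left (fun h => h hγ)
  have hδ' : RatFunc.C δ ≠ 0 := by simpa using hδ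
  subst hγ
  have hs1 : v⁻¹ = RatFunc.C (α / δ) * u⁻¹ + RatFunc.C (β / δ) := by
    simp only [map_zero, zero_mul, zero_add] at hm
    rw [map_div₀, map_div₀]
    field_simp
    field_simp at hm
    rw [← sub_eq_zero] at hm ⊢
    rw [← hm]
  by_cases hα : 1 + α / δ = 0
  · have hα' : α / δ = -1 := by linear_combination hα
    have hx : RatFunc.C I * (u⁻¹ - v⁻¹) = RatFunc.C (2 * I) * u⁻¹ + RatFunc.C (- I * (β / δ)) := by
      rw [hs1, hα']
      simp only [map_mul, map_neg, map_one, map_ofNat]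
      ring
    have ha := adj_affine (x := RatFunc.C I * (u⁻¹ - v⁻¹)) (by simp) hx
    refine ⟨RatFunc.C I * (u⁻¹ - v⁻¹), ?_, nonconst_of_adj ha hnc, by rw [hKu, ha]⟩
    have := (R.C (L := L) I).mul hL (hst.sub hL hst.symm)
    convert this using 1
    rw [conj_I, map_neg]; ring
  · have hx : u⁻¹ + v⁻¹ = RatFunc.C (1 + α / δ) * u⁻¹ + RatFunc.C (β / δ) := by
      rw [hs1]
      simp only [map_add, map_one]
      ring
    have ha := adj_affine (x := u⁻¹ + v⁻¹) hα hx
    refine ⟨u⁻¹ + v⁻¹, ?_, nonconst_of_adj ha hnc, by rw [hKu, ha]⟩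
    have := (hst.add hL hst.symm)
    rwa [add_comm (v⁻¹)] at this

end SK

open MeasureTheory Complex Set Metric ComplexConjugate Filter Topology
open scoped ENNReal NNReal Interval

namespace SK
open Polynomial IntermediateField

variable {Ω : Set ℂ} {T : ℂ → ℂ} {S : ℂ → ℂ → ℂ} {A : Set ℂ}

theorem Geo.neBot (g : Geo Ω T) : NeBot (cofinite ⊓ 𝓟 (frontier Ω)) := by
  rw [cofinite_inf_principal_neBot_iff]
  intro hf
  obtain ⟨z, hz⟩ := g.frontier_nonempty
  have := g.perfect _ hf hz
  simp at this

theorem Ker.exists_s (k : Ker Ω T S A) {a : ℂ} (ha : a ∈ A) : ∃ s : RatFunc ℂ, ∀ z ∈ closure Ω, reg s z ∧ ev s z = S z a := by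
  obtain ⟨p, q, h⟩ := k.rat a ha
  refine ⟨algebraMap ℂ[X] (RatFunc ℂ) p / algebraMap ℂ[X] (RatFunc ℂ) q, fun z hz => ?_⟩
  obtain ⟨h1, h2⟩ := h z hz
  have := ev_div (f := algebraMap ℂ[X] (RatFunc ℂ) p / algebraMap ℂ[X] (RatFunc ℂ) q) rfl h1
  refine ⟨this.1, this.2.trans ?_⟩
  rw [div_eq_iff h1, h2]

theorem Ker.exists_l (k : Ker Ω T S A) {a : ℂ} (ha : a ∈ A) : ∃ l : RatFunc ℂ, (∀ w ∈ Ω, w ≠ a → reg l w ∧ ev l w = Lam Ω S w a) ∧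
    ∀ᶠ w in cofinite ⊓ 𝓟 (frontier Ω), ev l w = 2 * Real.pi * I * (conj (S w a) * conj (T w)) := by
  obtain ⟨p, q, hq, h1, h2⟩ := k.lam_rat2 ha
  obtain ⟨g, p', q', hg, hp, hq', hc⟩ := reduce (p := p) hq
  have hfin : ((g.roots.toFinset : Set ℂ)).Finite := Finset.finite_toSet _
  have hgr : ∀ z, z ∉ (g.roots.toFinset : Set ℂ) → g.eval z ≠ 0 := by
    intro z hz h0; apply hz
    simp [hg, h0]
  have key : ∀ w ∈ Ω, w ≠ a → Lam Ω S w a * q'.eval w = p'.eval w := by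
    have e1 : EqOn (fun w => Lam Ω S w a * q'.eval w) (fun w => p'.eval w) ((Ω \ {a}) \ (g.roots.toFinset : Set ℂ)) := by
      rintro w ⟨⟨hw, hwa⟩, hwg⟩
      have := h1 w hw hwa
      rw [hp, hq', eval_mul, eval_mul] at this
      apply mul_left_cancel₀ (hgr w hwg)
      simp only []
      rw [← this]; ring
    have hcont : ContinuousOn (fun w => Lam Ω S w a * q'.eval w) (Ω \ {a}) := by
      refine ContinuousOn.mul (ContinuousOn.sub ?_ ?_) (by fun_prop)
      · exact fun w hw => (k.E_diff (k.sub ha) hw.1).continuousAt.continuousWithinAt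
      · exact continuousOn_const.div (by fun_prop) fun w hw => sub_ne_zero.2 (Ne.symm hw.2)
    have e2 := e1.of_subset_closure hcont (by fun_prop) sdiff_subset
      (subset_closure.trans (closure_sub_fin (k.geo.isOpen.sdiff (finite_singleton a).isClosed) hfin))
    exact fun w hw hwa => e2 ⟨hw, hwa⟩
  refine ⟨algebraMap ℂ[X] (RatFunc ℂ) p' / algebraMap ℂ[X] (RatFunc ℂ) q', fun w hw hwa => ?_, ?_⟩
  · have h3 := key w hw hwa
    have h0 : q'.eval w ≠ 0 := by
      intro h0
      rw [h0, mul_zero] at h3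
      exact coprime_eval hc h0 h3.symm
    have := ev_div (f := algebraMap ℂ[X] (RatFunc ℂ) p' / algebraMap ℂ[X] (RatFunc ℂ) q') rfl h0
    refine ⟨this.1, this.2.trans ?_⟩
    rw [div_eq_iff h0, h3]
  · have hqfin : ((q.roots.toFinset : Set ℂ)).Finite := Finset.finite_toSet _
    rw [eventually_inf_principal]
    filter_upwards [hqfin.compl_mem_cofinite] with w hw hwf
    have hq0 : q.eval w ≠ 0 := by
      intro h0; apply hw
      simp [hq, h0]
    have h3 := h2 w hwf
    have hgq := hq0
    rw [hq', eval_mul] at hgq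
    have := ev_div (f := algebraMap ℂ[X] (RatFunc ℂ) p' / algebraMap ℂ[X] (RatFunc ℂ) q') rfl (right_ne_zero_of_mul hgq)
    rw [this.2, div_eq_iff (right_ne_zero_of_mul hgq)]
    apply mul_left_cancel₀ (left_ne_zero_of_mul hgq)
    rw [hp, hq', eval_mul, eval_mul] at h3
    rw [← h3]; ring

theorem Ker.same (k : Ker Ω T S A) {z z' c : ℂ} (hz : z ∈ Ω) (hz' : z' ∈ Ω) (h : ∀ ζ ∈ frontier Ω, S ζ z' = c * S ζ z) : z = z' := by
  have e : ∀ f : ℂ → ℂ, ContinuousOn f (closure Ω) → DifferentiableOn ℂ f Ω → f z' = conj c * f z := by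
    intro f h1 h2
    rw [k.repr f h1 h2 z' hz', k.repr f h1 h2 z hz, ← integral_const_mul]
    apply setIntegral_congr_fun isClosed_frontier.measurableSet
    intro ζ hζ
    simp only [h ζ hζ, map_mul]
    ring
  have e1 := e (fun _ => 1) continuousOn_const (differentiableOn_const _)
  have e2 := e (fun z => z) continuousOn_id differentiableOn_id
  simp only [mul_one] at e1
  rw [e2, ← e1, one_mul]

theorem Ker.nz (k : Ker Ω T S A) {z : ℂ} (hz : z ∈ Ω) : ¬ ∀ ζ ∈ frontier Ω, S ζ z = 0 := by
  intro h
  have e1 := k.repr (fun _ => 1) continuousOn_const (differentiableOn_const _) z hz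
  rw [setIntegral_congr_fun (g := fun _ => (0:ℂ)) isClosed_frontier.measurableSet (fun ζ hζ => by simp [h ζ hζ])] at e1
  simp at e1

theorem Ker.ext (k : Ker Ω T S A) {z z' c : ℂ} (hz : z ∈ Ω) (hz' : z' ∈ Ω) {F : Set ℂ} (hF : F.Finite)
    (h : ∀ a ∈ A, a ∉ F → S a z' = c * S a z) : ∀ ζ ∈ closure Ω, S ζ z' = c * S ζ z := by
  have e1 : EqOn (fun ζ => S ζ z') (fun ζ => c * S ζ z) (Ω \ ((Ω \ A) ∪ F)) := by
    rintro w ⟨hw, hw'⟩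
    exact h w (by by_contra hA; exact hw' (Or.inl ⟨hw, hA⟩)) (fun h => hw' (Or.inr h))
  exact e1.of_subset_closure (k.cont z' hz') (continuousOn_const.mul (k.cont z hz)) (sdiff_subset.trans subset_closure)
    (closure_sub_fin k.geo.isOpen (k.cofin.union hF))

theorem Ker.exists_b (k : Ker Ω T S A) {z : ℂ} (hz : z ∈ Ω) {F : Set ℂ} (hF : F.Finite) : ∃ b ∈ A, b ∉ F ∧ S z b ≠ 0 := by
  by_contra hcon
  push Not at hcon
  have := k.ext (c := 0) hz hz hF (fun a ha haF => by
    rw [k.herm a (k.sub ha) z hz, hcon a ha haF]; simp)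
  exact k.nz hz fun ζ hζ => by rw [this ζ (frontier_subset_closure hζ), zero_mul]

/-- rational representatives of the kernel and of `Lam`. -/
structure Rep (Ω : Set ℂ) (T : ℂ → ℂ) (S : ℂ → ℂ → ℂ) (A : Set ℂ) (s l : ℂ → RatFunc ℂ) : Prop where
  s_eq : ∀ a ∈ A, ∀ z ∈ closure Ω, reg (s a) z ∧ ev (s a) z = S z a
  l_eq : ∀ a ∈ A, ∀ w ∈ Ω, w ≠ a → reg (l a) w ∧ ev (l a) w = Lam Ω S w a
  l_fr : ∀ a ∈ A, ∀ᶠ w in cofinite ⊓ 𝓟 (frontier Ω), ev (l a) w = 2 * Real.pi * I * (conj (S w a) * conj (T w))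

theorem Ker.exists_rep (k : Ker Ω T S A) : ∃ s l, Rep Ω T S A s l := by
  choose! s hs using fun a (ha : a ∈ A) => k.exists_s ha
  choose! l hl using fun a (ha : a ∈ A) => k.exists_l ha
  exact ⟨s, l, hs, fun a ha => (hl a ha).1, fun a ha => (hl a ha).2⟩

variable {s l : ℂ → RatFunc ℂ} {a b : ℂ}

theorem Ker.s_ne (k : Ker Ω T S A) (r : Rep Ω T S A s l) (ha : a ∈ A) : s a ≠ 0 := by
  intro h
  apply k.nz (k.sub ha)
  intro ζ hζ
  rw [← (r.s_eq a ha ζ (frontier_subset_closure hζ)).2, h]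
  simpa using (reg_C 0 ζ).2

theorem hL (Ω : Set ℂ) : cofinite ⊓ 𝓟 (frontier Ω) ≤ cofinite := inf_le_left

theorem ev_fr (Ω : Set ℂ) : ∀ᶠ w in cofinite ⊓ 𝓟 (frontier Ω), w ∈ frontier Ω := by
  rw [eventually_inf_principal]
  exact Eventually.of_forall fun w hw => hw

theorem Geo.T_ne (g : Geo Ω T) {z : ℂ} (hz : z ∈ frontier Ω) : conj (T z) ≠ 0 := left_ne_zero_of_mul_eq_one (g.TT hz)

theorem Ker.l_ne (k : Ker Ω T S A) (r : Rep Ω T S A s l) (ha : a ∈ A) : l a ≠ 0 := by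
  intro h
  have := k.geo.neBot
  apply k.s_ne r ha
  apply eq_of_ev (hL Ω)
  filter_upwards [r.l_fr a ha, ev_fr Ω] with w h1 h2
  rw [h, show (0 : RatFunc ℂ) = RatFunc.C 0 by simp, (reg_C _ _).2] at h1
  rw [show (0 : RatFunc ℂ) = RatFunc.C 0 by simp, (reg_C _ _).2, (r.s_eq a ha w (frontier_subset_closure h2)).2]
  have h3 := k.geo.T_ne h2
  have h4 : (2 * Real.pi * I : ℂ) ≠ 0 := by simp [Real.pi_ne_zero]
  have h5 := mul_eq_zero.1 ((mul_eq_zero.1 h1.symm).resolve_left h4)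
  simpa using h5.resolve_right h3

theorem Ker.R_F (k : Ker Ω T S A) (r : Rep Ω T S A s l) (ha : a ∈ A) (hb : b ∈ A) :
    R (cofinite ⊓ 𝓟 (frontier Ω)) (s a * (s b)⁻¹) (l a * (l b)⁻¹) := by
  filter_upwards [r.l_fr a ha, r.l_fr b hb, ev_fr Ω, (ae_reg (l a)).filter_mono (hL Ω), (ae_reg (l b)).filter_mono (hL Ω),
    (ae_ne (k.l_ne r hb)).filter_mono (hL Ω), (ae_ne (k.s_ne r hb)).filter_mono (hL Ω)] with w h1 h2 h3 h4 h5 h6 h7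
  have sa := r.s_eq a ha w (frontier_subset_closure h3)
  have sb := r.s_eq b hb w (frontier_subset_closure h3)
  have ib := reg_inv sb.1 h7
  have ilb := reg_inv h5 h6
  rw [(reg_mul sa.1 ib.1).2, (reg_mul h4 ilb.1).2, ib.2, ilb.2, h1, h2, sa.2, sb.2, map_mul, map_inv₀]
  rw [sb.2] at h7
  have h8 := k.geo.T_ne h3
  have h9 : (2 * Real.pi * I : ℂ) ≠ 0 := by simp [Real.pi_ne_zero]
  have h10 : conj (S w b) ≠ 0 := by simpa using h7
  generalize (2 * Real.pi * I : ℂ) = τ at *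
  field_simp

theorem Ker.KF_ne (k : Ker Ω T S A) [NeBot (cofinite ⊓ 𝓟 (frontier Ω))] (r : Rep Ω T S A s l) : KF _ (hL Ω) ≠ ⊥ := by
  intro h
  obtain ⟨b, hb⟩ := k.infinite.nonempty
  obtain ⟨a, ha, hab⟩ := (k.infinite.sdiff (finite_singleton b)).nonempty
  have h1 : s a * (s b)⁻¹ ∈ KF _ (hL Ω) := ⟨_, k.R_F r ha hb⟩
  rw [h] at h1
  obtain ⟨c, hc⟩ := mem_bot.1 h1
  have h2 : s a = RatFunc.C c * s b := by
    rw [show RatFunc.C c = s a * (s b)⁻¹ from hc, mul_assoc, inv_mul_cancel₀ (k.s_ne r hb), mul_one]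
  apply hab
  refine (k.same (c := c) (k.sub hb) (k.sub ha) fun ζ hζ => ?_).symm
  have sa := r.s_eq a ha ζ (frontier_subset_closure hζ)
  have sb := r.s_eq b hb ζ (frontier_subset_closure hζ)
  rw [← sa.2, ← sb.2, h2, (reg_mul (reg_C _ _).1 sb.1).2, (reg_C _ _).2]

end SK

open MeasureTheory Complex Set Metric ComplexConjugate Filter Topology
open scoped ENNReal NNReal Interval

namespace SK
open Polynomial IntermediateField

variable {Ω : Set ℂ} {T : ℂ → ℂ} {S : ℂ → ℂ → ℂ} {A : Set ℂ} {s l : ℂ → RatFunc ℂ} {a b : ℂ} {y : RatFunc ℂ}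

theorem Ker.rel (k : Ker Ω T S A) [NeBot (cofinite ⊓ 𝓟 (frontier Ω))] (r : Rep Ω T S A s l)
    (hy : R (cofinite ⊓ 𝓟 (frontier Ω)) y y) (hK : KF _ (hL Ω) = ℂ⟮y⟯) (ha : a ∈ A) (hb : b ∈ A) :
    ∃ N D : ℂ[X], IsCoprime N D ∧ s a * aeval y D = s b * aeval y N ∧
      l a * aeval y (D.map (starRingEnd ℂ)) = l b * aeval y (N.map (starRingEnd ℂ)) := by
  have hsa := k.s_ne r ha
  have hsb := k.s_ne r hb
  have hla := k.l_ne r ha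
  have hlb := k.l_ne r hb
  have hF := k.R_F r ha hb
  have h1 : s a * (s b)⁻¹ ∈ KF _ (hL Ω) := ⟨_, hF⟩
  rw [hK] at h1
  obtain ⟨p, q, hpq⟩ := (mem_adjoin_simple_iff _ _).1 h1
  have hq0 : aeval y q ≠ 0 := by
    intro h0
    rw [h0, div_zero] at hpq
    exact mul_ne_zero hsa (inv_ne_zero hsb) hpq
  have hq : q ≠ 0 := by rintro rfl; simp at hq0
  obtain ⟨g, N, D, hg, hp, hq', hc⟩ := reduce (p := p) hq
  rw [hq', map_mul] at hq0
  have hg0 := left_ne_zero_of_mul hq0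
  have hD0 := right_ne_zero_of_mul hq0
  have e1 : s a * (s b)⁻¹ = aeval y N * (aeval y D)⁻¹ := by
    rw [hpq, hp, hq', map_mul, map_mul]
    field_simp
  refine ⟨N, D, hc, ?_, ?_⟩
  · field_simp at e1
    exact e1
  · have h2 := (hy.aeval (hL Ω) N).mul (hL Ω) ((hy.aeval (hL Ω) D).inv (hL Ω))
    rw [← e1] at h2
    have e2 := hF.unique (hL Ω) h2
    have hD1 : aeval y (D.map (starRingEnd ℂ)) ≠ 0 := by
      intro h0
      rw [h0, inv_zero, mul_zero] at e2
      exact mul_ne_zero hla (inv_ne_zero hlb) e2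
    field_simp at e2
    exact e2

theorem Ker.inj (k : Ker Ω T S A) [NeBot (cofinite ⊓ 𝓟 (frontier Ω))] (r : Rep Ω T S A s l)
    (hy : R (cofinite ⊓ 𝓟 (frontier Ω)) y y) (hK : KF _ (hL Ω) = ℂ⟮y⟯) {z z' : ℂ} (hz : z ∈ Ω) (hz' : z' ∈ Ω)
    (h1 : reg y z) (h2 : reg y z') (h : ev y z = ev y z') : z = z' := by
  have key : ∀ a ∈ A, ∀ b ∈ A, S z a * S z' b = S z b * S z' a := by
    intro a ha b hb
    obtain ⟨N, D, hc, hr, -⟩ := k.rel r hy hK ha hb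
    have pt : ∀ w ∈ Ω, reg y w → S w a * D.eval (ev y w) = S w b * N.eval (ev y w) := by
      intro w hw hrw
      have sa := r.s_eq a ha w (subset_closure hw)
      have sb := r.s_eq b hb w (subset_closure hw)
      have rD := reg_aeval hrw D
      have rN := reg_aeval hrw N
      rw [← sa.2, ← sb.2, ← rD.2, ← rN.2, ← (reg_mul sa.1 rD.1).2, ← (reg_mul sb.1 rN.1).2, hr]
    have p1 := pt z hz h1
    have p2 := pt z' hz' h2
    rw [← h] at p2
    by_cases hD : D.eval (ev y z) = 0
    · have hN := coprime_eval hc hD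
      apply mul_left_cancel₀ hN
      rw [hD] at p1 p2
      have q1 : S z b = 0 := by simpa [hN] using p1.symm
      have q2 : S z' b = 0 := by simpa [hN] using p2.symm
      rw [q1, q2]; ring
    · apply mul_left_cancel₀ hD
      linear_combination S z' b * p1 - S z b * p2
  obtain ⟨b, hb, -, hSb⟩ := k.exists_b hz finite_empty
  refine k.same (c := conj (S z' b / S z b)) hz hz' ?_
  intro ζ hζ
  refine k.ext hz hz' finite_empty (fun a ha _ => ?_) ζ (frontier_subset_closure hζ)
  rw [k.herm a (k.sub ha) z hz, k.herm a (k.sub ha) z' hz', ← map_mul]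
  congr 1
  field_simp
  linear_combination - key a ha b hb

theorem Ker.not_realA (k : Ker Ω T S A) [NeBot (cofinite ⊓ 𝓟 (frontier Ω))] (r : Rep Ω T S A s l)
    (hy : R (cofinite ⊓ 𝓟 (frontier Ω)) y y) (hK : KF _ (hL Ω) = ℂ⟮y⟯) {z : ℂ} (hz : z ∈ A)
    (h1 : reg y z) (h : conj (ev y z) = ev y z) : False := by
  have hzΩ := k.sub hz
  have key : ∀ a ∈ A, a ≠ z → ∀ b ∈ A, b ≠ z → S z a * conj (Lam Ω S z b) = S z b * conj (Lam Ω S z a) := by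
    intro a ha haz b hb hbz
    obtain ⟨N, D, hc, hr, hr'⟩ := k.rel r hy hK ha hb
    have sa := r.s_eq a ha z (subset_closure hzΩ)
    have sb := r.s_eq b hb z (subset_closure hzΩ)
    have la := r.l_eq a ha z hzΩ haz.symm
    have lb := r.l_eq b hb z hzΩ hbz.symm
    have rD := reg_aeval h1 D
    have rN := reg_aeval h1 N
    have rD' := reg_aeval h1 (D.map (starRingEnd ℂ))
    have rN' := reg_aeval h1 (N.map (starRingEnd ℂ))
    have p1 : S z a * D.eval (ev y z) = S z b * N.eval (ev y z) := by
      rw [← sa.2, ← sb.2, ← rD.2, ← rN.2, ← (reg_mul sa.1 rD.1).2, ← (reg_mul sb.1 rN.1).2, hr]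
    have cc : ∀ P : ℂ[X], (P.map (starRingEnd ℂ)).eval (ev y z) = conj (P.eval (ev y z)) := by
      intro P
      conv_lhs => rw [← h]
      rw [eval_map, eval₂_at_apply]
    have p2 : Lam Ω S z a * conj (D.eval (ev y z)) = Lam Ω S z b * conj (N.eval (ev y z)) := by
      rw [← la.2, ← lb.2, ← cc, ← cc, ← rD'.2, ← rN'.2, ← (reg_mul la.1 rD'.1).2, ← (reg_mul lb.1 rN'.1).2, hr']
    have p3 := congrArg conj p2
    simp only [map_mul, conj_conj] at p3
    by_cases hD : D.eval (ev y z) = 0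
    · have hN := coprime_eval hc hD
      rw [hD] at p1 p3
      have q1 : S z b = 0 := by simpa [hN] using p1.symm
      have q2 : conj (Lam Ω S z b) = 0 := by simpa [hN] using p3.symm
      rw [q1, q2]; ring
    · apply mul_left_cancel₀ hD
      linear_combination conj (Lam Ω S z b) * p1 - S z b * p3
  obtain ⟨b, hb, hbz, hSb⟩ := k.exists_b hzΩ (finite_singleton z)
  set κ := Lam Ω S z b / conj (S z b) with hκ
  have hSb' : conj (S z b) ≠ 0 := by simpa using hSb
  have e1 : EqOn (fun a => (a - z) * (- E Ω S a z - κ * S a z)) (fun _ => 1) (Ω \ ((Ω \ A) ∪ {z})) := by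
    rintro a ⟨ha, ha'⟩
    have haA : a ∈ A := by by_contra hA; exact ha' (Or.inl ⟨ha, hA⟩)
    have haz : a ≠ z := fun h => ha' (Or.inr h)
    have h3 := congrArg conj (key a haA haz b hb hbz)
    simp only [map_mul, conj_conj] at h3
    rw [← k.herm a ha z hzΩ] at h3
    have h4 : Lam Ω S z a = κ * S a z := by
      rw [hκ]; field_simp; linear_combination -h3
    rw [Lam, k.antisymm haA hz] at h4
    have hne : a - z ≠ 0 := sub_ne_zero.2 haz
    simp only [← h4]
    field_simp
    ring
  have e2 := e1.of_subset_closure (t := Ω) (by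
    have c1 : ContinuousOn (fun a => E Ω S a z) Ω := fun w hw => (k.E_diff hzΩ hw).continuousAt.continuousWithinAt
    have c2 : ContinuousOn (fun a => S a z) Ω := (k.cont z hzΩ).mono subset_closure
    fun_prop) continuousOn_const sdiff_subset
    (subset_closure.trans (closure_sub_fin k.geo.isOpen (k.cofin.union (finite_singleton z))))
  have := e2 hzΩ
  simp at this

theorem Ker.not_real (k : Ker Ω T S A) [NeBot (cofinite ⊓ 𝓟 (frontier Ω))] (r : Rep Ω T S A s l)
    (hy : R (cofinite ⊓ 𝓟 (frontier Ω)) y y) (hK : KF _ (hL Ω) = ℂ⟮y⟯) (hc : ¬ ∃ c, y = RatFunc.C c) {z : ℂ} (hz : z ∈ Ω)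
    (h1 : reg y z) (h : conj (ev y z) = ev y z) : False := by
  have han : AnalyticAt ℂ (ev y) z := by
    have a1 : AnalyticAt ℂ (fun w => y.num.eval w) z := (y.num.differentiable.analyticAt z)
    have a2 : AnalyticAt ℂ (fun w => y.denom.eval w) z := (y.denom.differentiable.analyticAt z)
    exact a1.div a2 h1
  rcases han.eventually_constant_or_nhds_le_map_nhds with h0 | h0
  · apply hc
    refine ⟨ev y z, eq_of_ev (L := 𝓝[≠] z) (nhdsNE_le_cofinite z) ?_⟩
    filter_upwards [nhdsWithin_le_nhds h0] with w hw
    rw [(reg_C _ _).2, hw]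
  · have hU : {w | w ∈ Ω ∧ reg y w} ∈ 𝓝 z := by
      have : {w | reg y w} ∈ 𝓝 z := y.denom.continuous.continuousAt.eventually_ne h1
      filter_upwards [k.geo.isOpen.mem_nhds hz, this] with w h2 h3 using ⟨h2, h3⟩
    have hV : ev y '' {w | w ∈ Ω ∧ reg y w} ∈ 𝓝 (ev y z) := h0 (image_mem_map hU)
    have hre : ((ev y z).re : ℂ) = ev y z := conj_eq_iff_re.1 h
    rw [← hre] at hV
    have hV' := Complex.continuous_ofReal.continuousAt.preimage_mem_nhds hV
    have hinf := infinite_of_mem_nhds _ hV'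
    have hfin : ((fun r : ℝ => (r:ℂ)) ⁻¹' (ev y '' (Ω \ A))).Finite := (k.cofin.image _).preimage Complex.ofReal_injective.injOn
    obtain ⟨t, ⟨w, hw, hwt⟩, ht2⟩ := (hinf.sdiff hfin).nonempty
    have hwA : w ∈ A := by
      by_contra hA
      exact ht2 ⟨w, ⟨hw.1, hA⟩, hwt⟩
    refine k.not_realA r hy hK hwA hw.2 ?_
    rw [hwt]; exact conj_ofReal t

theorem Ker.main (k : Ker Ω T S A) : ∃ p q : ℂ[X], IsCoprime p q ∧ (∀ z ∈ Ω, q.eval z ≠ 0 ∧ (p.eval z / q.eval z).im ≠ 0) ∧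
    InjOn (fun z => p.eval z / q.eval z) Ω ∧ ∀ᶠ z in cofinite ⊓ 𝓟 (frontier Ω), q.eval z ≠ 0 ∧ (p.eval z / q.eval z).im = 0 := by
  have := k.geo.neBot
  obtain ⟨s, l, r⟩ := k.exists_rep
  obtain ⟨x, hx, hc, hK⟩ := exists_real_gen (k.KF_ne r)
  have hreg : ∀ z ∈ Ω, reg x z := by
    intro z hz h0
    have hn : x.num.eval z ≠ 0 := coprime_eval (RatFunc.isCoprime_num_denom x) h0
    have hi : x⁻¹ = algebraMap ℂ[X] (RatFunc ℂ) x.denom / algebraMap ℂ[X] (RatFunc ℂ) x.num := by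
      conv_lhs => rw [← RatFunc.num_div_denom x]
      rw [inv_div]
    have h1 := ev_div hi hn
    rw [h0, zero_div] at h1
    refine k.not_real r (hx.inv (hL Ω)) (hK.trans (adj_inv rfl).symm) (nonconst_of_adj (adj_inv rfl) hc) hz h1.1 ?_
    rw [h1.2, map_zero]
  refine ⟨x.num, x.denom, RatFunc.isCoprime_num_denom x, fun z hz => ⟨hreg z hz, fun h0 => ?_⟩, fun z hz z' hz' h => ?_, ?_⟩
  · exact k.not_real r hx hK hc hz (hreg z hz) (conj_eq_iff_im.2 h0)
  · exact k.inj r hx hK hz hz' (hreg z hz) (hreg z' hz') h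
  · filter_upwards [hx, (ae_reg x).filter_mono (hL Ω)] with z h1 h2
    exact ⟨h2, conj_eq_iff_im.1 h1.symm⟩

end SK


open MeasureTheory Complex Set Metric ComplexConjugate Filter Topology
open scoped ENNReal NNReal Interval

namespace SK

theorem annulus_preconnected {r : ℝ} (hr : 0 ≤ r) : IsPreconnected {w : ℂ | r < ‖w‖ ∧ ‖w‖ < 1} := by
  have h1 : IsPreconnected ((Ioo r 1) ×ˢ (univ : Set ℝ)) := isPreconnected_Ioo.prod isPreconnected_univ
  have h2 := h1.image (fun x : ℝ × ℝ => (x.1 : ℂ) * Complex.exp (x.2 * I)) (by fun_prop)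
  convert h2 using 1
  ext w
  constructor
  · rintro ⟨h3, h4⟩
    exact ⟨(‖w‖, w.arg), ⟨⟨h3, h4⟩, mem_univ _⟩, norm_mul_exp_arg_mul_I w⟩
  · rintro ⟨⟨a, b⟩, ⟨⟨h3, h4⟩, -⟩, rfl⟩
    have h0 : 0 ≤ a := hr.trans h3.le
    have : ‖(a : ℂ) * Complex.exp (b * I)‖ = a := by
      rw [norm_mul, Complex.norm_exp_ofReal_mul_I, mul_one, Complex.norm_real, Real.norm_of_nonneg h0]
    exact ⟨this.symm ▸ h3, this.symm ▸ h4⟩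

theorem topo {Ω A B : Set ℂ} {f : ℂ → ℂ} (ho : IsOpen Ω) (hne : Ω.Nonempty)
    (hcp : IsCompact (closure Ω))
    (hf : ContinuousOn f (closure Ω)) (h1 : ∀ z ∈ Ω, ‖f z‖ < 1) (h2 : ∀ z ∈ frontier Ω, ‖f z‖ = 1)
    (hinj : InjOn f Ω) (hop : ∀ U ⊆ Ω, IsOpen U → IsOpen (f '' U))
    (hA : IsCompact A) (hB : IsCompact B) (hAB : Disjoint A B) (hAn : A.Nonempty) (hBn : B.Nonempty)
    (hfr : frontier Ω = A ∪ B) : False := by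
  have hcl : closure Ω = Ω ∪ frontier Ω := by
    rw [ho.frontier_eq, union_sdiff_cancel subset_closure]
  have hD : ball (0:ℂ) 1 ⊆ f '' Ω := by
    refine (convex_ball (0:ℂ) 1).isPreconnected.subset_left_of_subset_union (hop Ω subset_rfl ho)
      (v := (f '' closure Ω)ᶜ) (hcp.image_of_continuousOn hf).isClosed.isOpen_compl ?_ ?_ ?_
    · exact disjoint_compl_right_iff_subset.2 (image_mono subset_closure)
    · intro w hw
      by_cases h : w ∈ f '' closure Ω
      · left
        obtain ⟨z, hz, rfl⟩ := h
        rw [hcl] at hz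
        rcases hz with hz | hz
        · exact ⟨z, hz, rfl⟩
        · rw [mem_ball_zero_iff, h2 z hz] at hw
          exact absurd hw (lt_irrefl _)
      · exact Or.inr h
    · obtain ⟨z, hz⟩ := hne
      exact ⟨f z, mem_ball_zero_iff.2 (h1 z hz), z, hz, rfl⟩
  obtain ⟨U, V, hU, hV, hAU, hBV, hUV⟩ := SeparatedNhds.of_isCompact_isCompact hA hB hAB
  have hK : IsCompact (closure Ω \ (U ∪ V)) := hcp.diff (hU.union hV)
  have hKs : closure Ω \ (U ∪ V) ⊆ Ω := by
    rintro z ⟨hz, hz'⟩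
    rw [hcl, hfr] at hz
    rcases hz with hz | hz | hz
    · exact hz
    · exact absurd (Or.inl (hAU hz)) hz'
    · exact absurd (Or.inr (hBV hz)) hz'
  obtain ⟨r, hr0, hr1, hr⟩ : ∃ r : ℝ, 0 ≤ r ∧ r < 1 ∧ ∀ z ∈ closure Ω \ (U ∪ V), ‖f z‖ ≤ r := by
    by_cases hKn : (closure Ω \ (U ∪ V)).Nonempty
    · obtain ⟨z, hz, hm⟩ := hK.exists_isMaxOn hKn (hf.norm.mono sdiff_subset)
      exact ⟨‖f z‖, norm_nonneg _, h1 z (hKs hz), fun w hw => hm hw⟩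
    · rw [not_nonempty_iff_eq_empty] at hKn
      exact ⟨0, le_rfl, one_pos, by rw [hKn]; simp⟩
  have key : ∀ O : Set ℂ, IsOpen O → ∀ z ∈ O, z ∈ frontier Ω →
      ({w : ℂ | r < ‖w‖ ∧ ‖w‖ < 1} ∩ f '' (Ω ∩ O)).Nonempty := by
    intro O hO z hz hzf
    have hzc : z ∈ closure Ω := frontier_subset_closure hzf
    have hnb : (𝓝[Ω] z).NeBot := mem_closure_iff_nhdsWithin_neBot.1 hzc
    have ht : Tendsto (fun w => ‖f w‖) (𝓝[Ω] z) (𝓝 1) := by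
      have := (hf.norm z hzc).mono_left (nhdsWithin_mono z (subset_closure (s := Ω)))
      simp only [h2 z hzf] at this
      exact this
    have e2 : ∀ᶠ w in 𝓝[Ω] z, w ∈ O := mem_nhdsWithin_of_mem_nhds (hO.mem_nhds hz)
    have e3 : ∀ᶠ w in 𝓝[Ω] z, w ∈ Ω := self_mem_nhdsWithin
    obtain ⟨w, hw1, hw2, hw3⟩ := ((ht.eventually (lt_mem_nhds hr1)).and (e2.and e3)).exists
    exact ⟨f w, ⟨hw1, h1 w hw3⟩, w, ⟨hw3, hw2⟩, rfl⟩
  obtain ⟨a, ha⟩ := hAn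
  obtain ⟨b, hb⟩ := hBn
  obtain ⟨w, -, ⟨z1, hz1, e1⟩, ⟨z2, hz2, e2⟩⟩ := annulus_preconnected hr0 (f '' (Ω ∩ U)) (f '' (Ω ∩ V))
    (hop _ inter_subset_left (ho.inter hU)) (hop _ inter_subset_left (ho.inter hV)) (by
      rintro w ⟨hw1, hw2⟩
      obtain ⟨z, hz, rfl⟩ := hD (mem_ball_zero_iff.2 hw2)
      by_cases h : z ∈ U ∪ V
      · rcases h with h | h
        · exact Or.inl ⟨z, ⟨hz, h⟩, rfl⟩
        · exact Or.inr ⟨z, ⟨hz, h⟩, rfl⟩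
      · exact absurd (hr z ⟨subset_closure hz, h⟩) (not_le.2 hw1))
    (key U hU a (hAU ha) (hfr ▸ Or.inl ha)) (key V hV b (hBV hb) (hfr ▸ Or.inr hb))
  have : z1 = z2 := hinj hz1.1 hz2.1 (e1.trans e2.symm)
  subst this
  exact hUV.le_bot ⟨hz1.2, hz2.2⟩

theorem norm_id (p q : ℂ) (hq : q ≠ 0) :
    ‖p + I * q‖ ^ 2 - ‖p - I * q‖ ^ 2 = 4 * ‖q‖ ^ 2 * (p / q).im := by
  have : (p / q).im * ‖q‖ ^ 2 = (p * conj q).im := by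
    have h : p * conj q = (p / q) * ((‖q‖ ^ 2 : ℝ) : ℂ) := by
      push_cast
      rw [← Complex.mul_conj']; field_simp
    rw [h, Complex.im_mul_ofReal]
  rw [show 4 * ‖q‖ ^ 2 * (p / q).im = 4 * ((p / q).im * ‖q‖ ^ 2) by ring, this, ← Complex.normSq_eq_norm_sq,
    ← Complex.normSq_eq_norm_sq, Complex.normSq_apply, Complex.normSq_apply]
  simp
  ring

theorem open_image {Ω : Set ℂ} {f : ℂ → ℂ} (hf : DifferentiableOn ℂ f Ω)
    (hinj : InjOn f Ω) (U : Set ℂ) (hU : U ⊆ Ω) (hUo : IsOpen U) : IsOpen (f '' U) := by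
  rw [isOpen_iff_mem_nhds]
  rintro _ ⟨z, hz, rfl⟩
  have han : AnalyticAt ℂ f z := (hf.mono hU).analyticAt (hUo.mem_nhds hz)
  rcases han.eventually_constant_or_nhds_le_map_nhds with h0 | h0
  · exfalso
    have e1 : ∀ᶠ w in 𝓝[≠] z, f w = f z := nhdsWithin_le_nhds h0
    have e2 : ∀ᶠ w in 𝓝[≠] z, w ∈ U := mem_nhdsWithin_of_mem_nhds (hUo.mem_nhds hz)
    have e3 : ∀ᶠ w in 𝓝[≠] z, w ≠ z := self_mem_nhdsWithin
    obtain ⟨w, ⟨hw1, hw2⟩, hw3⟩ := ((e1.and e2).and e3).exists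
    exact hw3 (hinj (hU hw2) (hU hz) hw1)
  · exact h0 (image_mem_map (hUo.mem_nhds hz))

theorem final_pos {Ω A B : Set ℂ} {T : ℂ → ℂ} (g : Geo Ω T) (p q : Polynomial ℂ) (hpq : IsCoprime p q)
    (h1 : ∀ z ∈ Ω, q.eval z ≠ 0 ∧ 0 < (p.eval z / q.eval z).im)
    (hinj : InjOn (fun z => p.eval z / q.eval z) Ω)
    (h2 : ∀ᶠ z in cofinite ⊓ 𝓟 (frontier Ω), q.eval z ≠ 0 ∧ (p.eval z / q.eval z).im = 0)
    (hA : IsCompact A) (hB : IsCompact B) (hAB : Disjoint A B) (hAn : A.Nonempty) (hBn : B.Nonempty)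
    (hfr : frontier Ω = A ∪ B) : False := by
  have hcN : Continuous (fun z => p.eval z - I * q.eval z) := by fun_prop
  have hcD : Continuous (fun z => p.eval z + I * q.eval z) := by fun_prop
  have hlt : ∀ z ∈ Ω, ‖p.eval z - I * q.eval z‖ < ‖p.eval z + I * q.eval z‖ := by
    intro z hz
    obtain ⟨h3, h4⟩ := h1 z hz
    have h5 := norm_id (p.eval z) (q.eval z) h3
    have h6 : 0 < 4 * ‖q.eval z‖ ^ 2 * (p.eval z / q.eval z).im := by positivity
    exact lt_of_pow_lt_pow_left₀ 2 (norm_nonneg _) (by linarith)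
  have hle : ∀ z ∈ closure Ω, ‖p.eval z - I * q.eval z‖ ≤ ‖p.eval z + I * q.eval z‖ := by
    intro z hz
    have hcl : IsClosed {z : ℂ | ‖p.eval z - I * q.eval z‖ ≤ ‖p.eval z + I * q.eval z‖} :=
      isClosed_le hcN.norm hcD.norm
    exact closure_minimal (fun z hz => (hlt z hz).le) hcl hz
  have hD : ∀ z ∈ closure Ω, p.eval z + I * q.eval z ≠ 0 := by
    intro z hz h0
    have h3 := hle z hz
    rw [h0, norm_zero] at h3
    have h4 : p.eval z - I * q.eval z = 0 := norm_le_zero_iff.1 h3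
    have h5 : q.eval z = 0 := by
      have : 2 * I * q.eval z = 0 := by linear_combination h0 - h4
      simpa using this
    have h6 : p.eval z = 0 := by rw [h5] at h0; simpa using h0
    exact coprime_eval hpq h5 h6
  have heq : ∀ z ∈ frontier Ω, ‖p.eval z - I * q.eval z‖ = ‖p.eval z + I * q.eval z‖ := by
    have hcl : IsClosed {z : ℂ | ‖p.eval z - I * q.eval z‖ = ‖p.eval z + I * q.eval z‖} :=
      isClosed_eq hcN.norm hcD.norm
    rw [eventually_inf_principal, eventually_cofinite] at h2
    intro z hz
    refine closure_minimal ?_ hcl (g.perfect _ h2 hz)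
    rintro w ⟨hw1, hw2⟩
    simp only [mem_ofPred_eq, not_not] at hw2
    obtain ⟨h3, h4⟩ := hw2 hw1
    have h5 := norm_id (p.eval w) (q.eval w) h3
    rw [h4, mul_zero] at h5
    have h6 : ‖p.eval w - I * q.eval w‖ ^ 2 = ‖p.eval w + I * q.eval w‖ ^ 2 := by linarith
    exact (pow_left_inj₀ (norm_nonneg _) (norm_nonneg _) two_ne_zero).1 h6
  have hinj' : InjOn (fun z => (p.eval z - I * q.eval z) / (p.eval z + I * q.eval z)) Ω := by
    intro z hz w hw h
    have a1 := hD z (subset_closure hz)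
    have a2 := hD w (subset_closure hw)
    have b1 := (h1 z hz).1
    have b2 := (h1 w hw).1
    apply hinj hz hw
    simp only at h ⊢
    rw [div_eq_div_iff a1 a2] at h
    rw [div_eq_div_iff b1 b2]
    have h3 : 2 * I * (p.eval z * q.eval w - p.eval w * q.eval z) = 0 := by linear_combination h
    have h4 : p.eval z * q.eval w - p.eval w * q.eval z = 0 := by simpa using h3
    exact sub_eq_zero.1 h4
  have hdiff : DifferentiableOn ℂ (fun z => (p.eval z - I * q.eval z) / (p.eval z + I * q.eval z)) Ω := by
    apply DifferentiableOn.div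
    · exact (p.differentiable.sub (q.differentiable.const_mul I)).differentiableOn
    · exact (p.differentiable.add (q.differentiable.const_mul I)).differentiableOn
    · exact fun z hz => hD z (subset_closure hz)
  refine topo g.isOpen g.nonempty g.compact_closure (hcN.continuousOn.div hcD.continuousOn hD) ?_ ?_ hinj'
    (open_image hdiff hinj') hA hB hAB hAn hBn hfr
  · intro z hz
    rw [Pi.div_apply, norm_div, div_lt_one (norm_pos_iff.2 (hD z (subset_closure hz)))]
    exact hlt z hz
  · intro z hz
    rw [Pi.div_apply, norm_div, heq z hz, div_self]
    exact norm_ne_zero_iff.2 (hD z (frontier_subset_closure hz))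

theorem final {Ω A B : Set ℂ} {T : ℂ → ℂ} (g : Geo Ω T) (p q : Polynomial ℂ) (hpq : IsCoprime p q)
    (h1 : ∀ z ∈ Ω, q.eval z ≠ 0 ∧ (p.eval z / q.eval z).im ≠ 0)
    (hinj : InjOn (fun z => p.eval z / q.eval z) Ω)
    (h2 : ∀ᶠ z in cofinite ⊓ 𝓟 (frontier Ω), q.eval z ≠ 0 ∧ (p.eval z / q.eval z).im = 0)
    (hA : IsCompact A) (hB : IsCompact B) (hAB : Disjoint A B) (hAn : A.Nonempty) (hBn : B.Nonempty)
    (hfr : frontier Ω = A ∪ B) : False := by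
  have hc : ContinuousOn (fun z => (p.eval z / q.eval z).im) Ω :=
    Complex.continuous_im.comp_continuousOn
      (p.continuous.continuousOn.div q.continuous.continuousOn fun z hz => (h1 z hz).1)
  by_cases hpos : ∀ z ∈ Ω, 0 < (p.eval z / q.eval z).im
  · exact final_pos g p q hpq (fun z hz => ⟨(h1 z hz).1, hpos z hz⟩) hinj h2 hA hB hAB hAn hBn hfr
  · push Not at hpos
    obtain ⟨z0, hz0, hz0'⟩ := hpos
    have hneg : ∀ z ∈ Ω, (p.eval z / q.eval z).im < 0 := by
      intro z hz
      by_contra h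
      push Not at h
      obtain ⟨w, hw, hw'⟩ := g.conn.intermediate_value hz0 hz hc ⟨hz0', h⟩
      exact (h1 w hw).2 hw'
    refine final_pos g (-p) q hpq.neg_left (fun z hz => ⟨(h1 z hz).1, ?_⟩) ?_ ?_ hA hB hAB hAn hBn hfr
    · rw [Polynomial.eval_neg, neg_div, Complex.neg_im]
      exact neg_pos.2 (hneg z hz)
    · intro z hz w hw h
      apply hinj hz hw
      simpa [neg_div] using h
    · filter_upwards [h2] with z hz
      refine ⟨hz.1, ?_⟩
      rw [Polynomial.eval_neg, neg_div, Complex.neg_im, hz.2, neg_zero]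

theorem finish {n : ℕ} (hn : 2 ≤ n) {Ω : Set ℂ} {γ : Fin n → ℝ → ℂ} (h : Dom n Ω γ) {S : ℂ → ℂ → ℂ}
    (cont : ∀ a ∈ Ω, ContinuousOn (fun z => S z a) (closure Ω))
    (holo : ∀ a ∈ Ω, DifferentiableOn ℂ (fun z => S z a) Ω)
    (herm : ∀ z ∈ Ω, ∀ w ∈ Ω, S z w = conj (S w z))
    (repr : ∀ h : ℂ → ℂ, ContinuousOn h (closure Ω) → DifferentiableOn ℂ h Ω →
      ∀ a ∈ Ω, h a = ∫ ζ in frontier Ω, h ζ * conj (S ζ a) ∂μH[1])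
    (P Q : MvPolynomial (Fin 2) ℂ) (hQ : Q ≠ 0)
    (hPQ : ∀ z ∈ Ω, ∀ w ∈ Ω,
      S z w * MvPolynomial.eval ![z, conj w] Q = MvPolynomial.eval ![z, conj w] P) : False := by
  obtain ⟨γ', h', -, hpos⟩ := h.orient
  have g := h'.geo hpos
  obtain ⟨A, k⟩ := Ker.of g cont holo herm repr P Q hQ hPQ
  obtain ⟨p, q, hpq, h1, hinj, h2⟩ := k.main
  let i0 : Fin n := ⟨0, by omega⟩
  let i1 : Fin n := ⟨1, by omega⟩
  have h01 : i1 ≠ i0 := by simp [i0, i1]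
  refine final g p q hpq h1 hinj h2 (A := range (γ i0)) (B := ⋃ j : {j : Fin n // j ≠ i0}, range (γ j))
    (h.curve i0).isCompact_range (isCompact_iUnion fun j => (h.curve j).isCompact_range) ?_
    (range_nonempty _) ⟨γ i1 0, mem_iUnion.2 ⟨⟨i1, h01⟩, mem_range_self _⟩⟩ ?_
  · rw [disjoint_iUnion_right]
    exact fun j => h.disj _ _ j.2.symm
  · rw [h.bd]
    ext z
    simp only [mem_iUnion, mem_union]
    constructor
    · rintro ⟨j, hj⟩
      by_cases e : j = i0
      · left; rwa [e] at hj
      · exact Or.inr ⟨⟨j, e⟩, hj⟩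
    · rintro (hz | ⟨j, hj⟩)
      · exact ⟨_, hz⟩
      · exact ⟨_, hj⟩

end SK

/-- the Szegő kernel of a smoothly bounded domain of connectivity `n ≥ 2`
is not rational. -/
theorem szego_kernel_not_rational
    (n : ℕ) (hn : 2 ≤ n) (Ω : Set ℂ) (γ : Fin n → ℝ → ℂ)
    (hΩ : IsSmoothMultiplyConnectedDomain n Ω γ)
    (S : ℂ → ℂ → ℂ) (hS : IsSzegoKernel Ω S) :
    ¬ ∃ P Q : MvPolynomial (Fin 2) ℂ, Q ≠ 0 ∧
      ∀ z ∈ Ω, ∀ w ∈ Ω,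
        S z w * MvPolynomial.eval ![z, conj w] Q = MvPolynomial.eval ![z, conj w] P := by
  rintro ⟨P, Q, hQ, hPQ⟩
  have h : SK.Dom n Ω γ :=
    { nonempty := hΩ.nonempty
      isOpen := hΩ.isOpen
      conn := hΩ.isConnected.isPreconnected
      bdd := hΩ.isBounded
      curve := fun j => SK.Curve.of_injOn ((hΩ.smooth j).of_le (WithTop.coe_le_coe.2 (le_top : (2 : ℕ∞) ≤ ⊤)))
        (hΩ.periodic j) (hΩ.injOn j) (hΩ.deriv_ne j)
      bd := hΩ.boundary_eq
      disj := hΩ.disjointImages }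
  exact SK.finish hn h hS.continuousOn hS.holo hS.hermitian hS.reproducing P Q hQ hPQ
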